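/- Every non-trivial simple cuspidal strong Harish-Chandra module for V = W(m,n) or V = W(m,n) ⋉ A d_0 is a quotient of a tensor AV-module. -/

import Mathlib

open scoped BigOperators

namespace WSuper

noncomputable section

/-- Exponents of the Laurent (even) variables `t_1, …, t_m`. -/
abbrev LExp (m : ℕ) := Fin m → ℤ
/-- Exponents of the Grassmann (odd) variables `ξ_1, …, ξ_n`. -/
abbrev GExp (n : ℕ) := Fin n → Bool

variable {m n : ℕ}

/-- Degree of a Grassmann monomial `ξ^s`. -/
def gdeg (s : GExp n) : ℕ := (Finset.univ.filter fun a => s a = true).card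

/-- Number of inversions between `ξ^s` and `ξ^q`. -/
def invCount (s q : GExp n) : ℕ :=
  ((Finset.univ ×ˢ Finset.univ).filter
    fun p : Fin n × Fin n => s p.1 = true ∧ q p.2 = true ∧ p.2 < p.1).card

/-- The scalar `c` with `ξ^s · ξ^q = c · ξ^(s xor q)` in the exterior algebra. -/
def mulSgn (s q : GExp n) : ℂ :=
  if ∃ a, s a = true ∧ q a = true then 0 else (-1 : ℂ) ^ invCount s q

/-- Exponent of the product of two (disjoint) Grassmann monomials. -/
def xorE (s q : GExp n) : GExp n := fun a => Bool.xor (s a) (q a)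

/-- The scalar `c` with `∂_a (ξ^s) = c ξ^(s \ a)`. -/
def derC (a : Fin n) (s : GExp n) : ℂ :=
  if s a = true then (-1 : ℂ) ^ (Finset.univ.filter fun x => s x = true ∧ x < a).card else 0

/-- The exponent of `∂_a (ξ^s)`. -/
def derE (a : Fin n) (s : GExp n) : GExp n := Function.update s a false

/-- Directions: `d_i = t_i ∂/∂t_i`, `∂_α = ∂/∂ξ_α`, and (when `b = true`) the extra
even direction `d_0` of `W(m,n) ⋉ A d_0`. -/
inductive Dir (m n : ℕ) : Bool → Type where
  | di {b : Bool} (i : Fin m) : Dir m n b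
  | pa {b : Bool} (a : Fin n) : Dir m n b
  | d0 : Dir m n true

/-- The basis `t^r ξ^s D` of `W(m,n)` (for `b = false`) resp. of `W(m,n) ⋉ A d_0`
(for `b = true`). -/
abbrev WBasis (m n : ℕ) (b : Bool) := LExp m × GExp n × Dir m n b

/-- The Lie superalgebra `W(m,n)` (`b = false`) resp. `W(m,n) ⋉ A d_0` (`b = true`),
as the free complex vector space on its standard basis. -/
abbrev W (m n : ℕ) (b : Bool) := WBasis m n b →₀ ℂ

def sng {b : Bool} (x : WBasis m n b) : W m n b := Finsupp.single x 1

/-- Parity (0 = even, 1 = odd) of a basis element. -/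
def par {b : Bool} : WBasis m n b → ℕ
  | ⟨_, s, .di _⟩ => gdeg s % 2
  | ⟨_, s, .pa _⟩ => (gdeg s + 1) % 2
  | ⟨_, s, .d0⟩ => gdeg s % 2

/-- The super Lie bracket of `W(m,n)` (resp. `W(m,n) ⋉ A d_0`) on basis elements. -/
def brB {b : Bool} : WBasis m n b → WBasis m n b → W m n b
  | ⟨r, s, .di i⟩, ⟨p, q, .di j⟩ =>
      ((p i : ℂ) * mulSgn s q) • sng ⟨r + p, xorE s q, .di j⟩
        - ((r j : ℂ) * mulSgn s q) • sng ⟨r + p, xorE s q, .di i⟩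
  | ⟨r, s, .di i⟩, ⟨p, q, .pa β⟩ =>
      ((p i : ℂ) * mulSgn s q) • sng ⟨r + p, xorE s q, .pa β⟩
        - ((-1 : ℂ) ^ (gdeg s * (gdeg q + 1)) * derC β s * mulSgn q (derE β s)) •
            sng ⟨r + p, xorE q (derE β s), .di i⟩
  | ⟨r, s, .pa α⟩, ⟨p, q, .di j⟩ =>
      (derC α q * mulSgn s (derE α q)) • sng ⟨r + p, xorE s (derE α q), .di j⟩
        - ((-1 : ℂ) ^ ((gdeg s + 1) * gdeg q) * (r j : ℂ) * mulSgn q s) •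
            sng ⟨r + p, xorE q s, .pa α⟩
  | ⟨r, s, .pa α⟩, ⟨p, q, .pa β⟩ =>
      (derC α q * mulSgn s (derE α q)) • sng ⟨r + p, xorE s (derE α q), .pa β⟩
        - ((-1 : ℂ) ^ ((gdeg s + 1) * (gdeg q + 1)) * derC β s * mulSgn q (derE β s)) •
            sng ⟨r + p, xorE q (derE β s), .pa α⟩
  | ⟨r, s, .di i⟩, ⟨p, q, .d0⟩ =>
      ((p i : ℂ) * mulSgn s q) • sng ⟨r + p, xorE s q, .d0⟩
  | ⟨r, s, .pa α⟩, ⟨p, q, .d0⟩ =>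
      (derC α q * mulSgn s (derE α q)) • sng ⟨r + p, xorE s (derE α q), .d0⟩
  | ⟨r, s, .d0⟩, ⟨p, q, .di j⟩ =>
      (-(r j : ℂ) * mulSgn s q) • sng ⟨r + p, xorE s q, .d0⟩
  | ⟨r, s, .d0⟩, ⟨p, q, .pa β⟩ =>
      (-(-1 : ℂ) ^ (gdeg s * (gdeg q + 1)) * derC β s * mulSgn q (derE β s)) •
          sng ⟨r + p, xorE q (derE β s), .d0⟩
  | ⟨_, _, .d0⟩, ⟨_, _, .d0⟩ => 0

/-- A module over the Lie superalgebra `W(m,n)` (resp. `W(m,n) ⋉ A d_0`):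
a complex vector space with a linear action satisfying the super commutator rule. -/
structure WRep (m n : ℕ) (b : Bool) where
  M : Type
  [addgrp : AddCommGroup M]
  [mods : Module ℂ M]
  act : W m n b →ₗ[ℂ] M →ₗ[ℂ] M
  super : ∀ x y : WBasis m n b,
    act (brB x y)
      = act (sng x) ∘ₗ act (sng y)
        - ((-1 : ℂ) ^ (par x * par y)) • (act (sng y) ∘ₗ act (sng x))

attribute [instance] WRep.addgrp WRep.mods

/-- A raw action of (the basis of) `W(m,n)` resp. `W(m,n) ⋉ A d_0` on a vector space. -/
abbrev GAct (m n : ℕ) (b : Bool) (M : Type) [AddCommGroup M] [Module ℂ M] :=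
  WBasis m n b → M →ₗ[ℂ] M

/-- Index set for the Cartan subalgebra `h'`: the elements `d_1, …, d_m`,
together with `d_0` when `b = true`. -/
abbrev HIdx (m : ℕ) (b : Bool) := Fin m ⊕ Fin (cond b 1 0)

def hB (m n : ℕ) (b : Bool) : HIdx m b → WBasis m n b :=
  fun h => match b, h with
    | _, .inl i => ⟨0, fun _ => false, .di i⟩
    | true, .inr _ => ⟨0, fun _ => false, .d0⟩
    | false, .inr j => j.elim0

/-- The basis element `ξ_a ∂_a` of the odd Cartan subalgebra `h''`. -/
def hppB (m n : ℕ) (b : Bool) (a : Fin n) : WBasis m n b :=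
  ⟨0, fun x => decide (x = a), .pa a⟩

section Predicates

variable {M : Type} [AddCommGroup M] [Module ℂ M] {b : Bool}

/-- Weight space with respect to the even Cartan subalgebra `h'`. -/
def wtG (F : GAct m n b M) (lam : HIdx m b → ℂ) : Submodule ℂ M :=
  ⨅ h, LinearMap.ker (F (hB m n b h) - lam h • (LinearMap.id : M →ₗ[ℂ] M))

/-- Weight space with respect to the full Cartan subalgebra `h = h' ⊕ h''`. -/
def wtFullG (F : GAct m n b M) (lam : HIdx m b → ℂ) (mu : Fin n → ℂ) : Submodule ℂ M :=
  wtG F lam ⊓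
    ⨅ a, LinearMap.ker (F (hppB m n b a) - mu a • (LinearMap.id : M →ₗ[ℂ] M))

/-- Strong Harish-Chandra module: weight decomposition with respect to `h'`
with finite-dimensional weight spaces. -/
def IsStrongHCG (F : GAct m n b M) : Prop :=
  (⨆ lam, wtG F lam) = ⊤ ∧ ∀ lam, FiniteDimensional ℂ (wtG F lam)

/-- Harish-Chandra module: weight decomposition with respect to `h`
with finite-dimensional weight spaces. -/
def IsHCG (F : GAct m n b M) : Prop :=
  (⨆ lam, ⨆ mu, wtFullG F lam mu) = ⊤ ∧
    ∀ lam mu, FiniteDimensional ℂ (wtFullG F lam mu)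

/-- Strongly cuspidal: strong Harish-Chandra with uniformly bounded multiplicities. -/
def IsStronglyCuspidalG (F : GAct m n b M) : Prop :=
  IsStrongHCG F ∧ ∃ C : ℕ, ∀ lam, Module.finrank ℂ (wtG F lam) ≤ C

/-- Cuspidal: Harish-Chandra with uniformly bounded weight multiplicities. -/
def IsCuspidalG (F : GAct m n b M) : Prop :=
  IsHCG F ∧ ∃ C : ℕ, ∀ lam mu, Module.finrank ℂ (wtFullG F lam mu) ≤ C

/-- The action of the odd Cartan subalgebra `h''` is diagonalizable. -/
def DiagHppG (F : GAct m n b M) : Prop :=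
  (⨆ mu : Fin n → ℂ,
    ⨅ a, LinearMap.ker (F (hppB m n b a) - mu a • (LinearMap.id : M →ₗ[ℂ] M))) = ⊤

def InvariantG (F : GAct m n b M) (N : Submodule ℂ M) : Prop :=
  ∀ x : WBasis m n b, ∀ v ∈ N, F x v ∈ N

/-- Simplicity of a module, phrased via invariant subspaces. -/
def IsSimpleG (F : GAct m n b M) : Prop :=
  (∃ v : M, v ≠ 0) ∧ ∀ N : Submodule ℂ M, InvariantG F N → N = ⊥ ∨ N = ⊤

end Predicates

/-- The action of basis elements attached to a representation. -/
def WRep.g {b : Bool} (ρ : WRep m n b) : GAct m n b ρ.M := fun x => ρ.act (sng x)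

end

end WSuper

namespace WSuper

noncomputable section

variable {m n : ℕ}

/-- Basis monomials `t^r ξ^s` of the supercommutative superalgebra `A = R_m ⊗ Λ`. -/
abbrev ABasis (m n : ℕ) := LExp m × GExp n

/-- The supercommutative superalgebra `A = R_m ⊗ Λ` as the free complex vector
space on its monomial basis. -/
abbrev AAlg (m n : ℕ) := ABasis m n →₀ ℂ

def asng (x : ABasis m n) : AAlg m n := Finsupp.single x 1

def aone (m n : ℕ) : AAlg m n := asng (0, fun _ => false)

/-- Product of two monomials of `A`. -/
def amulB (x y : ABasis m n) : AAlg m n :=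
  mulSgn x.2 y.2 • asng (x.1 + y.1, xorE x.2 y.2)

/-- Parity of a monomial of `A`. -/
def apar (x : ABasis m n) : ℕ := gdeg x.2 % 2

/-- The action of a basis element of `W(m,n)` (resp. `W(m,n) ⋉ A d_0`) on a
monomial of `A` by superderivations (`d_0` acts by zero on `A`). -/
def wOnA {b : Bool} : WBasis m n b → ABasis m n → AAlg m n
  | ⟨r, s, .di i⟩, ⟨p, q⟩ => ((p i : ℂ) * mulSgn s q) • asng (r + p, xorE s q)
  | ⟨r, s, .pa α⟩, ⟨p, q⟩ =>
      (derC α q * mulSgn s (derE α q)) • asng (r + p, xorE s (derE α q))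
  | ⟨_, _, .d0⟩, _ => 0

/-- An `AV`-module: compatible actions of the superalgebra `A` and of the Lie
superalgebra `V = W(m,n)` (resp. `W(m,n) ⋉ A d_0`), satisfying the Leibniz rule. -/
structure AVRep (m n : ℕ) (b : Bool) extends WRep m n b where
  aact : AAlg m n →ₗ[ℂ] M →ₗ[ℂ] M
  aact_one : aact (aone m n) = LinearMap.id
  aact_mul : ∀ x y : ABasis m n, aact (amulB x y) = aact (asng x) ∘ₗ aact (asng y)
  leibniz : ∀ (x : WBasis m n b) (f : ABasis m n),
    act (sng x) ∘ₗ aact (asng f)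
      = aact (wOnA x f)
        + ((-1 : ℂ) ^ (par x * apar f)) • (aact (asng f) ∘ₗ act (sng x))

/-- `M` is finitely generated as an `A`-module. -/
def IsFiniteRank {b : Bool} (ρ : AVRep m n b) : Prop :=
  ∃ S : Finset ρ.M,
    Submodule.span ℂ {v : ρ.M | ∃ f : ABasis m n, ∃ s ∈ S, v = ρ.aact (asng f) s} = ⊤

/-- A subspace invariant under both the `A`-action and the `V`-action. -/
def AVInvariant {b : Bool} (ρ : AVRep m n b) (N : Submodule ℂ ρ.M) : Prop :=
  InvariantG ρ.g N ∧ ∀ f : ABasis m n, ∀ v ∈ N, ρ.aact (asng f) v ∈ N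

/-- Irreducibility as an `AV`-module. -/
def AVIsSimple {b : Bool} (ρ : AVRep m n b) : Prop :=
  (∃ v : ρ.M, v ≠ 0) ∧ ∀ N : Submodule ℂ ρ.M, AVInvariant ρ N → N = ⊥ ∨ N = ⊤

/-- A weight module: weight decomposition with respect to `h'`. -/
def IsWeightG {M : Type} [AddCommGroup M] [Module ℂ M] {b : Bool}
    (F : GAct m n b M) : Prop :=
  (⨆ lam, wtG F lam) = ⊤

end

end WSuper

namespace WSuper

noncomputable section

variable {m n : ℕ}

/-- Index set for the standard basis `e_{xy}` of `gl(m,n)`. -/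
abbrev GlIdx (m n : ℕ) := Fin m ⊕ Fin n

/-- Parity of an index of `gl(m,n)`. -/
def gpar : GlIdx m n → ℕ
  | .inl _ => 0
  | .inr _ => 1

/-- A module over the Lie superalgebra `gl(m,n)`, given by the action of the
standard basis elements `e_{xy}` subject to the super commutator relations. -/
structure GlRep (m n : ℕ) where
  V : Type
  [addgrp : AddCommGroup V]
  [mods : Module ℂ V]
  ρ : GlIdx m n → GlIdx m n → Module.End ℂ V
  rel : ∀ x y z w : GlIdx m n,
    ρ x y * ρ z w
        - ((-1 : ℂ) ^ ((gpar x + gpar y) * (gpar z + gpar w))) • (ρ z w * ρ x y)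
      = (if y = z then ρ x w else 0)
        - ((-1 : ℂ) ^ ((gpar x + gpar y) * (gpar z + gpar w))) •
            (if w = x then ρ z y else 0)

attribute [instance] GlRep.addgrp GlRep.mods

/-- Irreducibility of a `gl(m,n)`-module. -/
def GlRep.IsSimple (σ : GlRep m n) : Prop :=
  (∃ v : σ.V, v ≠ 0) ∧
    ∀ N : Submodule ℂ σ.V, (∀ x y, ∀ v ∈ N, σ.ρ x y v ∈ N) → N = ⊥ ∨ N = ⊤

/-- The carrier `A ⊗ V` of a tensor module. -/
abbrev TModule (σ : GlRep m n) := ABasis m n →₀ σ.V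

/-- The action of `W(m,n)` (resp. `W(m,n) ⋉ A d_0`, where `f d_0` acts as
multiplication by `λ_0 f`) on the tensor module `T(V, λ) = A ⊗ V`:
`(t^s f d_j)(t^r g ⊗ v) = (r_j + λ_j) t^{r+s} f g ⊗ v
  + Σ_i s_i t^{r+s} f ⊗ ρ(e_{ij}) g·v + Σ_α t^{r+s} (f)∂*_α ⊗ ρ(e_{αj}) g·v`,
`(t^s f ∂_β)(t^r g ⊗ v) = t^{r+s} f (∂g/∂ξ_β) ⊗ v
  + Σ_i s_i t^{r+s} f ⊗ ρ(e_{iβ}) g·v + Σ_α t^{r+s} (f)∂*_α ⊗ ρ(e_{αβ}) g·v`,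
with `(f)∂*_α = (−1)^{|f|+1} ∂_α(f)` and the usual Koszul signs for applying an
operator `a ⊗ ρ(e)` with `e` odd to `g ⊗ v`. -/
def tmAct (σ : GlRep m n) (lam : Fin m → ℂ) (lam0 : ℂ) {b : Bool} :
    WBasis m n b → TModule σ → TModule σ
  | ⟨s, f, .di j⟩, u => u.sum fun rc v =>
      ((((rc.1 j : ℂ) + lam j) * mulSgn f rc.2) •
          Finsupp.single (rc.1 + s, xorE f rc.2) v)
      + (∑ i : Fin m, ((s i : ℂ) * mulSgn f rc.2) •
          Finsupp.single (rc.1 + s, xorE f rc.2) (σ.ρ (.inl i) (.inl j) v))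
      + (∑ α : Fin n,
          ((-1 : ℂ) ^ gdeg rc.2 * ((-1 : ℂ) ^ (gdeg f + 1) * derC α f) *
              mulSgn (derE α f) rc.2) •
            Finsupp.single (rc.1 + s, xorE (derE α f) rc.2) (σ.ρ (.inr α) (.inl j) v))
  | ⟨s, f, .pa β⟩, u => u.sum fun rc v =>
      ((derC β rc.2 * mulSgn f (derE β rc.2)) •
          Finsupp.single (rc.1 + s, xorE f (derE β rc.2)) v)
      + (∑ i : Fin m, ((-1 : ℂ) ^ gdeg rc.2 * (s i : ℂ) * mulSgn f rc.2) •
          Finsupp.single (rc.1 + s, xorE f rc.2) (σ.ρ (.inl i) (.inr β) v))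
      + (∑ α : Fin n,
          (((-1 : ℂ) ^ (gdeg f + 1) * derC α f) * mulSgn (derE α f) rc.2) •
            Finsupp.single (rc.1 + s, xorE (derE α f) rc.2) (σ.ρ (.inr α) (.inr β) v))
  | ⟨s, f, .d0⟩, u => u.sum fun rc v =>
      (lam0 * mulSgn f rc.2) • Finsupp.single (rc.1 + s, xorE f rc.2) v

/-- The action of `A` on the tensor module `A ⊗ V` by multiplication on the
left tensor factor. -/
def tmA {σ : GlRep m n} (x : ABasis m n) (u : TModule σ) : TModule σ :=
  u.sum fun rc v => mulSgn x.2 rc.2 • Finsupp.single (x.1 + rc.1, xorE x.2 rc.2) v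

end

end WSuper

set_option linter.unusedSectionVars false
set_option linter.unusedSimpArgs false

namespace WSuper

open scoped AddMonoidAlgebra


noncomputable section

section Laurent

variable {G G' V : Type*} [AddCommGroup G] [AddCommGroup G'] [AddCommGroup V] [Module ℂ V]

/-- The monomial of exponent `a`. -/
abbrev mon (a : G) : AddMonoidAlgebra ℂ G := AddMonoidAlgebra.single a 1

/-- The linear extension of a function on exponents. -/
def evl (F : G → V) : AddMonoidAlgebra ℂ G →ₗ[ℂ] V :=
  Finsupp.linearCombination ℂ F ∘ₗ (AddMonoidAlgebra.coeffLinearEquiv ℂ).toLinearMap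

@[simp] lemma evl_single (F : G → V) (a : G) (c : ℂ) :
    evl F (AddMonoidAlgebra.single a c) = c • F a := by
  simp [evl]

/-- The ring map induced by an additive map on exponents. -/
abbrev mapMon (r : G →+ G') : AddMonoidAlgebra ℂ G →+* AddMonoidAlgebra ℂ G' :=
  AddMonoidAlgebra.mapDomainRingHom ℂ r

lemma laurent_induct {p : AddMonoidAlgebra ℂ G → Prop} (f : AddMonoidAlgebra ℂ G)
    (h0 : p 0) (hadd : ∀ f g, p f → p g → p (f + g)) (hs : ∀ a (c : ℂ), p (c • mon a)) : p f := by
  induction f using AddMonoidAlgebra.induction_linear with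
  | zero => exact h0
  | add f g hf hg => exact hadd f g hf hg
  | single a c => simpa using hs a c

lemma evl_mapMon (r : G →+ G') (F : G' → V) (f : AddMonoidAlgebra ℂ G) :
    evl F (mapMon r f) = evl (fun a => F (r a)) f := by
  induction f using laurent_induct with
  | h0 => simp
  | hadd f g hf hg => simp only [map_add, hf, hg]
  | hs a c => simp

lemma evl_sub (F F' : G → V) (f : AddMonoidAlgebra ℂ G) :
    evl F f - evl F' f = evl (fun a => F a - F' a) f := by
  induction f using laurent_induct with
  | h0 => simp
  | hadd f g hf hg => simp only [map_add, ← hf, ← hg]; abel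
  | hs a c => simp [smul_sub]

lemma evl_add (F F' : G → V) (f : AddMonoidAlgebra ℂ G) :
    evl F f + evl F' f = evl (fun a => F a + F' a) f := by
  induction f using laurent_induct with
  | h0 => simp
  | hadd f g hf hg => simp only [map_add, ← hf, ← hg]; abel
  | hs a c => simp [smul_add]

lemma evl_comp {V' : Type*} [AddCommGroup V'] [Module ℂ V'] (L : V →ₗ[ℂ] V') (F : G → V)
    (f : AddMonoidAlgebra ℂ G) : L (evl F f) = evl (fun a => L (F a)) f := by
  induction f using laurent_induct with
  | h0 => simp
  | hadd f g hf hg => simp only [map_add, hf, hg]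
  | hs a c => simp

lemma evl_mon_mul (F : G → V) (u : G) (f : AddMonoidAlgebra ℂ G) :
    evl F (mon u * f) = evl (fun a => F (u + a)) f := by
  induction f using laurent_induct with
  | h0 => simp
  | hadd f g hf hg => simp only [mul_add, map_add, hf, hg]
  | hs a c => simp [mul_smul_comm]

/-- Contraction of a difference of two monomials with the same restriction, against an
affine coefficient. -/
lemma evl_contract (r : G →+ G') (H : G' → V) (c : G → ℂ) (κ : ℂ) (u v : G)
    (hr : r u = r v) (hc : ∀ a, c (u + a) - c (v + a) = κ) (h : AddMonoidAlgebra ℂ G) :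
    evl (fun a => c a • H (r a)) ((mon u - mon v) * h)
      = κ • evl H (mapMon r (mon u * h)) := by
  rw [evl_mapMon, sub_mul, map_sub, evl_mon_mul, evl_mon_mul, evl_mon_mul, evl_sub]
  induction h using laurent_induct with
  | h0 => simp
  | hadd f g hf hg => simp only [map_add (evl _), hf, hg, smul_add]
  | hs a c' =>
    simp only [map_smul, evl_single, one_smul, map_add, hr]
    rw [← sub_smul, hc, smul_comm]

/-- Contraction vanishes on multiples of the square of the difference. -/
lemma evl_contract_sq (r : G →+ G') (H : G' → V) (c : G → ℂ) (κ : ℂ) (u v : G)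
    (hr : r u = r v) (hc : ∀ a, c (u + a) - c (v + a) = κ) (h : AddMonoidAlgebra ℂ G) :
    evl (fun a => c a • H (r a)) ((mon u - mon v) ^ 2 * h) = 0 := by
  rw [pow_two, mul_assoc, evl_contract r H c κ u v hr hc]
  simp only [map_mul, map_sub, AddMonoidAlgebra.mapDomainRingHom_apply,
    AddMonoidAlgebra.mapDomain_single, hr, sub_self, zero_mul, mul_zero, map_zero, smul_zero]

end Laurent

/-- Exponents of the coordinate monomials. -/
abbrev xA : AddMonoidAlgebra ℂ (ℤ × ℤ) := mon (1, 0)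
abbrev xB : AddMonoidAlgebra ℂ (ℤ × ℤ) := mon (0, 1)
abbrev yA : AddMonoidAlgebra ℂ (ℤ × ℤ × ℤ) := mon (1, 0, 0)
abbrev yB : AddMonoidAlgebra ℂ (ℤ × ℤ × ℤ) := mon (0, 1, 0)
abbrev yC : AddMonoidAlgebra ℂ (ℤ × ℤ × ℤ) := mon (0, 0, 1)
abbrev zA : AddMonoidAlgebra ℂ (ℤ × ℤ × ℤ × ℤ) := mon (1, 0, 0, 0)
abbrev zB : AddMonoidAlgebra ℂ (ℤ × ℤ × ℤ × ℤ) := mon (0, 1, 0, 0)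
abbrev zC : AddMonoidAlgebra ℂ (ℤ × ℤ × ℤ × ℤ) := mon (0, 0, 1, 0)
abbrev zD : AddMonoidAlgebra ℂ (ℤ × ℤ × ℤ × ℤ) := mon (0, 0, 0, 1)

section Witt

variable {R : Type*} [Ring R] [Algebra ℂ R]

/-- Quadratic evaluation of a pair of families. -/
def ev2 (e f : ℤ → R) : AddMonoidAlgebra ℂ (ℤ × ℤ) →ₗ[ℂ] R := evl fun p => e p.1 * f p.2

/-- The span of the difference operators of order `m`. -/
def SS (e : ℤ → R) (m : ℕ) : Submodule ℂ R :=
  LinearMap.range (ev2 e e ∘ₗ LinearMap.mulLeft ℂ ((xA - xB) ^ m))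

lemma ev2_mem_SS (e : ℤ → R) (m : ℕ) (h) : ev2 e e ((xA - xB) ^ m * h) ∈ SS e m := ⟨h, rfl⟩

/-- Difference operator `∑ (-1)^r C(m,r) e_{k-r} f_{s+r}`. -/
def Om (e f : ℤ → R) (m : ℕ) (k s : ℤ) : R :=
  ∑ r ∈ Finset.range (m + 1), ((-1 : ℂ) ^ r * (m.choose r : ℂ)) • (e (k - r) * f (s + r))

lemma evl_sub_pow_mul_mon {V : Type*} [AddCommGroup V] [Module ℂ V] (F : ℤ × ℤ → V) (m : ℕ) (k s : ℤ) :
    evl F ((xA - xB) ^ m * mon (k - m, s))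
      = ∑ r ∈ Finset.range (m + 1), ((-1 : ℂ) ^ r * (m.choose r : ℂ)) • F (k - r, s + r) := by
  have h : ((xA - xB) ^ m : AddMonoidAlgebra ℂ (ℤ × ℤ)) =
      ∑ r ∈ Finset.range (m + 1), ((-1 : ℂ) ^ r * (m.choose r : ℂ)) •
        (mon ((m : ℤ) - r, (r : ℤ)) : AddMonoidAlgebra ℂ (ℤ × ℤ)) := by
    rw [sub_eq_neg_add, add_pow]
    refine Finset.sum_congr rfl fun r hr => ?_
    have hr' : r ≤ m := by simpa [Nat.lt_succ_iff] using hr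
    rw [neg_pow, AddMonoidAlgebra.single_pow, AddMonoidAlgebra.single_pow]
    rw [show ((-1 : AddMonoidAlgebra ℂ (ℤ × ℤ)) ^ r) = AddMonoidAlgebra.single 0 ((-1 : ℂ) ^ r) by
      rw [show (-1 : AddMonoidAlgebra ℂ (ℤ × ℤ)) = AddMonoidAlgebra.single 0 (-1 : ℂ) by
        rw [AddMonoidAlgebra.single_neg]; rfl, AddMonoidAlgebra.single_pow]; simp]
    rw [show ((m.choose r : ℕ) : AddMonoidAlgebra ℂ (ℤ × ℤ)) =
      AddMonoidAlgebra.single 0 (m.choose r : ℂ) by rfl]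
    simp [AddMonoidAlgebra.single_mul_single, hr', Nat.cast_sub]
  rw [h, Finset.sum_mul, map_sum]
  refine Finset.sum_congr rfl fun r _ => ?_
  rw [smul_mul_assoc, map_smul, AddMonoidAlgebra.single_mul_single]
  simp only [mul_one, evl_single, one_smul, Prod.mk_add_mk]
  congr 3
  · ring
  · ring_nf

lemma ev2_eq_Om (e f : ℤ → R) (m : ℕ) (k s : ℤ) :
    ev2 e f ((xA - xB) ^ m * mon (k - m, s)) = Om e f m k s := evl_sub_pow_mul_mon _ m k s

lemma ev2_eq_zero_of_Om (e f : ℤ → R) (m : ℕ) (L : R →ₗ[ℂ] R) (h : ∀ k s, L (Om e f m k s) = 0)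
    (g) : L (ev2 e f ((xA - xB) ^ m * g)) = 0 := by
  induction g using laurent_induct with
  | h0 => simp
  | hadd f g hf hg => simp only [mul_add, map_add, hf, hg, add_zero]
  | hs a c =>
    have := ev2_eq_Om e f m (a.1 + m) a.2
    rw [add_sub_cancel_right] at this
    rw [mul_smul_comm, map_smul, map_smul, this, h, smul_zero]

lemma Om_mem_SS (e : ℤ → R) (m : ℕ) (k s : ℤ) : Om e e m k s ∈ SS e m := by
  rw [← ev2_eq_Om]; exact ev2_mem_SS e m _

lemma SS_le_of_Om (e : ℤ → R) (m : ℕ) (T : Submodule ℂ R) (h : ∀ k s, Om e e m k s ∈ T) :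
    SS e m ≤ T := by
  rintro _ ⟨g, rfl⟩
  simp only [LinearMap.comp_apply, LinearMap.mulLeft_apply]
  induction g using laurent_induct with
  | h0 => simp
  | hadd f g hf hg => simp only [mul_add, map_add]; exact T.add_mem hf hg
  | hs a c =>
    have := ev2_eq_Om e e m (a.1 + m) a.2
    rw [add_sub_cancel_right] at this
    rw [mul_smul_comm, map_smul, this]
    exact T.smul_mem _ (h _ _)

lemma ev2_mem_of_dvd (e : ℤ → R) (m : ℕ) {f} (h : (xA - xB) ^ m ∣ f) : ev2 e e f ∈ SS e m := by
  obtain ⟨g, rfl⟩ := h; exact ev2_mem_SS e m g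

variable (e : ℤ → R)

private def swap12 : (ℤ × ℤ × ℤ) →+ (ℤ × ℤ × ℤ) where
  toFun p := (p.2.1, p.1, p.2.2)
  map_zero' := rfl
  map_add' _ _ := rfl

private def swap23 : (ℤ × ℤ × ℤ) →+ (ℤ × ℤ × ℤ) where
  toFun p := (p.1, p.2.2, p.2.1)
  map_zero' := rfl
  map_add' _ _ := rfl

private def swap23' : (ℤ × ℤ × ℤ × ℤ) →+ (ℤ × ℤ × ℤ × ℤ) where
  toFun p := (p.1, p.2.2.1, p.2.1, p.2.2.2)
  map_zero' := rfl
  map_add' _ _ := rfl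

private def join12 : (ℤ × ℤ × ℤ) →+ (ℤ × ℤ) where
  toFun p := (p.1 + p.2.1, p.2.2)
  map_zero' := rfl
  map_add' a b := by ext <;> simp; ring

private def join23 : (ℤ × ℤ × ℤ) →+ (ℤ × ℤ) where
  toFun p := (p.1, p.2.1 + p.2.2)
  map_zero' := rfl
  map_add' a b := by ext <;> simp; ring

private def join23' : (ℤ × ℤ × ℤ × ℤ) →+ (ℤ × ℤ × ℤ) where
  toFun p := (p.1, p.2.1 + p.2.2.1, p.2.2.2)
  map_zero' := rfl
  map_add' a b := by ext <;> simp; ring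

private def incl12 : (ℤ × ℤ) →+ (ℤ × ℤ × ℤ × ℤ) where
  toFun p := (p.1, p.2, 0, 0)
  map_zero' := rfl
  map_add' a b := by ext <;> simp

private def incl34 : (ℤ × ℤ) →+ (ℤ × ℤ × ℤ × ℤ) where
  toFun p := (0, 0, p.1, p.2)
  map_zero' := rfl
  map_add' a b := by ext <;> simp

private def ev3 : AddMonoidAlgebra ℂ (ℤ × ℤ × ℤ) →ₗ[ℂ] R :=
  evl fun p => e p.1 * e p.2.1 * e p.2.2

private def ev4 : AddMonoidAlgebra ℂ (ℤ × ℤ × ℤ × ℤ) →ₗ[ℂ] R :=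
  evl fun p => e p.1 * e p.2.1 * (e p.2.2.1 * e p.2.2.2)

private lemma ev4_mul (f g) : ev4 e (mapMon incl12 f * mapMon incl34 g) = ev2 e e f * ev2 e e g := by
  induction f using laurent_induct with
  | h0 => simp
  | hadd f g hf hg => simp only [map_add, add_mul, hf, hg]
  | hs a c =>
    induction g using laurent_induct with
    | h0 => simp
    | hadd f g hf hg => simp only [map_add, mul_add, hf, hg]
    | hs b c' =>
      simp only [map_smul, AddMonoidAlgebra.mapDomainRingHom_apply, AddMonoidAlgebra.mapDomain_single,
        smul_mul_assoc, mul_smul_comm, ev2, evl_single, one_smul,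
        AddMonoidAlgebra.single_mul_single, mul_one, ev4]
      simp [incl12, incl34, mul_smul]
      rw [smul_comm]

private lemma ev4_mem (m : ℕ) {f} (h : (zA - zB) ^ m * (zC - zD) ^ m ∣ f) :
    ev4 e f ∈ SS e m * SS e m := by
  obtain ⟨g, rfl⟩ := h
  induction g using laurent_induct with
  | h0 => simp
  | hadd f g hf hg => rw [mul_add, map_add]; exact add_mem hf hg
  | hs a c =>
    have : (zA - zB) ^ m * (zC - zD) ^ m * (c • mon a) =
        c • (mapMon incl12 ((xA - xB) ^ m * mon (a.1, a.2.1)) *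
          mapMon incl34 ((xA - xB) ^ m * mon (a.2.2.1, a.2.2.2))) := by
      have : (mon a : AddMonoidAlgebra ℂ (ℤ × ℤ × ℤ × ℤ)) =
          mapMon incl12 (mon (a.1, a.2.1)) * mapMon incl34 (mon (a.2.2.1, a.2.2.2)) := by
        rw [AddMonoidAlgebra.mapDomainRingHom_apply, AddMonoidAlgebra.mapDomain_single,
          AddMonoidAlgebra.mapDomainRingHom_apply, AddMonoidAlgebra.mapDomain_single,
          AddMonoidAlgebra.single_mul_single, mul_one]
        congr 1
        ext <;> simp [incl12, incl34]
      rw [mul_smul_comm, this]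
      simp only [map_mul, map_pow, map_sub]
      simp only [AddMonoidAlgebra.mapDomainRingHom_apply, AddMonoidAlgebra.mapDomain_single]
      simp only [incl12, incl34, AddMonoidHom.coe_mk, ZeroHom.coe_mk]
      congr 1; ring
    rw [this, map_smul, ev4_mul]
    exact Submodule.smul_mem _ _ (Submodule.mul_mem_mul (ev2_mem_SS e m _) (ev2_mem_SS e m _))

private lemma ev4_swap
    (he : ∀ i j, e i * e j - e j * e i = ((j - i : ℤ) : ℂ) • e (i + j))
    (h) :
    ev4 e ((zB - zC) * h) - ev4 e (mapMon swap23' ((zB - zC) * h))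
      = (-2 : ℂ) • ev3 e (mapMon join23' (zB * h)) := by
  rw [ev3, ← evl_contract join23' _ (fun a => ((a.2.2.1 - a.2.1 : ℤ) : ℂ)) (-2) (0, 1, 0, 0) (0, 0, 1, 0),
    ev4, evl_mapMon, evl_sub]
  · congr 2
    funext a
    simp only [swap23', join23', AddMonoidHom.coe_mk, ZeroHom.coe_mk]
    have := he a.2.1 a.2.2.1
    calc _ = e a.1 * (e a.2.1 * e a.2.2.1 - e a.2.2.1 * e a.2.1) * e a.2.2.2 := by noncomm_ring
      _ = _ := by rw [this, mul_smul_comm, smul_mul_assoc]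
  · rfl
  · intro a; simp; ring

private lemma ev3_swap23
    (he : ∀ i j, e i * e j - e j * e i = ((j - i : ℤ) : ℂ) • e (i + j))
    (h) :
    ev3 e ((yB - yC) * h) - ev3 e (mapMon swap23 ((yB - yC) * h))
      = (-2 : ℂ) • ev2 e e (mapMon join23 (yB * h)) := by
  rw [ev2, ← evl_contract join23 _ (fun a => ((a.2.2 - a.2.1 : ℤ) : ℂ)) (-2) (0, 1, 0) (0, 0, 1),
    ev3, evl_mapMon, evl_sub]
  · congr 2
    funext a
    simp only [swap23, join23, AddMonoidHom.coe_mk, ZeroHom.coe_mk]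
    have := he a.2.1 a.2.2
    calc _ = e a.1 * (e a.2.1 * e a.2.2 - e a.2.2 * e a.2.1) := by noncomm_ring
      _ = _ := by rw [this, mul_smul_comm]
  · rfl
  · intro a; simp; ring

private lemma ev3_swap12
    (he : ∀ i j, e i * e j - e j * e i = ((j - i : ℤ) : ℂ) • e (i + j))
    (h) :
    ev3 e ((yA - yB) * h) - ev3 e (mapMon swap12 ((yA - yB) * h))
      = (-2 : ℂ) • ev2 e e (mapMon join12 (yA * h)) := by
  rw [ev2, ← evl_contract join12 _ (fun a => ((a.2.1 - a.1 : ℤ) : ℂ)) (-2) (1, 0, 0) (0, 1, 0),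
    ev3, evl_mapMon, evl_sub]
  · congr 2
    funext a
    simp only [swap12, join12, AddMonoidHom.coe_mk, ZeroHom.coe_mk]
    have := he a.1 a.2.1
    calc _ = (e a.1 * e a.2.1 - e a.2.1 * e a.1) * e a.2.2 := by noncomm_ring
      _ = _ := by rw [this, smul_mul_assoc]
  · rfl
  · intro a; simp; ring

/-- The span of difference operators is stable under commutation with the Witt algebra. -/
lemma SS_ad
    (he : ∀ i j, e i * e j - e j * e i = ((j - i : ℤ) : ℂ) • e (i + j))
    (m : ℕ) (j : ℤ) {x : R} (hx : x ∈ SS e m) : e j * x - x * e j ∈ SS e m := by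
  have hdvd : (xA - xB : AddMonoidAlgebra ℂ (ℤ × ℤ)) ∣ mon (j + 1, 0) - mon (0, j + 1) := by
    have hp : ∀ k : ℕ, (xA - xB : AddMonoidAlgebra ℂ (ℤ × ℤ)) ∣ mon ((k : ℤ), 0) - mon (0, (k : ℤ)) := by
      intro k
      have := sub_dvd_pow_sub_pow (xA : AddMonoidAlgebra ℂ (ℤ × ℤ)) xB k
      rw [AddMonoidAlgebra.single_pow, AddMonoidAlgebra.single_pow] at this
      simpa using this
    obtain ⟨k, hk⟩ := Int.eq_nat_or_neg (j + 1)
    rcases hk with hk | hk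
    · rw [hk]; exact hp k
    · rw [hk]
      have : (mon (-(k : ℤ), 0) - mon (0, -(k : ℤ)) : AddMonoidAlgebra ℂ (ℤ × ℤ)) =
          (mon ((k : ℤ), 0) - mon (0, (k : ℤ))) * (-mon (-(k : ℤ), -(k : ℤ))) := by
        rw [mul_neg, sub_mul, AddMonoidAlgebra.single_mul_single, AddMonoidAlgebra.single_mul_single]
        simp
      rw [this]
      exact dvd_mul_of_dvd_left (hp k) _
  let δ : AddMonoidAlgebra ℂ (ℤ × ℤ) →ₗ[ℂ] AddMonoidAlgebra ℂ (ℤ × ℤ) :=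
    evl fun p => ((p.1 - j : ℤ) : ℂ) • mon (j + p.1, p.2) + ((p.2 - j : ℤ) : ℂ) • mon (p.1, j + p.2)
  have hδ : ∀ f, δ ((xA - xB) * f) = (xA - xB) * δ f + (mon (j + 1, 0) - mon (0, j + 1)) * f := by
    intro f
    induction f using laurent_induct with
    | h0 => simp
    | hadd f g hf hg => rw [mul_add, map_add, hf, hg, map_add]; ring
    | hs a c =>
      obtain ⟨p, q⟩ := a
      rw [mul_smul_comm, map_smul, map_smul, mul_smul_comm, mul_smul_comm, ← smul_add]
      congr 1
      rw [sub_mul, sub_mul, sub_mul, map_sub]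
      simp only [δ, AddMonoidAlgebra.single_mul_single, evl_single, one_smul, mul_one, mul_add,
        mul_smul_comm]
      simp only [Prod.mk_add_mk, zero_add]
      rw [show j + (1 + p) = 1 + (j + p) by ring, show j + 1 + p = 1 + (j + p) by ring,
        show j + (1 + q) = 1 + (j + q) by ring, show j + 1 + q = 1 + (j + q) by ring]
      push_cast
      module
  have hδm : ∀ (m : ℕ) f, (xA - xB) ^ m ∣ δ ((xA - xB) ^ m * f) := by
    intro m
    induction m with
    | zero => simp
    | succ m ih =>
      intro f
      rw [pow_succ', mul_assoc, hδ]
      refine dvd_add (mul_dvd_mul_left _ (ih f)) ?_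
      exact mul_dvd_mul hdvd (dvd_mul_right _ _)
  obtain ⟨g, rfl⟩ := hx
  simp only [LinearMap.comp_apply, LinearMap.mulLeft_apply]
  have : ∀ f, e j * ev2 e e f - ev2 e e f * e j = ev2 e e (δ f) := by
    intro f
    induction f using laurent_induct with
    | h0 => simp
    | hadd f g hf hg => rw [map_add, map_add, map_add, ← hf, ← hg]; noncomm_ring
    | hs a c =>
      simp only [map_smul, map_add, ev2, evl_single, one_smul, δ]
      rw [mul_smul_comm, smul_mul_assoc, ← smul_sub]
      congr 1
      calc _ = (e j * e a.1 - e a.1 * e j) * e a.2 + e a.1 * (e j * e a.2 - e a.2 * e j) := by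
            noncomm_ring
        _ = _ := by rw [he, he, smul_mul_assoc, mul_smul_comm]
  rw [this]
  exact ev2_mem_of_dvd e m (hδm m g)

lemma SS_four_mul_le
    (he : ∀ i j, e i * e j - e j * e i = ((j - i : ℤ) : ℂ) • e (i + j))
    {m : ℕ} (hm : 0 < m) : SS e (4 * m) ≤ SS e m * SS e m := by
  have hzA : ∀ {G : Type} [AddCommGroup G] (r : (ℤ × ℤ × ℤ × ℤ) →+ G), mapMon r zA = mon (r (1,0,0,0)) ∧
      mapMon r zB = mon (r (0,1,0,0)) ∧ mapMon r zC = mon (r (0,0,1,0)) ∧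
      mapMon r zD = mon (r (0,0,0,1)) := fun r => by simp
  have hyA : ∀ {G : Type} [AddCommGroup G] (r : (ℤ × ℤ × ℤ) →+ G), mapMon r yA = mon (r (1,0,0)) ∧
      mapMon r yB = mon (r (0,1,0)) ∧ mapMon r yC = mon (r (0,0,1)) := fun r => by simp
  -- cubic evaluations with the factor `(x₁-x₂)(x₂-x₃)`
  have h1 : ∀ g, ev3 e ((yA - yB) ^ (2 * m) * (yB - yC) ^ (2 * m) * g) ∈ SS e m * SS e m := by
    intro g
    obtain ⟨g', hg'⟩ : ∃ g', mapMon join23' (zB * g') = g := by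
      refine ⟨mon (0,-1,0,0) * mapMon (⟨⟨fun p => (p.1, p.2.1, 0, p.2.2), rfl⟩,
        fun a b => by simp⟩ : (ℤ × ℤ × ℤ) →+ (ℤ × ℤ × ℤ × ℤ)) g, ?_⟩
      rw [← mul_assoc, AddMonoidAlgebra.single_mul_single]
      induction g using laurent_induct with
      | h0 => simp
      | hadd f g hf hg => rw [map_add, mul_add, map_add, hf, hg]
      | hs a c => simp [AddMonoidAlgebra.single_mul_single, join23']
    have key := ev4_swap e he ((zA - zB) ^ m * (zC - zD) ^ m * ((zA - zC) ^ m * (zB - zD) ^ m) * g')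
    have e1 : mapMon join23' (zB * ((zA - zB) ^ m * (zC - zD) ^ m * ((zA - zC) ^ m * (zB - zD) ^ m) * g'))
        = (yA - yB) ^ (2 * m) * (yB - yC) ^ (2 * m) * g := by
      rw [← hg']
      simp only [map_mul, map_pow, map_sub, hzA]
      simp only [join23', AddMonoidHom.coe_mk, ZeroHom.coe_mk]
      norm_num
      ring
    rw [e1] at key
    have e2 : ev3 e ((yA - yB) ^ (2 * m) * (yB - yC) ^ (2 * m) * g) = (-1/2 : ℂ) • ((-2 : ℂ) •
      ev3 e ((yA - yB) ^ (2 * m) * (yB - yC) ^ (2 * m) * g)) := by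
      rw [smul_smul]; norm_num
    rw [e2, ← key]
    refine Submodule.smul_mem _ _ (sub_mem (ev4_mem e m ?_) (ev4_mem e m ?_))
    · refine ⟨(zB - zC) * ((zA - zC) ^ m * (zB - zD) ^ m) * g', ?_⟩
      ring
    · simp only [map_mul, map_pow, map_sub, hzA]
      simp only [swap23', AddMonoidHom.coe_mk, ZeroHom.coe_mk]
      refine ⟨(zC - zB) * ((zA - zC) ^ m * (zB - zD) ^ m) * mapMon swap23' g', ?_⟩
      simp only [swap23']
      ring
  have h2 : ∀ g, ev3 e ((yA - yB) ^ (2 * m) * (yA - yC) ^ (2 * m) * g) ∈ SS e m * SS e m := by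
    intro g
    obtain ⟨k, hk⟩ : ∃ k, 2 * m = k + 2 := ⟨2 * m - 2, by omega⟩
    have key := ev3_swap12 e he ((yA - yB) ^ (k + 1) * (yB - yC) ^ (2 * m) * mapMon swap12 g)
    rw [show mapMon join12 (yA * ((yA - yB) ^ (k + 1) * (yB - yC) ^ (2 * m) * mapMon swap12 g)) = 0 by
      simp only [map_mul, map_pow, map_sub, hyA]
      simp [join12], map_zero, smul_zero, sub_eq_zero] at key
    have e1 : mapMon swap12 ((yA - yB) * ((yA - yB) ^ (k + 1) * (yB - yC) ^ (2 * m) * mapMon swap12 g))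
        = (yA - yB) ^ (2 * m) * (yA - yC) ^ (2 * m) * g := by
      have : mapMon swap12 (mapMon swap12 g) = g := by
        clear key
        induction g using laurent_induct with
        | h0 => simp
        | hadd f g hf hg => rw [map_add, map_add, hf, hg]
        | hs a c => simp [swap12]
      simp only [map_mul, map_pow, map_sub, hyA, this]
      simp only [swap12, AddMonoidHom.coe_mk, ZeroHom.coe_mk]
      have : (yB - yA : AddMonoidAlgebra ℂ (ℤ × ℤ × ℤ)) * (yB - yA) ^ (k + 1) = (yA - yB) ^ (2 * m) := by
        rw [← pow_succ', show k + 1 + 1 = 2 * m by omega, pow_mul, pow_mul]; congr 1; ring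
      rw [← mul_assoc, ← mul_assoc, this]
    rw [← e1, ← key]
    have e3 := h1 (mapMon swap12 g)
    convert e3 using 2
    rw [← mul_assoc, ← mul_assoc, ← pow_succ', show k + 1 + 1 = 2 * m by omega]
  refine SS_le_of_Om e _ _ fun k s => ?_
  rw [← ev2_eq_Om]
  generalize (mon (k - ((4 * m : ℕ) : ℤ), s) : AddMonoidAlgebra ℂ (ℤ × ℤ)) = g
  obtain ⟨g', hg'⟩ : ∃ g', mapMon join23 (yB * g') = g := by
    refine ⟨mon (0,-1,0) * mapMon (⟨⟨fun p => (p.1, p.2, 0), rfl⟩,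
      fun a b => by simp⟩ : (ℤ × ℤ) →+ (ℤ × ℤ × ℤ)) g, ?_⟩
    rw [← mul_assoc, AddMonoidAlgebra.single_mul_single]
    induction g using laurent_induct with
    | h0 => simp
    | hadd f g hf hg => rw [map_add, mul_add, map_add, hf, hg]
    | hs a c => simp [AddMonoidAlgebra.single_mul_single, join23]
  have key := ev3_swap23 e he ((yA - yB) ^ (2 * m) * (yA - yC) ^ (2 * m) * g')
  have e1 : mapMon join23 (yB * ((yA - yB) ^ (2 * m) * (yA - yC) ^ (2 * m) * g'))
      = (xA - xB) ^ (4 * m) * g := by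
    rw [← hg']
    simp only [map_mul, map_pow, map_sub, hyA]
    simp only [join23, AddMonoidHom.coe_mk, ZeroHom.coe_mk]
    norm_num
    ring
  rw [e1] at key
  have e2 : ev2 e e ((xA - xB) ^ (4 * m) * g) = (-1/2 : ℂ) • ((-2 : ℂ) •
    ev2 e e ((xA - xB) ^ (4 * m) * g)) := by
    rw [smul_smul]; norm_num
  rw [e2, ← key]
  refine Submodule.smul_mem _ _ (sub_mem ?_ ?_)
  · convert h2 ((yB - yC) * g') using 2; ring
  · convert h2 ((yC - yB) * mapMon swap23 g') using 2
    simp only [map_mul, map_pow, map_sub, hyA]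
    simp only [swap23, AddMonoidHom.coe_mk, ZeroHom.coe_mk]
    ring

lemma SS_four_pow_le
    (he : ∀ i j, e i * e j - e j * e i = ((j - i : ℤ) : ℂ) • e (i + j))
    {m : ℕ} (hm : 0 < m) (q : ℕ) : SS e (4 ^ q * m) ≤ SS e m ^ (2 ^ q) := by
  induction q with
  | zero => simp
  | succ q ih =>
    have := SS_four_mul_le e he (m := 4 ^ q * m) (by positivity)
    rw [show 4 ^ (q + 1) * m = 4 * (4 ^ q * m) by ring, pow_succ 2, pow_mul, pow_two]
    exact this.trans (mul_le_mul' ih ih)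

end Witt

end

end WSuper

namespace WSuper

open scoped Matrix


noncomputable section

open Polynomial

section Rational

variable {ι : Type*} [Fintype ι] [DecidableEq ι]

/-- Matrix of constants acting on a vector of polynomials. -/
def cact (A : Matrix ι ι ℂ) (P : ι → ℂ[X]) (i : ι) : ℂ[X] := ∑ k, C (A i k) * P k

lemma coeff_cact (A : Matrix ι ι ℂ) (P : ι → ℂ[X]) (i : ι) (n : ℕ)
    (h : ∀ k, (P k).coeff n = 0) : (cact A P i).coeff n = 0 := by
  simp [cact, h]

lemma eval_cact (A : Matrix ι ι ℂ) (P : ι → ℂ[X]) (i : ι) (w : ℂ) :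
    (cact A P i).eval w = (A *ᵥ fun k => (P k).eval w) i := by
  simp [cact, eval_finsetSum, Matrix.mulVec, dotProduct]

lemma X_mul_cact (A : Matrix ι ι ℂ) (P : ι → ℂ[X]) (i : ι) :
    X * cact A P i = cact A (fun k => X * P k) i := by
  simp only [cact, Finset.mul_sum]
  exact Finset.sum_congr rfl fun k _ => by ring

/-- Polynomial solutions of the system with right hand sides of small degree vanish. -/
lemma polynomial_system_eq_zero (A B A' B' : Matrix ι ι ℂ) (c1 c2 c3 : ι → ℂ) (P Q S : ι → ℂ[X])
    (h1 : ∀ i, (X ^ 2 - 3 * X + 2) * P i + cact A P i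
      = (X ^ 2 + X) * Q i + cact A' Q i + C (c1 i))
    (h2 : ∀ i, (X ^ 2 - X) * Q i + cact A Q i
      = (X ^ 2 + 3 * X + 2) * S i + cact A' S i + C (c2 i))
    (h3 : ∀ i, (X ^ 3 - 3 * X ^ 2 + 2 * X) * P i + (3 * X - 3) * cact A P i + cact B P i
      = (X ^ 3 + 3 * X ^ 2 + 2 * X) * S i + (3 * X + 3) * cact A' S i + cact B' S i
        + X * C (c3 i)) :
    P = 0 ∧ Q = 0 ∧ S = 0 := by
  have key : ∀ r : ℕ, (∀ l, r < l → ∀ i, (X * P i).coeff l = 0 ∧ (X * Q i).coeff l = 0 ∧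
      (X * S i).coeff l = 0) → ∀ i, (X * P i).coeff r = 0 ∧ (X * Q i).coeff r = 0 ∧
      (X * S i).coeff r = 0 := by
    intro r hr i
    cases r with
    | zero => simp
    | succ r =>
      have g1 : X ^ 2 * (X * P i) - 3 * (X * (X * P i)) + 2 * (X * P i)
          + cact A (fun k => X * P k) i
        = X ^ 2 * (X * Q i) + X * (X * Q i) + cact A' (fun k => X * Q k) i + C (c1 i) * X := by
        rw [← X_mul_cact, ← X_mul_cact]; linear_combination X * h1 i
      have g2 : X ^ 2 * (X * Q i) - X * (X * Q i) + cact A (fun k => X * Q k) i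
        = X ^ 2 * (X * S i) + 3 * (X * (X * S i)) + 2 * (X * S i)
          + cact A' (fun k => X * S k) i + C (c2 i) * X := by
        rw [← X_mul_cact, ← X_mul_cact]; linear_combination X * h2 i
      have g3 : X ^ 3 * (X * P i) - 3 * (X ^ 2 * (X * P i)) + 2 * (X * (X * P i))
          + 3 * (X * cact A (fun k => X * P k) i) - 3 * cact A (fun k => X * P k) i
          + cact B (fun k => X * P k) i
        = X ^ 3 * (X * S i) + 3 * (X ^ 2 * (X * S i)) + 2 * (X * (X * S i))
          + 3 * (X * cact A' (fun k => X * S k) i) + 3 * cact A' (fun k => X * S k) i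
          + cact B' (fun k => X * S k) i + C (c3 i) * X ^ 2 := by
        rw [← X_mul_cact, ← X_mul_cact, ← X_mul_cact, ← X_mul_cact]
        linear_combination X * h3 i
      generalize hP : (fun k => X * P k) = P' at *
      generalize hQ : (fun k => X * Q k) = Q' at *
      generalize hS : (fun k => X * S k) = S' at *
      have eP : ∀ i, X * P i = P' i := fun i => by rw [← hP]
      have eQ : ∀ i, X * Q i = Q' i := fun i => by rw [← hQ]
      have eS : ∀ i, X * S i = S' i := fun i => by rw [← hS]
      simp only [eP, eQ, eS] at *
      have hc : ∀ l, r + 1 < l → ∀ A : Matrix ι ι ℂ, (cact A P' i).coeff l = 0 ∧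
          (cact A Q' i).coeff l = 0 ∧ (cact A S' i).coeff l = 0 := fun l hl A =>
        ⟨coeff_cact _ _ _ _ fun k => (hr l hl k).1, coeff_cact _ _ _ _ fun k => (hr l hl k).2.1,
          coeff_cact _ _ _ _ fun k => (hr l hl k).2.2⟩
      have c3' : ∀ (p : ℂ[X]) l, ((3 : ℂ[X]) * p).coeff l = 3 * p.coeff l := fun p l => by
        rw [show (3 : ℂ[X]) = C 3 from rfl, coeff_C_mul]
      have c2' : ∀ (p : ℂ[X]) l, ((2 : ℂ[X]) * p).coeff l = 2 * p.coeff l := fun p l => by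
        rw [show (2 : ℂ[X]) = C 2 from rfl, coeff_C_mul]
      have k1 := congrArg (fun p => coeff p (r + 1 + 2)) g1
      have k1' := congrArg (fun p => coeff p (r + 2)) g1
      have k2 := congrArg (fun p => coeff p (r + 1 + 2)) g2
      have k2' := congrArg (fun p => coeff p (r + 2)) g2
      have k3' := congrArg (fun p => coeff p (r + 3)) g3
      have x1 : ∀ (p : ℂ[X]), (X ^ 2 * p).coeff (r + 1 + 2) = p.coeff (r + 1) := fun p =>
        coeff_X_pow_mul _ _ _
      have x2 : ∀ (p : ℂ[X]), (X ^ 2 * p).coeff (r + 2) = p.coeff r := fun p =>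
        coeff_X_pow_mul _ _ _
      have x3 : ∀ (p : ℂ[X]), (X ^ 3 * p).coeff (r + 3) = p.coeff r := fun p =>
        coeff_X_pow_mul _ _ _
      have x5 : ∀ (p : ℂ[X]), (X * p).coeff (r + 1 + 2) = p.coeff (r + 2) := fun p =>
        coeff_X_mul _ _
      have x6 : ∀ (p : ℂ[X]), (X * p).coeff (r + 2) = p.coeff (r + 1) := fun p =>
        coeff_X_mul _ _
      have x8 : ∀ c : ℂ, (C c * X : ℂ[X]).coeff (r + 1 + 2) = 0 := fun c => by
        rw [coeff_C_mul, coeff_X_of_ne_one (by omega), mul_zero]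
      have x9 : ∀ c : ℂ, (C c * X : ℂ[X]).coeff (r + 2) = 0 := fun c => by
        rw [coeff_C_mul, coeff_X_of_ne_one (by omega), mul_zero]
      have x10 : ∀ c : ℂ, (C c * X ^ 2 : ℂ[X]).coeff (r + 3) = 0 := fun c => by
        rw [coeff_C_mul, coeff_X_pow, if_neg (by omega), mul_zero]
      simp only [coeff_add, coeff_sub, x1, x2, x3, x5, x6, x8, x9, x10, c3', c2',
        (hc (r + 1 + 2) (by omega) _).1, (hc (r + 2) (by omega) _).1,
        (hc (r + 1 + 2) (by omega) _).2.1, (hc (r + 2) (by omega) _).2.1,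
        (hc (r + 1 + 2) (by omega) _).2.2, (hc (r + 2) (by omega) _).2.2, (hr (r + 1 + 2) (by omega) i).1,
        (hr (r + 2) (by omega) i).1, (hr (r + 2) (by omega) i).2.1, (hr (r + 1 + 2) (by omega) i).2.2,
        (hr (r + 2) (by omega) i).2.2] at k1 k1' k2 k2' k3'
      have hx : (P' i).coeff (r + 1) = 0 := by
        linear_combination k1 + (1/2) * (k3' - k1' - k2')
      refine ⟨hx, ?_, ?_⟩
      · linear_combination hx - k1
      · linear_combination hx - k1 - k2
  obtain ⟨R, hR⟩ : ∃ R : ℕ, ∀ l, R < l → ∀ i, (X * P i).coeff l = 0 ∧ (X * Q i).coeff l = 0 ∧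
      (X * S i).coeff l = 0 := by
    refine ⟨∑ i, ((X * P i).natDegree + (X * Q i).natDegree + (X * S i).natDegree), fun l hl i => ?_⟩
    have := Finset.single_le_sum
      (f := fun i => (X * P i).natDegree + (X * Q i).natDegree + (X * S i).natDegree)
      (fun _ _ => Nat.zero_le _) (Finset.mem_univ i)
    refine ⟨?_, ?_, ?_⟩ <;> exact coeff_eq_zero_of_natDegree_lt (by omega)
  have all : ∀ d l, R < l + d → ∀ i, (X * P i).coeff l = 0 ∧ (X * Q i).coeff l = 0 ∧
      (X * S i).coeff l = 0 := by
    intro d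
    induction d with
    | zero => exact hR
    | succ d ih => exact fun l hl => key l fun l' hl' => ih l' (by omega)
  have fin : ∀ l i, (X * P i).coeff l = 0 ∧ (X * Q i).coeff l = 0 ∧ (X * S i).coeff l = 0 :=
    fun l => all (R + 1) l (by omega)
  refine ⟨?_, ?_, ?_⟩ <;> funext i <;> ext n
  · simpa using (fin (n + 1) i).1
  · simpa using (fin (n + 1) i).2.1
  · simpa using (fin (n + 1) i).2.2

lemma cmat_mulVec (A : Matrix ι ι ℂ) (P : ι → ℂ[X]) : (A.map C) *ᵥ P = cact A P := by
  funext i; simp [cact, Matrix.mulVec, dotProduct]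

/-- A sequence satisfying the system is given by a rational function. -/
lemma rational_of_system (A B A' B' : Matrix ι ι ℂ) (c1 c3 : ι → ℂ) (lam : ℂ) (D : ℤ → ι → ℂ)
    (b : ℤ)
    (h1 : ∀ j ≤ b, ((lam + j) ^ 2 - 3 * (lam + j) + 2) • D j + A *ᵥ D j
      = ((lam + j) ^ 2 + (lam + j)) • D (j + 1) + A' *ᵥ D (j + 1) + c1)
    (h3 : ∀ j ≤ b, ((lam + j) ^ 3 - 3 * (lam + j) ^ 2 + 2 * (lam + j)) • D j
        + (3 * (lam + j) - 3) • (A *ᵥ D j) + B *ᵥ D j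
      = ((lam + j) ^ 3 + 3 * (lam + j) ^ 2 + 2 * (lam + j)) • D (j + 2)
        + (3 * (lam + j) + 3) • (A' *ᵥ D (j + 2)) + B' *ᵥ D (j + 2) + (lam + j) • c3) :
    ∃ q : ℂ[X], q ≠ 0 ∧ ∃ N : ι → ℂ[X], (c1 = 0 → c3 = 0 → N = 0) ∧
      ∀ j ≤ b - 1, q.eval (lam + j) • D j = fun i => (N i).eval (lam + j) := by
  let T : Matrix (Fin 3 × ι) (Fin 3 × ι) ℂ[X] := Matrix.of fun e v =>
    (![![(X ^ 2 - 3 * X + 2 : ℂ[X]) • (1 : Matrix ι ι ℂ[X]) + A.map C,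
        -((X ^ 2 + X : ℂ[X]) • (1 : Matrix ι ι ℂ[X]) + A'.map C), 0],
      ![0, (X ^ 2 - X : ℂ[X]) • (1 : Matrix ι ι ℂ[X]) + A.map C,
        -((X ^ 2 + 3 * X + 2 : ℂ[X]) • (1 : Matrix ι ι ℂ[X]) + A'.map C)],
      ![(X ^ 3 - 3 * X ^ 2 + 2 * X : ℂ[X]) • (1 : Matrix ι ι ℂ[X]) + (3 * X - 3 : ℂ[X]) • A.map C
          + B.map C, 0,
        -((X ^ 3 + 3 * X ^ 2 + 2 * X : ℂ[X]) • (1 : Matrix ι ι ℂ[X]) + (3 * X + 3 : ℂ[X]) • A'.map C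
          + B'.map C)]] : Fin 3 → Fin 3 → Matrix ι ι ℂ[X]) e.1 v.1 e.2 v.2
  have hT : ∀ (P : Fin 3 × ι → ℂ[X]) e i, (T *ᵥ P) (e, i) = ∑ v : Fin 3,
      ((![![(X ^ 2 - 3 * X + 2 : ℂ[X]) • (1 : Matrix ι ι ℂ[X]) + A.map C,
        -((X ^ 2 + X : ℂ[X]) • (1 : Matrix ι ι ℂ[X]) + A'.map C), 0],
      ![0, (X ^ 2 - X : ℂ[X]) • (1 : Matrix ι ι ℂ[X]) + A.map C,
        -((X ^ 2 + 3 * X + 2 : ℂ[X]) • (1 : Matrix ι ι ℂ[X]) + A'.map C)],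
      ![(X ^ 3 - 3 * X ^ 2 + 2 * X : ℂ[X]) • (1 : Matrix ι ι ℂ[X]) + (3 * X - 3 : ℂ[X]) • A.map C
          + B.map C, 0,
        -((X ^ 3 + 3 * X ^ 2 + 2 * X : ℂ[X]) • (1 : Matrix ι ι ℂ[X]) + (3 * X + 3 : ℂ[X]) • A'.map C
          + B'.map C)]] : Fin 3 → Fin 3 → Matrix ι ι ℂ[X]) e v *ᵥ fun k => P (v, k)) i := by
    intro P e i
    simp only [Matrix.mulVec, dotProduct, Fintype.sum_prod_type, T, Matrix.of_apply]
  have hT0 : ∀ (P : Fin 3 × ι → ℂ[X]) i, (T *ᵥ P) (0, i) =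
      (X ^ 2 - 3 * X + 2) * P (0, i) + cact A (fun k => P (0, k)) i
        - ((X ^ 2 + X) * P (1, i) + cact A' (fun k => P (1, k)) i) := by
    intro P i
    rw [hT, Fin.sum_univ_three]
    simp [Matrix.add_mulVec, Matrix.smul_mulVec, Matrix.neg_mulVec, cmat_mulVec, sub_eq_add_neg]
  have hT1 : ∀ (P : Fin 3 × ι → ℂ[X]) i, (T *ᵥ P) (1, i) =
      (X ^ 2 - X) * P (1, i) + cact A (fun k => P (1, k)) i
        - ((X ^ 2 + 3 * X + 2) * P (2, i) + cact A' (fun k => P (2, k)) i) := by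
    intro P i
    rw [hT, Fin.sum_univ_three]
    simp [Matrix.add_mulVec, Matrix.smul_mulVec, Matrix.neg_mulVec, cmat_mulVec, sub_eq_add_neg]
  have hT2 : ∀ (P : Fin 3 × ι → ℂ[X]) i, (T *ᵥ P) (2, i) =
      (X ^ 3 - 3 * X ^ 2 + 2 * X) * P (0, i) + (3 * X - 3) * cact A (fun k => P (0, k)) i
        + cact B (fun k => P (0, k)) i
        - ((X ^ 3 + 3 * X ^ 2 + 2 * X) * P (2, i) + (3 * X + 3) * cact A' (fun k => P (2, k)) i
          + cact B' (fun k => P (2, k)) i) := by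
    intro P i
    rw [hT, Fin.sum_univ_three]
    simp [Matrix.add_mulVec, Matrix.smul_mulVec, Matrix.neg_mulVec, cmat_mulVec, sub_eq_add_neg]
  have hdet : T.det ≠ 0 := by
    intro h
    obtain ⟨P, hP, hP0⟩ := Matrix.exists_mulVec_eq_zero_iff.mpr h
    have := polynomial_system_eq_zero A B A' B' 0 0 0 (fun i => P (0, i)) (fun i => P (1, i))
      (fun i => P (2, i)) (fun i => ?_) (fun i => ?_) (fun i => ?_)
    · refine hP ?_
      funext ⟨v, i⟩
      fin_cases v
      · exact congrFun this.1 i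
      · exact congrFun this.2.1 i
      · exact congrFun this.2.2 i
    · have := congrFun hP0 (0, i)
      rw [hT0, Pi.zero_apply] at this
      simp only [Pi.zero_apply, C_0]
      linear_combination this
    · have := congrFun hP0 (1, i)
      rw [hT1, Pi.zero_apply] at this
      simp only [Pi.zero_apply, C_0]
      linear_combination this
    · have := congrFun hP0 (2, i)
      rw [hT2, Pi.zero_apply] at this
      simp only [Pi.zero_apply, C_0]
      linear_combination this
  let rhs : Fin 3 × ι → ℂ[X] := fun v => (![C (c1 v.2), C (c1 v.2), X * C (c3 v.2)] : Fin 3 → ℂ[X]) v.1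
  refine ⟨T.det, hdet, fun i => (T.adjugate *ᵥ rhs) (0, i), ?_, ?_⟩
  · intro e1 e3
    have : rhs = 0 := by
      funext ⟨v, i⟩
      fin_cases v <;> simp [rhs, e1, e3]
    funext i
    simp [this]
  · intro j hj
    let P : Fin 3 × ι → ℂ[X] := fun v => C (D (j + (v.1 : ℕ)) v.2)
    have hP : ∀ v k, P (v, k) = C (D (j + (v : ℕ)) k) := fun v k => rfl
    have hcact : ∀ (A : Matrix ι ι ℂ) (v : ι → ℂ) i, (cact A (fun k => C (v k)) i).eval (lam + j)
        = (A *ᵥ v) i := fun A v i => by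
      rw [eval_cact]; simp
    have hTP : ∀ v, ((T *ᵥ P) v).eval (lam + j) = (rhs v).eval (lam + j) := by
      rintro ⟨v, i⟩
      fin_cases v
      · have := congrFun (h1 j (by omega)) i
        simp only [Pi.add_apply, Pi.smul_apply, smul_eq_mul] at this
        simp only [Fin.zero_eta, hT0, hP, eval_sub, eval_add, eval_mul, hcact]
        simp [rhs]
        linear_combination this
      · have := congrFun (h1 (j + 1) (by omega)) i
        simp only [Pi.add_apply, Pi.smul_apply, smul_eq_mul, add_assoc] at this
        simp only [Fin.mk_one, hT1, hP, eval_sub, eval_add, eval_mul, hcact]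
        simp [rhs]
        norm_num at this
        linear_combination this
      · have := congrFun (h3 j (by omega)) i
        simp only [Pi.add_apply, Pi.smul_apply, smul_eq_mul] at this
        simp only [Fin.reduceFinMk, hT2, hP, eval_sub, eval_add, eval_mul, hcact]
        simp [rhs]
        linear_combination this
    funext i
    have hadj : (T.adjugate *ᵥ (T *ᵥ P)) (0, i) = T.det * P (0, i) := by
      rw [Matrix.mulVec_mulVec, Matrix.adjugate_mul, Matrix.smul_mulVec, Matrix.one_mulVec]
      rfl
    have e1 : ∀ Q : Fin 3 × ι → ℂ[X], ((T.adjugate *ᵥ Q) (0, i)).eval (lam + j) =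
        ∑ v, (T.adjugate (0, i) v).eval (lam + j) * (Q v).eval (lam + j) := by
      intro Q
      simp only [Matrix.mulVec, dotProduct, eval_finsetSum, eval_mul]
    have := congrArg (eval (lam + j)) hadj
    rw [e1, eval_mul] at this
    simp only [hTP] at this
    simp only [Pi.smul_apply, smul_eq_mul]
    rw [e1, this, hP]
    simp

end Rational

end

end WSuper

namespace WSuper


noncomputable section

open Polynomial

section Cross

lemma exists_le_eval_ne_zero {p : ℂ[X]} (hp : p ≠ 0) (lam : ℂ) (b : ℤ) :
    ∃ j ≤ b, p.eval (lam + j) ≠ 0 := by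
  by_contra! h
  refine hp (Polynomial.eq_zero_of_infinite_isRoot p ?_)
  refine Set.Infinite.mono (s := (fun j : ℤ => lam + j) '' Set.Iic b) ?_ ?_
  · rintro _ ⟨j, hj, rfl⟩
    exact h j hj
  · refine (Set.Iic_infinite b).image ?_
    intro i _ j _ hij
    simpa using hij

lemma eventually_eval_ne_zero {p : ℂ[X]} (hp : p ≠ 0) (lam : ℂ) (b : ℤ) :
    ∃ b' ≤ b, ∀ j ≤ b', p.eval (lam + (j : ℂ)) ≠ 0 := by
  have hfin : {j : ℤ | p.eval (lam + (j : ℂ)) = 0}.Finite := by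
    have : Set.Finite {x : ℂ | p.IsRoot x} := Polynomial.finite_setOfPred_isRoot hp
    refine Set.Finite.preimage (f := fun j : ℤ => lam + (j : ℂ)) ?_ this
    intro i _ j _ hij
    simpa using hij
  obtain ⟨c, hc⟩ := hfin.bddBelow
  refine ⟨min b (c - 1), min_le_left _ _, fun j hj h => ?_⟩
  have := hc h
  omega

lemma eq_of_eval_le {p q : ℂ[X]} {lam : ℂ} (b : ℤ)
    (h : ∀ j ≤ b, p.eval (lam + (j : ℂ)) = q.eval (lam + (j : ℂ))) : p = q := by
  by_contra hne
  obtain ⟨j, hj, h'⟩ := exists_le_eval_ne_zero (sub_ne_zero.mpr hne) lam b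
  exact h' (by rw [eval_sub, h j hj, sub_self])

/-- Reduced form of a family of rational functions with common denominator. -/
lemma rational_reduced {ι : Type*} (lam : ℂ) (D : ℤ → ι → ℂ) (d : ℕ) : ∀ (q : ℂ[X]), q ≠ 0 →
    q.natDegree = d → ∀ (N : ι → ℂ[X]) (b : ℤ),
    (∀ j ≤ b, ∀ i, q.eval (lam + (j : ℂ)) * D j i = (N i).eval (lam + (j : ℂ))) →
    ∃ q' : ℂ[X], q' ≠ 0 ∧ ∃ (N' : ι → ℂ[X]), ∃ b' ≤ b,
    (∀ j ≤ b', ∀ i, q'.eval (lam + (j : ℂ)) * D j i = (N' i).eval (lam + (j : ℂ))) ∧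
    ∀ p, q'.IsRoot p → ∃ i, (N' i).eval p ≠ 0 := by
  induction d with
  | zero =>
    intro q hq hd N b h
    refine ⟨q, hq, N, b, le_rfl, h, fun p hp => absurd hp ?_⟩
    rw [natDegree_eq_zero] at hd
    obtain ⟨c, rfl⟩ := hd
    simpa using hq
  | succ d ih =>
    intro q hq hd N b h
    by_cases hr : ∀ p, q.IsRoot p → ∃ i, (N i).eval p ≠ 0
    · exact ⟨q, hq, N, b, le_rfl, h, hr⟩
    push Not at hr
    obtain ⟨p, hp, hN⟩ := hr
    obtain ⟨q1, rfl⟩ := dvd_iff_isRoot.mpr hp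
    have hN1 : ∀ i, ∃ N1, N i = (X - C p) * N1 := fun i => dvd_iff_isRoot.mpr (hN i)
    choose N1 hN1 using hN1
    have hq1 : q1 ≠ 0 := right_ne_zero_of_mul hq
    have hd1 : q1.natDegree = d := by
      rw [natDegree_mul (X_sub_C_ne_zero p) hq1, natDegree_X_sub_C] at hd
      omega
    obtain ⟨b1, hb1, hne⟩ := eventually_eval_ne_zero (X_sub_C_ne_zero p) lam b
    obtain ⟨q', h1, N', b', hb', h2, h3⟩ := ih q1 hq1 hd1 N1 b1 fun j hj i => by
      have h4 := h j (hj.trans hb1) i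
      have h5 := hne j hj
      rw [hN1, eval_mul, eval_mul] at h4
      refine mul_left_cancel₀ h5 ?_
      rw [← h4]; ring
    exact ⟨q', h1, N', b', hb'.trans hb1, h2, h3⟩

private lemma cross_exists_shift (ν α : ℂ) (hν : ν ≠ 0) (d : ℤ) :
    ∃ d' : ℤ, d < d' ∧ (ν - d - 2 * d' + d * α) * (ν - 2 * d' + d' * α) ≠ 0 := by
  have h1 : (C (ν - d + d * α) - 2 * X : ℂ[X]) ≠ 0 := fun h => by
    have := congrArg (fun p => coeff p 1) h
    rw [show (2 : ℂ[X]) = C 2 from rfl] at this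
    simp only [coeff_sub, coeff_C_mul, coeff_X_one, coeff_C_succ, coeff_zero] at this
    norm_num at this
  have h2 : (C ν + C (α - 2) * X : ℂ[X]) ≠ 0 := fun h => by
    have := congrArg (fun p => coeff p 0) h
    simp at this
    exact hν this
  obtain ⟨b, hb, h3⟩ := eventually_eval_ne_zero (p := (C (ν - d + d * α) - 2 * X).comp (-X) *
    (C ν + C (α - 2) * X).comp (-X)) (by
      refine mul_ne_zero (fun h => h1 ?_) (fun h => h2 ?_)
      · have := congrArg (fun p => p.comp (-X)) h
        simpa [comp_assoc, sub_eq_add_neg] using this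
      · have := congrArg (fun p => p.comp (-X)) h
        simpa [comp_assoc] using this) 0 (-d - 1)
  refine ⟨-b, by omega, ?_⟩
  have := h3 b le_rfl
  simp only [eval_mul, eval_comp, eval_sub, eval_add, eval_C, eval_X, eval_neg, zero_add,
    eval_ofNat] at this
  push_cast
  convert this using 2 <;> ring

/-- The cross relation forces polynomiality of degree at most three. -/
lemma cross_polynomial (lam α : ℂ) (t b : ℤ) (htb : b ≤ t) (hν : lam + t ≠ 0) (g : ℤ → ℂ)
    (h : ∀ i ≤ b, ∀ j ≤ b, ((i : ℂ) - j) * g (i + j - t) =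
      (lam + (i + j - t : ℤ) + (t - j) * α) * g i - (lam + (i + j - t : ℤ) + (t - i) * α) * g j) :
    ∃ p : ℂ[X], p.natDegree ≤ 3 ∧ ∃ b' ≤ b, ∀ j ≤ b', g j = p.eval (lam + (j : ℂ)) := by
  set ν : ℂ := lam + t with hνdef
  -- rationality
  obtain ⟨q0, hq0, N0, hN0⟩ : ∃ q : ℂ[X], q ≠ 0 ∧ ∃ N : ℂ[X], ∀ j ≤ b,
      q.eval (lam + (j : ℂ)) * g j = N.eval (lam + (j : ℂ)) := by
    obtain ⟨d, hd⟩ : ∃ d : ℤ, d = max 1 (t - b) := ⟨_, rfl⟩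
    obtain ⟨d', hdd, hne⟩ := cross_exists_shift ν α hν d
    have key : ∀ c : ℤ, t - b ≤ c → 1 ≤ c → ∀ i ≤ b, (lam + i - ν + c) * g (i - c) =
        (lam + i - c + c * α) * g i - (lam + i - c + (ν - (lam + i)) * α) * g (t - c) := by
      intro c hc hc1 i hi
      have := h i hi (t - c) (by omega)
      rw [show i + (t - c) - t = i - c by ring] at this
      push_cast at this
      rw [hνdef]
      linear_combination this
    let P : ℤ → ℂ[X] := fun c => X - C (c : ℂ) + C (c * α)
    let Q : ℤ → ℂ[X] := fun c => X - C (c : ℂ) + (C ν - X) * C α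
    let E : ℤ → ℂ[X] := fun c => X - C ν + C (c : ℂ)
    let sh : ℤ → ℂ[X] → ℂ[X] := fun c p => p.comp (X - C (c : ℂ))
    let L : ℤ → ℤ → ℂ[X] := fun c c' => E c * sh c (E c')
    let U : ℤ → ℤ → ℂ[X] := fun c c' => sh c (P c') * P c
    let R : ℤ → ℤ → ℂ[X] := fun c c' => sh c (P c') * Q c * C (g (t - c)) +
      E c * sh c (Q c') * C (g (t - c'))
    have two : ∀ c : ℤ, t - b ≤ c → 1 ≤ c → ∀ c' : ℤ, t - b ≤ c' → 1 ≤ c' → ∀ i ≤ b,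
        (L c c').eval (lam + i) * g (i - c - c') = (U c c').eval (lam + i) * g i
          - (R c c').eval (lam + i) := by
      intro c hc hc1 c' hc' hc1' i hi
      have k1 := key c hc hc1 i hi
      have k2 := key c' hc' hc1' (i - c) (by omega)
      push_cast at k2
      simp only [L, U, R, E, P, Q, sh, eval_mul, eval_add, eval_sub, eval_comp, eval_X, eval_C]
      linear_combination (lam + i - ν + c) * k2 + (lam + i - c - c' + c' * α) * k1
    refine ⟨L d' d * U d d' - L d d' * U d' d, ?_, L d' d * R d d' - L d d' * R d' d, ?_⟩
    · intro h0
      have := congrArg (eval (ν - d')) h0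
      simp only [L, U, E, P, sh, eval_mul, eval_add, eval_sub, eval_comp, eval_X, eval_C,
        eval_zero] at this
      have h1 : ((d : ℂ) - d') * d * ((ν - d - 2 * d' + d * α) * (ν - 2 * d' + d' * α)) = 0 := by
        linear_combination this
      rcases mul_eq_zero.mp h1 with h2 | h2
      · rcases mul_eq_zero.mp h2 with h3 | h3
        · have : (d : ℂ) = d' := by linear_combination h3
          have : d = d' := by exact_mod_cast this
          omega
        · have : d = 0 := by exact_mod_cast h3
          omega
      · exact hne h2
    · intro i hi
      have a1 := two d (by omega) (by omega) d' (by omega) (by omega) i hi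
      have a2 := two d' (by omega) (by omega) d (by omega) (by omega) i hi
      rw [show i - d' - d = i - d - d' by ring] at a2
      simp only [eval_sub, eval_mul] at a1 a2 ⊢
      linear_combination (L d d').eval (lam + i) * a2 - (L d' d).eval (lam + i) * a1
  -- polynomiality
  obtain ⟨q, hq, N, b', hb', hN, hroot⟩ := rational_reduced (ι := Unit) lam (fun j _ => g j) _ q0
    hq0 rfl (fun _ => N0) b (fun j hj _ => hN0 j hj)
  replace hN := fun j hj => hN j hj ()
  replace hroot : ∀ p, q.IsRoot p → (N ()).eval p ≠ 0 := fun p hp => by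
    obtain ⟨⟨⟩, h⟩ := hroot p hp; exact h
  set N := N ()
  have bi : ∀ x y : ℂ, (x - y) * (N.eval (x + y - ν) * q.eval x * q.eval y) =
      q.eval (x + y - ν) * ((x + y - ν + (ν - y) * α) * N.eval x * q.eval y -
        (x + y - ν + (ν - x) * α) * N.eval y * q.eval x) := by
    have step : ∀ j ≤ b', ∀ x : ℂ, (x - (lam + j)) * (N.eval (x + (lam + j) - ν) * q.eval x *
        q.eval (lam + j)) = q.eval (x + (lam + j) - ν) * ((x + (lam + j) - ν + (ν - (lam + j)) * α)
        * N.eval x * q.eval (lam + j) - (x + (lam + j) - ν + (ν - x) * α) * N.eval (lam + j)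
        * q.eval x) := by
      intro j hj x
      have : (X - C (lam + j)) * (N.comp (X + C (lam + j) - C ν) * q * C (q.eval (lam + j))) =
          q.comp (X + C (lam + j) - C ν) * ((X + C (lam + j) - C ν + C ((ν - (lam + j)) * α))
          * N * C (q.eval (lam + j)) - (X + C (lam + j) - C ν + (C ν - X) * C α)
          * C (N.eval (lam + j)) * q) := by
        refine eq_of_eval_le (lam := lam) b' fun i hi => ?_
        have e1 := h i (by omega) j (by omega)
        have e2 := hN i hi
        have e3 := hN j hj
        have e4 := hN (i + j - t) (by omega)
        have e5 : lam + ((i + j - t : ℤ) : ℂ) = lam + i + (lam + j) - ν := by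
          rw [hνdef]; push_cast; ring
        rw [e5] at e4 e1
        simp only [eval_mul, eval_sub, eval_add, eval_comp, eval_X, eval_C]
        rw [← e2, ← e3, ← e4]
        have e6 : (t : ℂ) = ν - lam := by rw [hνdef]; ring
        rw [e6] at e1
        linear_combination q.eval (lam + i + (lam + j) - ν) * q.eval (lam + ↑i) *
          q.eval (lam + ↑j) * e1
      have := congrArg (eval x) this
      simpa only [eval_mul, eval_sub, eval_add, eval_comp, eval_X, eval_C] using this
    intro x y
    have : (C x - X) * (N.comp (C x + X - C ν) * C (q.eval x) * q) =
        q.comp (C x + X - C ν) * ((C x + X - C ν + (C ν - X) * C α) * C (N.eval x) * q -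
          (C x + X - C ν + C ((ν - x) * α)) * N * C (q.eval x)) := by
      refine eq_of_eval_le (lam := lam) b' fun j hj => ?_
      have := step j hj x
      simpa only [eval_mul, eval_sub, eval_add, eval_comp, eval_X, eval_C] using this
    have := congrArg (eval y) this
    simpa only [eval_mul, eval_sub, eval_add, eval_comp, eval_X, eval_C] using this
  have hconst : q.natDegree = 0 := by
    by_contra hdeg
    obtain ⟨p, hp⟩ := Complex.exists_root (f := q) (natDegree_pos_iff_degree_pos.mp (by omega))
    have hz : (C (p + ν) - 2 * X) * (q.comp (C (p + ν) - X) * q * C (N.eval p)) = 0 := by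
      refine eq_of_eval_le (lam := 0) 0 fun j _ => ?_
      have := bi (p + ν - j) j
      rw [show p + ν - j + (j : ℂ) - ν = p by ring, hp.eq_zero, zero_mul] at this
      simp only [eval_mul, eval_sub, eval_comp, eval_X, eval_C, eval_ofNat, eval_zero, zero_add]
      linear_combination this
    have h1 : (C (p + ν) - 2 * X : ℂ[X]) ≠ 0 := fun h => by
      have := congrArg (fun p => coeff p 1) h
      rw [show (2 : ℂ[X]) = C 2 from rfl] at this
      simp only [coeff_sub, coeff_C_mul, coeff_X_one, coeff_C_succ, coeff_zero] at this
      norm_num at this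
    have h2 : q.comp (C (p + ν) - X) ≠ 0 := fun h => by
      have := congrArg (fun f => f.comp (C (p + ν) - X)) h
      simp [comp_assoc] at this
      exact hq this
    exact mul_ne_zero h1 (mul_ne_zero (mul_ne_zero h2 hq) (C_ne_zero.mpr (hroot p hp))) hz
  obtain ⟨c, hc⟩ := natDegree_eq_zero.mp hconst
  have hc0 : c ≠ 0 := fun h => hq (by rw [← hc, h, C_0])
  obtain ⟨p, hp⟩ : ∃ p : ℂ[X], p = C c⁻¹ * N := ⟨_, rfl⟩
  have hNp : N = C c * p := by
    rw [hp, ← mul_assoc, ← C_mul, mul_inv_cancel₀ hc0, C_1, one_mul]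
  refine ⟨p, ?_, b', hb', fun j hj => ?_⟩
  swap
  · have := hN j hj
    rw [← hc, hNp, eval_C, eval_mul, eval_C] at this
    exact mul_left_cancel₀ hc0 this
  -- degree bound
  have bi' : ∀ x y : ℂ, (x - y) * p.eval (x + y - ν) =
      (x + y - ν + (ν - y) * α) * p.eval x - (x + y - ν + (ν - x) * α) * p.eval y := by
    intro x y
    have := bi x y
    rw [← hc, hNp] at this
    simp only [eval_mul, eval_C] at this
    refine mul_left_cancel₀ (pow_ne_zero 3 hc0) ?_
    linear_combination this
  by_contra! hdeg
  obtain ⟨s, hs⟩ : ∃ s, p.natDegree = s + 4 := ⟨p.natDegree - 4, by omega⟩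
  have tay : ∀ z : ℂ, (taylor z p).coeff (s + 2) - (z + ν) * (taylor z p).coeff (s + 3) =
      p.coeff (s + 2) + (z - z * α) * p.coeff (s + 3) := by
    intro z
    have : (X - C (z + ν)) * taylor z p = (X + C (z - z * α)) * p -
        (X * C (1 - α) + C (z + ν * α)) * C (p.eval (z + ν)) := by
      refine funext fun x => ?_
      have := bi' x (z + ν)
      simp only [eval_mul, eval_sub, eval_add, taylor_eval, eval_X, eval_C]
      rw [show x + (z + ν) - ν = x + z by ring] at this
      linear_combination this
    have := congrArg (fun f => coeff f (s + 2 + 1)) this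
    simp only [sub_mul, add_mul, coeff_sub, coeff_add, coeff_X_mul, coeff_C_mul, mul_assoc,
      ← C_mul, coeff_C_succ] at this
    linear_combination this
  have pol : hasseDeriv (s + 2) p - (X + C ν) * hasseDeriv (s + 3) p =
      C (p.coeff (s + 2)) + X * C ((1 - α) * p.coeff (s + 3)) := by
    refine funext fun z => ?_
    have := tay z
    simp only [taylor_coeff] at this
    simp only [eval_mul, eval_sub, eval_add, eval_X, eval_C]
    linear_combination this
  have := congrArg (fun f => coeff f (1 + 1)) pol
  have hz : p.coeff (1 + 1 + (s + 3)) = 0 := coeff_eq_zero_of_natDegree_lt (by omega)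
  simp only [add_mul, coeff_sub, coeff_add, coeff_X_mul, coeff_C_mul, hasseDeriv_coeff,
    coeff_C_succ, hz] at this
  have hl : p.coeff (s + 4) ≠ 0 := by
    rw [← hs]
    exact leadingCoeff_ne_zero.mpr fun h => by simp [h] at hs
  rw [show 1 + 1 + (s + 2) = s + 4 by ring, show 1 + (s + 3) = s + 4 by ring,
    show (s + 4).choose (s + 2) = (s + 4).choose 2 from by
      rw [← Nat.choose_symm (show 2 ≤ s + 4 by omega)]; rfl,
    show (s + 4).choose (s + 3) = s + 4 from by
      simp] at this
  have h2 : (((s + 4).choose 2 : ℕ) : ℂ) * 2 = (s + 4) * (s + 3) := by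
    rw [Nat.choose_two_right]
    have : 2 ∣ (s + 4) * (s + 4 - 1) := (Nat.even_mul_pred_self (s + 4)).two_dvd
    have h3 := Nat.div_mul_cancel this
    have := congrArg (Nat.cast : ℕ → ℂ) h3
    push_cast [show s + 4 - 1 = s + 3 from rfl] at this ⊢
    exact this
  have h3 : ((s : ℂ) + 4) * (s + 1) * p.coeff (s + 4) = 0 := by
    push_cast at this
    linear_combination 2 * this - p.coeff (s + 4) * h2
  have h4 : ((s : ℂ) + 4) ≠ 0 := by exact_mod_cast Nat.succ_ne_zero (s + 3)
  have h5 : ((s : ℂ) + 1) ≠ 0 := by exact_mod_cast Nat.succ_ne_zero s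
  exact mul_ne_zero (mul_ne_zero h4 h5) hl h3

end Cross

end

end WSuper

namespace WSuper


noncomputable section

open Polynomial Matrix

open scoped Kronecker

section Local

variable {ι : Type*} [Fintype ι] [DecidableEq ι]

lemma exists_root_forall_ne {q : ℂ[X]} (hq : q.natDegree ≠ 0) :
    ∃ p, q.IsRoot p ∧ q.eval (p + 1) ≠ 0 ∧ q.eval (p + 2) ≠ 0 := by
  have hq0 : q ≠ 0 := fun h => hq (by simp [h])
  obtain ⟨p0, hp0⟩ := Complex.exists_root (f := q) (natDegree_pos_iff_degree_pos.mp (by omega))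
  obtain ⟨p, hp, hmax⟩ := Set.exists_max_image {x : ℂ | q.IsRoot x} Complex.re
    (Polynomial.finite_setOfPred_isRoot hq0) ⟨p0, hp0⟩
  refine ⟨p, hp, fun h => ?_, fun h => ?_⟩
  · have := hmax (p + 1) h
    simp at this
    linarith
  · have := hmax (p + 2) h
    simp at this
    linarith

lemma cact_comp (A : Matrix ι ι ℂ) (P : ι → ℂ[X]) (i : ι) (r : ℂ[X]) :
    (cact A P i).comp r = cact A (fun k => (P k).comp r) i := by
  have := map_sum (compRingHom r) (fun k => C (A i k) * P k) Finset.univ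
  simpa only [cact, coe_compRingHom_apply, mul_comp, C_comp] using this

lemma exists_common_eigenvector [Nonempty ι] (A B : Matrix ι ι ℂ) (D : ℤ → Matrix ι ι ℂ) (lam : ℂ)
    (b : ℤ)
    (h1 : ∀ j ≤ b, ((lam + j) ^ 2 - 3 * (lam + j) + 2) • D j + A * D j
      = ((lam + j) ^ 2 + (lam + j)) • D (j + 1) + D (j + 1) * A + (-3 : ℂ) • (1 : Matrix ι ι ℂ))
    (h3 : ∀ j ≤ b, ((lam + j) ^ 3 - 3 * (lam + j) ^ 2 + 2 * (lam + j)) • D j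
        + (3 * (lam + j) - 3) • (A * D j) + B * D j
      = ((lam + j) ^ 3 + 3 * (lam + j) ^ 2 + 2 * (lam + j)) • D (j + 2)
        + (3 * (lam + j) + 3) • (D (j + 2) * A) + D (j + 2) * B
        + (lam + j) • ((-4 : ℂ) • (1 : Matrix ι ι ℂ))) :
    ∃ (α : ℂ) (w : ι → ℂ), w ≠ 0 ∧ A *ᵥ w = (α * (1 - α)) • w ∧
      B *ᵥ w = (α * (α - 1) * (2 * α - 1)) • w := by
  let Al : Matrix (ι × ι) (ι × ι) ℂ := (1 : Matrix ι ι ℂ) ⊗ₖ A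
  let Bl : Matrix (ι × ι) (ι × ι) ℂ := (1 : Matrix ι ι ℂ) ⊗ₖ B
  let Ar : Matrix (ι × ι) (ι × ι) ℂ := Aᵀ ⊗ₖ (1 : Matrix ι ι ℂ)
  let Br : Matrix (ι × ι) (ι × ι) ℂ := Bᵀ ⊗ₖ (1 : Matrix ι ι ℂ)
  have hAl : ∀ X, Al *ᵥ vec X = vec (A * X) := fun X => by
    simp only [Al, kronecker_mulVec_vec, transpose_one, mul_one]
  have hBl : ∀ X, Bl *ᵥ vec X = vec (B * X) := fun X => by
    simp only [Bl, kronecker_mulVec_vec, transpose_one, mul_one]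
  have hAr : ∀ X, Ar *ᵥ vec X = vec (X * A) := fun X => by
    simp only [Ar, kronecker_mulVec_vec, transpose_transpose, one_mul]
  have hBr : ∀ X, Br *ᵥ vec X = vec (X * B) := fun X => by
    simp only [Br, kronecker_mulVec_vec, transpose_transpose, one_mul]
  let I : ι × ι → ℂ := vec (1 : Matrix ι ι ℂ)
  have g1 : ∀ j ≤ b, ((lam + j) ^ 2 - 3 * (lam + j) + 2) • vec (D j) + Al *ᵥ vec (D j)
      = ((lam + j) ^ 2 + (lam + j)) • vec (D (j + 1)) + Ar *ᵥ vec (D (j + 1)) + (-3 : ℂ) • I := by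
    intro j hj
    rw [hAl, hAr]
    exact congrArg vec (h1 j hj)
  have g3 : ∀ j ≤ b, ((lam + j) ^ 3 - 3 * (lam + j) ^ 2 + 2 * (lam + j)) • vec (D j)
        + (3 * (lam + j) - 3) • (Al *ᵥ vec (D j)) + Bl *ᵥ vec (D j)
      = ((lam + j) ^ 3 + 3 * (lam + j) ^ 2 + 2 * (lam + j)) • vec (D (j + 2))
        + (3 * (lam + j) + 3) • (Ar *ᵥ vec (D (j + 2))) + Br *ᵥ vec (D (j + 2))
        + (lam + j) • ((-4 : ℂ) • I) := by
    intro j hj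
    rw [hAl, hAr, hBl, hBr]
    exact congrArg vec (h3 j hj)
  obtain ⟨q0, hq0, N0, -, hN0⟩ := rational_of_system Al Bl Ar Br _ _ lam (fun j => vec (D j)) b g1 g3
  obtain ⟨q, hq, N, b', hb', hN, hroot⟩ := rational_reduced lam (fun j => vec (D j)) _ q0 hq0 rfl
    N0 (b - 1) (fun j hj i => congrFun (hN0 j hj) i)
  have hcact : ∀ (Y : Matrix (ι × ι) (ι × ι) ℂ) (P : ι × ι → ℂ[X]) (z s : ℂ) (v : ι × ι → ℂ),
      (∀ i, s * v i = (P i).eval z) → ∀ i, (cact Y P i).eval z = s * (Y *ᵥ v) i := by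
    intro Y P z s v h i
    rw [eval_cact, ← smul_eq_mul, ← Pi.smul_apply, ← Matrix.mulVec_smul]
    exact congrFun (congrArg _ (funext fun k => (h k).symm)) i
  have p1 : ∀ i, ((X ^ 2 - 3 * X + 2) * N i + cact Al N i) * q.comp (X + 1) =
      ((X ^ 2 + X) * (N i).comp (X + 1) + cact Ar (fun k => (N k).comp (X + 1)) i) * q +
        C (-3 * I i) * q * q.comp (X + 1) := by
    intro i
    refine eq_of_eval_le (lam := lam) (b' - 1) fun j hj => ?_
    have e1 := congrFun (g1 j (by omega)) i
    have e2 := hN j (by omega)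
    have e3 := hN (j + 1) (by omega)
    push_cast at e3
    rw [← add_assoc] at e3
    simp only [eval_mul, eval_add, eval_sub, eval_pow, eval_X, eval_C, eval_ofNat, eval_comp,
      eval_one, hcact Al N _ _ _ e2]
    rw [hcact Ar (fun k => (N k).comp (X + 1)) (lam + j) _ _ (fun k => by
      rw [eval_comp, eval_add, eval_X, eval_one]; exact e3 k), ← e2, ← e3]
    simp only [Pi.add_apply, Pi.smul_apply, smul_eq_mul] at e1
    linear_combination q.eval (lam + j) * q.eval (lam + j + 1) * e1
  have p3 : ∀ i, ((X ^ 3 - 3 * X ^ 2 + 2 * X) * N i + (3 * X - 3) * cact Al N i + cact Bl N i)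
        * q.comp (X + 2) =
      ((X ^ 3 + 3 * X ^ 2 + 2 * X) * (N i).comp (X + 2)
        + (3 * X + 3) * cact Ar (fun k => (N k).comp (X + 2)) i
        + cact Br (fun k => (N k).comp (X + 2)) i) * q +
        X * C (-4 * I i) * q * q.comp (X + 2) := by
    intro i
    refine eq_of_eval_le (lam := lam) (b' - 2) fun j hj => ?_
    have e1 := congrFun (g3 j (by omega)) i
    have e2 := hN j (by omega)
    have e3 := hN (j + 2) (by omega)
    push_cast at e3
    rw [← add_assoc] at e3
    have e4 : ∀ k, q.eval (lam + j + 2) * vec (D (j + 2)) k =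
        eval (lam + j) ((N k).comp (X + 2)) := fun k => by
      rw [eval_comp, eval_add, eval_X, eval_ofNat]; exact e3 k
    simp only [eval_mul, eval_add, eval_sub, eval_pow, eval_X, eval_C, eval_ofNat,
      hcact Al N _ _ _ e2, hcact Bl N _ _ _ e2, hcact Ar _ _ _ _ e4, hcact Br _ _ _ _ e4]
    rw [← e2, ← e4, eval_comp, eval_add, eval_X, eval_ofNat]
    simp only [Pi.add_apply, Pi.smul_apply, smul_eq_mul] at e1
    linear_combination q.eval (lam + j) * q.eval (lam + j + 2) * e1
  have hdeg : q.natDegree ≠ 0 := by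
    intro hd
    obtain ⟨c, rfl⟩ := natDegree_eq_zero.mp hd
    have hc : c ≠ 0 := fun h => hq (by rw [h, C_0])
    simp only [C_comp] at p1 p3
    have hC : (C c : ℂ[X]) ≠ 0 := hq
    have p2 : ∀ i, (X ^ 2 - X) * (N i).comp (X + 1) + cact Al (fun k => (N k).comp (X + 1)) i =
        (X ^ 2 + 3 * X + 2) * (N i).comp (X + 2) + cact Ar (fun k => (N k).comp (X + 2)) i
        + C (-3 * I i * c) := by
      intro i
      have := congrArg (fun p => p.comp (X + 1)) (p1 i)
      refine mul_right_cancel₀ hC ?_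
      have e : (X + 1 + 1 : ℂ[X]) = X + 2 := by ring
      simp only [cact_comp, mul_comp, add_comp, sub_comp, pow_comp, X_comp, C_comp, comp_assoc,
        one_comp, e] at this
      have e3 : (3 : ℂ[X]).comp (X + 1) = 3 := C_comp (a := 3)
      have e2 : (2 : ℂ[X]).comp (X + 1) = 2 := C_comp (a := 2)
      rw [e3, e2] at this
      rw [C_mul (b := c)]
      linear_combination this
    have := polynomial_system_eq_zero Al Bl Ar Br (fun i => -3 * I i * c) (fun i => -3 * I i * c)
      (fun i => -4 * I i * c) N (fun i => (N i).comp (X + 1)) (fun i => (N i).comp (X + 2))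
      (fun i => mul_right_cancel₀ hC (by rw [p1, C_mul (b := c)]; ring)) p2
      (fun i => mul_right_cancel₀ hC (by rw [p3, C_mul (b := c)]; ring))
    have hD : ∀ j ≤ b', D j = 0 := by
      intro j hj
      refine Matrix.ext fun x y => ?_
      have := hN j hj (y, x)
      rw [‹N = 0 ∧ _›.1, eval_C, Pi.zero_apply, eval_zero] at this
      exact (mul_eq_zero.mp this).resolve_left hc
    obtain ⟨x⟩ := ‹Nonempty ι›
    have := congrFun (congrFun (h1 (b' - 1) (by omega)) x) x
    rw [hD _ (by omega), hD _ (by omega)] at this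
    simp at this
  obtain ⟨p, hp, hp1, hp2⟩ := exists_root_forall_ne hdeg
  obtain ⟨⟨y0, x0⟩, hxy⟩ := hroot p hp
  let Np : Matrix ι ι ℂ := fun x y => (N (y, x)).eval p
  have hNp : ∀ k, (1 : ℂ) * vec Np k = (N k).eval p := fun k => one_mul _
  have r1 : ((p ^ 2 - 3 * p + 2) • Np + A * Np) = 0 := by
    refine vec_inj.mp (funext fun i => ?_)
    have := congrArg (eval p) (p1 i)
    simp only [eval_mul, eval_add, eval_sub, eval_pow, eval_X, eval_C, eval_ofNat, eval_comp,
      eval_one, hp.eq_zero, mul_zero, zero_mul, add_zero, hcact _ _ _ _ _ hNp, hAl,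
      ← hNp] at this
    have := (mul_eq_zero.mp this).resolve_right hp1
    simp only [one_mul] at this
    exact this
  have r3 : ((p ^ 3 - 3 * p ^ 2 + 2 * p) • Np + (3 * p - 3) • (A * Np) + B * Np) = 0 := by
    refine vec_inj.mp (funext fun i => ?_)
    have := congrArg (eval p) (p3 i)
    simp only [eval_mul, eval_add, eval_sub, eval_pow, eval_X, eval_C, eval_ofNat, eval_comp,
      hp.eq_zero, mul_zero, zero_mul, add_zero, hcact _ _ _ _ _ hNp, hAl, hBl,
      ← hNp] at this
    have := (mul_eq_zero.mp this).resolve_right hp2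
    simp only [one_mul] at this
    exact this
  let w : ι → ℂ := Np *ᵥ Pi.single y0 1
  have hw1 : (p ^ 2 - 3 * p + 2) • w + A *ᵥ w = 0 := by
    have := congrArg (fun Y => Y *ᵥ (Pi.single y0 1 : ι → ℂ)) r1
    simpa only [add_mulVec, smul_mulVec, ← mulVec_mulVec, zero_mulVec] using this
  have hw3 : (p ^ 3 - 3 * p ^ 2 + 2 * p) • w + (3 * p - 3) • (A *ᵥ w) + B *ᵥ w = 0 := by
    have := congrArg (fun Y => Y *ᵥ (Pi.single y0 1 : ι → ℂ)) r3
    simpa only [add_mulVec, smul_mulVec, ← mulVec_mulVec, zero_mulVec] using this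
  have hwA : A *ᵥ w = ((p - 1) * (1 - (p - 1))) • w := by
    rw [eq_neg_of_add_eq_zero_right hw1]; module
  refine ⟨p - 1, w, fun h => hxy ?_, hwA, ?_⟩
  · have := congrFun h x0
    simp only [w, mulVec_single_one] at this
    exact this
  · rw [eq_neg_of_add_eq_zero_right hw3, hwA]; module

lemma eigenvector_eq (A B : Matrix ι ι ℂ) (D : ℤ → Matrix ι ι ℂ) (lam : ℂ)
    (b : ℤ)
    (h1 : ∀ j ≤ b, ((lam + j) ^ 2 - 3 * (lam + j) + 2) • D j + A * D j
      = ((lam + j) ^ 2 + (lam + j)) • D (j + 1) + D (j + 1) * A + (-3 : ℂ) • (1 : Matrix ι ι ℂ))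
    (h3 : ∀ j ≤ b, ((lam + j) ^ 3 - 3 * (lam + j) ^ 2 + 2 * (lam + j)) • D j
        + (3 * (lam + j) - 3) • (A * D j) + B * D j
      = ((lam + j) ^ 3 + 3 * (lam + j) ^ 2 + 2 * (lam + j)) • D (j + 2)
        + (3 * (lam + j) + 3) • (D (j + 2) * A) + D (j + 2) * B
        + (lam + j) • ((-4 : ℂ) • (1 : Matrix ι ι ℂ)))
    (α : ℂ) (w : ι → ℂ) (hA : A *ᵥ w = (α * (1 - α)) • w)
    (hB : B *ᵥ w = (α * (α - 1) * (2 * α - 1)) • w) :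
    ∃ b' ≤ b, ∀ j ≤ b', ((lam + j - α) * (lam + j - α - 1)) • (D j *ᵥ w) =
      (lam + j - 2 * α) • w := by
  obtain ⟨b1, hb1, hne⟩ := eventually_eval_ne_zero (p := (X - C α) * (X - C (α + 1)))
    (mul_ne_zero (X_sub_C_ne_zero _) (X_sub_C_ne_zero _)) lam b
  have hne1 : ∀ j ≤ b1, lam + (j : ℂ) - α ≠ 0 ∧ lam + (j : ℂ) - α - 1 ≠ 0 := fun j hj => by
    have := hne j hj
    simp only [eval_mul, eval_sub, eval_X, eval_C] at this
    exact ⟨left_ne_zero_of_mul this, by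
      rw [sub_sub]; exact right_ne_zero_of_mul this⟩
  let f : ℤ → ℂ := fun j => (lam + j - 2 * α) / ((lam + j - α) * (lam + j - α - 1))
  let x : ℤ → ι → ℂ := fun j => D j *ᵥ w - f j • w
  let A' : Matrix ι ι ℂ := (α * (1 - α)) • (1 : Matrix ι ι ℂ)
  let B' : Matrix ι ι ℂ := (α * (α - 1) * (2 * α - 1)) • (1 : Matrix ι ι ℂ)
  have hA' : ∀ v, A' *ᵥ v = (α * (1 - α)) • v := fun v => by simp only [A', smul_mulVec, one_mulVec]
  have hB' : ∀ v, B' *ᵥ v = (α * (α - 1) * (2 * α - 1)) • v := fun v => by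
    simp only [B', smul_mulVec, one_mulVec]
  have R := rational_of_system A B A' B' 0 0 lam x (b1 - 2) ?_ ?_
  · obtain ⟨q, hq, N, hN0, hN⟩ := R
    obtain ⟨b2, hb2, hq2⟩ := eventually_eval_ne_zero hq lam (b1 - 2 - 1)
    refine ⟨b2, by omega, fun j hj => ?_⟩
    have h0 := hN j (by omega)
    rw [hN0 rfl rfl] at h0
    have hx : x j = 0 := by
      refine (smul_eq_zero.mp (h0.trans ?_)).resolve_left (hq2 j hj)
      funext i; simp
    have hx' : D j *ᵥ w = f j • w := sub_eq_zero.mp hx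
    rw [hx', smul_smul, mul_div_cancel₀]
    have := hne1 j (by omega)
    exact mul_ne_zero this.1 this.2
  · intro j hj
    have e := congrArg (fun Y => Y *ᵥ w) (h1 j (by omega))
    simp only [add_mulVec, smul_mulVec, ← mulVec_mulVec, one_mulVec, hA, mulVec_smul] at e
    have ha := hne1 j (by omega)
    have hb := hne1 (j + 1) (by omega)
    have e2 : ((lam + j) ^ 2 - 3 * (lam + j) + 2 + α * (1 - α)) * f j =
        ((lam + j) ^ 2 + (lam + j) + α * (1 - α)) * f (j + 1) - 3 := by
      simp only [f]
      obtain ⟨ha1, ha2⟩ := ha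
      obtain ⟨hb1, hb2⟩ := hb
      push_cast at hb1 hb2 ⊢
      have : lam + ((j : ℂ) + 1) - α - 1 = lam + j - α := by ring
      rw [this]
      field_simp
      ring
    simp only [x, mulVec_sub, mulVec_smul, hA, hA', add_zero]
    linear_combination (norm := module) e - e2 • w
  · intro j hj
    have e := congrArg (fun Y => Y *ᵥ w) (h3 j (by omega))
    simp only [add_mulVec, smul_mulVec, ← mulVec_mulVec, one_mulVec, hA, hB, mulVec_smul] at e
    have ha := hne1 j (by omega)
    have hb := hne1 (j + 2) (by omega)
    have e2 : ((lam + j) ^ 3 - 3 * (lam + j) ^ 2 + 2 * (lam + j) + (3 * (lam + j) - 3) *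
        (α * (1 - α)) + α * (α - 1) * (2 * α - 1)) * f j =
        ((lam + j) ^ 3 + 3 * (lam + j) ^ 2 + 2 * (lam + j) + (3 * (lam + j) + 3) *
        (α * (1 - α)) + α * (α - 1) * (2 * α - 1)) * f (j + 2) - 4 * (lam + j) := by
      simp only [f]
      obtain ⟨ha1, ha2⟩ := ha
      obtain ⟨hb1, hb2⟩ := hb
      push_cast at hb1 hb2 ⊢
      field_simp
      ring
    simp only [x, mulVec_sub, mulVec_smul, hA, hA', hB, hB', add_zero, smul_zero]
    linear_combination (norm := module) e - e2 • w

end Local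

end

end WSuper

namespace WSuper


noncomputable section

open Polynomial Matrix

section Density

variable {M : Type*} [AddCommGroup M] [Module ℂ M] (e : ℤ → Module.End ℂ M)

lemma witt_apply
    (he : ∀ i j, e i * e j - e j * e i = ((j - i : ℤ) : ℂ) • e (i + j))
    (i j : ℤ) (v : M) :
    e i (e j v) = e j (e i v) + ((j : ℂ) - i) • e (i + j) v := by
  have := congrArg (fun f : Module.End ℂ M => f v) (he i j)
  simp only [LinearMap.sub_apply, Module.End.mul_apply, LinearMap.smul_apply] at this
  push_cast at this
  rw [← this]; abel

lemma density_of_generators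
    (he : ∀ i j, e i * e j - e j * e i = ((j - i : ℤ) : ℂ) • e (i + j))
    (lam α : ℂ) (b : ℤ) (v : ℤ → M)
    (h : ∀ k ∈ ({-2, -1, 0, 1, 2} : Set ℤ), ∀ j ≤ b, j + k ≤ b →
      e k (v j) = (lam + j + k * α) • v (j + k)) (k j : ℤ) (hj : j ≤ b) (hjk : j + k ≤ b) :
    e k (v j) = (lam + j + k * α) • v (j + k) := by
  let P : ℤ → Prop := fun k => ∀ j ≤ b, j + k ≤ b → e k (v j) = (lam + j + k * α) • v (j + k)
  have step : ∀ a c : ℤ, P a → P c → a ≠ c → (0 ≤ a ∧ 0 ≤ c ∨ a ≤ 0 ∧ c ≤ 0) → P (a + c) := by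
    intro a c ha hc hne hs j hj hjk
    have e1 := witt_apply e he a c (v j)
    rw [hc j hj (by omega), ha j hj (by omega), map_smul, map_smul, ha (j + c) (by omega) (by omega),
      hc (j + a) (by omega) (by omega)] at e1
    rw [show j + a + c = j + (a + c) by ring, show j + c + a = j + (a + c) by ring] at e1
    have hne' : ((c : ℂ) - a) ≠ 0 := by
      rw [sub_ne_zero]; exact_mod_cast hne.symm
    refine smul_right_injective M hne' ?_
    push_cast at e1 ⊢
    linear_combination (norm := module) -e1
  have base : ∀ k ∈ ({-2, -1, 0, 1, 2} : Set ℤ), P k := h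
  have pos : ∀ n : ℕ, P (n + 2) := by
    intro n
    induction n with
    | zero => simpa using base 2 (by simp)
    | succ n ih =>
      have := step 1 (n + 2) (base 1 (by simp)) ih (by omega) (by omega)
      convert this using 1
      push_cast; ring
  have neg : ∀ n : ℕ, P (-(n + 2)) := by
    intro n
    induction n with
    | zero => simpa using base (-2) (by simp)
    | succ n ih =>
      have := step (-1) (-(n + 2)) (base (-1) (by simp)) ih (by omega) (by omega)
      convert this using 1
      push_cast; ring
  have all : P k := by
    rcases le_or_gt 2 k with h2 | h2
    · have := pos (k - 2).toNat
      rwa [show (((k - 2).toNat : ℕ) : ℤ) + 2 = k by omega] at this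
    rcases le_or_gt k (-2) with h3 | h3
    · have := neg (-k - 2).toNat
      rwa [show -((((-k - 2).toNat : ℕ) : ℤ) + 2) = k by omega] at this
    · exact base k (by
        simp only [Set.mem_insert_iff, Set.mem_singleton_iff]; omega)
  exact all j hj hjk

variable {ι : Type*} [Fintype ι] [DecidableEq ι] [Nonempty ι]

lemma exists_density
    (he : ∀ i j, e i * e j - e j * e i = ((j - i : ℤ) : ℂ) • e (i + j))
    (lam : ℂ) (b : ℤ) (T : ℤ → (ι → ℂ) →ₗ[ℂ] M)
    (hinj : ∀ j ≤ b, Function.Injective (T j))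
    (h0 : ∀ j ≤ b, ∀ u, e 0 (T j u) = (lam + j) • T j u)
    (hm : ∀ j ≤ b, ∀ u, e (-1) (T j u) = T (j - 1) u)
    (hF : ∀ k j : ℤ, j ≤ b → j + k ≤ b → ∃ f : Matrix ι ι ℂ, ∀ u, e k (T j u) = T (j + k) (f *ᵥ u)) :
    ∃ (α : ℂ) (b' : ℤ) (c : ℤ → ℂ) (w : ι → ℂ), b' ≤ b ∧ w ≠ 0 ∧ (∀ j ≤ b', c j ≠ 0) ∧
      ∀ k j : ℤ, j ≤ b' → j + k ≤ b' →
        e k (T j (c j • w)) = (lam + j + k * α) • T (j + k) (c (j + k) • w) := by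
  have hF' : ∀ k j : ℤ, ∃ f : Matrix ι ι ℂ, j ≤ b → j + k ≤ b →
      ∀ u, e k (T j u) = T (j + k) (f *ᵥ u) := fun k j => by
    by_cases h : j ≤ b ∧ j + k ≤ b
    · obtain ⟨f, hf⟩ := hF k j h.1 h.2
      exact ⟨f, fun _ _ => hf⟩
    · exact ⟨0, fun h1 h2 => absurd ⟨h1, h2⟩ h⟩
  choose F hF using hF'
  have ext : ∀ j ≤ b, ∀ f g : Matrix ι ι ℂ, (∀ u, T j (f *ᵥ u) = T j (g *ᵥ u)) → f = g := by
    intro j hj f g h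
    exact Matrix.ext_of_mulVec_single fun i => hinj j hj (h _)
  -- the operators of degree one and two
  have d1 : ∀ j ≤ b - 1, F 1 j - F 1 (j - 1) = (2 * (lam + j)) • (1 : Matrix ι ι ℂ) := by
    intro j hj
    refine ext j (by omega) _ _ fun u => ?_
    have e1 := witt_apply e he (-1) 1 (T j u)
    rw [hF 1 j (by omega) (by omega), hm _ (by omega), hm _ (by omega),
      hF 1 (j - 1) (by omega) (by omega), show (-1 : ℤ) + 1 = 0 by rfl, h0 j (by omega),
      show j - 1 + 1 = j by ring, show j + 1 - 1 = j by ring] at e1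
    rw [sub_mulVec, map_sub, smul_mulVec, one_mulVec, map_smul, e1]
    push_cast
    module
  obtain ⟨A, hA⟩ : ∃ A : Matrix ι ι ℂ, ∀ j ≤ b - 1,
      F 1 j = ((lam + j) ^ 2 + (lam + j)) • (1 : Matrix ι ι ℂ) + A := by
    refine ⟨F 1 (b - 1) - ((lam + (b - 1 : ℤ)) ^ 2 + (lam + (b - 1 : ℤ))) • 1, ?_⟩
    have : ∀ n : ℕ, F 1 (b - 1 - n) = ((lam + (b - 1 - n : ℤ)) ^ 2 + (lam + (b - 1 - n : ℤ))) •
        (1 : Matrix ι ι ℂ) + (F 1 (b - 1) - ((lam + (b - 1 : ℤ)) ^ 2 + (lam + (b - 1 : ℤ))) • 1) := by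
      intro n
      induction n with
      | zero => simp
      | succ n ih =>
        have := d1 (b - 1 - n) (by omega)
        rw [ih] at this
        rw [show b - 1 - ((n + 1 : ℕ) : ℤ) = b - 1 - n - 1 by push_cast; ring]
        push_cast at this ⊢
        linear_combination (norm := module) -this
    intro j hj
    have := this (b - 1 - j).toNat
    rwa [show b - 1 - (((b - 1 - j).toNat : ℕ) : ℤ) = j by omega] at this
  have d2 : ∀ j ≤ b - 2, F 2 j - F 2 (j - 1) = (3 : ℂ) • F 1 j := by
    intro j hj
    refine ext (j + 1) (by omega) _ _ fun u => ?_
    have e1 := witt_apply e he (-1) 2 (T j u)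
    rw [hF 2 j (by omega) (by omega), hm _ (by omega), hm _ (by omega),
      hF 2 (j - 1) (by omega) (by omega), show (-1 : ℤ) + 2 = 1 by rfl,
      hF 1 j (by omega) (by omega),
      show j - 1 + 2 = j + 1 by ring, show j + 2 - 1 = j + 1 by ring] at e1
    rw [sub_mulVec, map_sub, smul_mulVec, map_smul, e1]
    push_cast
    module
  obtain ⟨B, hB⟩ : ∃ B : Matrix ι ι ℂ, ∀ j ≤ b - 2,
      F 2 j = ((lam + j + 1) ^ 3 - (lam + j + 1)) • (1 : Matrix ι ι ℂ) +
        (3 * (lam + j + 1)) • A + B := by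
    refine ⟨F 2 (b - 2) - ((lam + (b - 2 : ℤ) + 1) ^ 3 - (lam + (b - 2 : ℤ) + 1)) •
      (1 : Matrix ι ι ℂ) - (3 * (lam + (b - 2 : ℤ) + 1)) • A, ?_⟩
    have : ∀ n : ℕ, F 2 (b - 2 - n) = ((lam + (b - 2 - n : ℤ) + 1) ^ 3 -
        (lam + (b - 2 - n : ℤ) + 1)) • (1 : Matrix ι ι ℂ) + (3 * (lam + (b - 2 - n : ℤ) + 1)) • A
        + (F 2 (b - 2) - ((lam + (b - 2 : ℤ) + 1) ^ 3 - (lam + (b - 2 : ℤ) + 1)) •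
      (1 : Matrix ι ι ℂ) - (3 * (lam + (b - 2 : ℤ) + 1)) • A) := by
      intro n
      induction n with
      | zero => simp
      | succ n ih =>
        have := d2 (b - 2 - n) (by omega)
        rw [ih, hA _ (by omega)] at this
        rw [show b - 2 - ((n + 1 : ℕ) : ℤ) = b - 2 - n - 1 by push_cast; ring]
        push_cast at this ⊢
        linear_combination (norm := module) -this
    intro j hj
    have := this (b - 2 - j).toNat
    rwa [show b - 2 - (((b - 2 - j).toNat : ℕ) : ℤ) = j by omega] at this
  have h1 : ∀ j ≤ b - 4, ((lam + j) ^ 2 - 3 * (lam + j) + 2) • F (-2) j + A * F (-2) j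
      = ((lam + j) ^ 2 + (lam + j)) • F (-2) (j + 1) + F (-2) (j + 1) * A
        + (-3 : ℂ) • (1 : Matrix ι ι ℂ) := by
    intro j hj
    have : F (-2) (j + 1) * F 1 j - F 1 (j - 2) * F (-2) j = (3 : ℂ) • 1 := by
      refine ext (j - 1) (by omega) _ _ fun u => ?_
      have e1 := witt_apply e he (-2) 1 (T j u)
      rw [hF 1 j (by omega) (by omega), hF (-2) j (by omega) (by omega),
        hF (-2) (j + 1) (by omega) (by omega), show j + -2 = j - 2 by ring,
        hF 1 (j - 2) (by omega) (by omega), show (-2 : ℤ) + 1 = -1 by rfl, hm j (by omega),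
        show j - 2 + 1 = j - 1 by ring, show j + 1 + -2 = j - 1 by ring] at e1
      rw [sub_mulVec, map_sub, smul_mulVec, one_mulVec, map_smul, ← mulVec_mulVec,
        ← mulVec_mulVec, e1]
      push_cast
      module
    rw [hA j (by omega), hA (j - 2) (by omega), mul_add, add_mul, Matrix.mul_smul, Matrix.smul_mul, mul_one,
      one_mul] at this
    push_cast at this
    linear_combination (norm := module) -this
  have h3 : ∀ j ≤ b - 4, ((lam + j) ^ 3 - 3 * (lam + j) ^ 2 + 2 * (lam + j)) • F (-2) j
        + (3 * (lam + j) - 3) • (A * F (-2) j) + B * F (-2) j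
      = ((lam + j) ^ 3 + 3 * (lam + j) ^ 2 + 2 * (lam + j)) • F (-2) (j + 2)
        + (3 * (lam + j) + 3) • (F (-2) (j + 2) * A) + F (-2) (j + 2) * B
        + (lam + j) • ((-4 : ℂ) • (1 : Matrix ι ι ℂ)) := by
    intro j hj
    have : F (-2) (j + 2) * F 2 j - F 2 (j - 2) * F (-2) j = (4 * (lam + j)) • 1 := by
      refine ext j (by omega) _ _ fun u => ?_
      have e1 := witt_apply e he (-2) 2 (T j u)
      rw [hF 2 j (by omega) (by omega), hF (-2) j (by omega) (by omega),
        hF (-2) (j + 2) (by omega) (by omega), show j + -2 = j - 2 by ring,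
        hF 2 (j - 2) (by omega) (by omega), show (-2 : ℤ) + 2 = 0 by rfl, h0 j (by omega),
        show j - 2 + 2 = j by ring, show j + 2 + -2 = j by ring] at e1
      rw [sub_mulVec, map_sub, smul_mulVec, one_mulVec, map_smul, ← mulVec_mulVec,
        ← mulVec_mulVec, e1]
      push_cast
      module
    rw [hB j (by omega), hB (j - 2) (by omega)] at this
    simp only [mul_add, add_mul, Matrix.mul_smul, Matrix.smul_mul, mul_one, one_mul] at this
    push_cast at this
    linear_combination (norm := module) -this
  obtain ⟨α, w, hw, hAw, hBw⟩ := exists_common_eigenvector A B (F (-2)) lam (b - 4) h1 h3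
  obtain ⟨b1, hb1, hD⟩ := eigenvector_eq A B (F (-2)) lam (b - 4) h1 h3 α w hAw hBw
  obtain ⟨b', hb', hne⟩ := eventually_eval_ne_zero (X_sub_C_ne_zero α) lam (b1 - 2)
  simp only [eval_sub, eval_X, eval_C] at hne
  let c : ℤ → ℂ := fun j => ∏ i ∈ Finset.range (b' - j).toNat, (lam + (b' - i : ℤ) - α)⁻¹
  have hc0 : ∀ j, c j ≠ 0 := fun j => Finset.prod_ne_zero_iff.mpr fun i hi =>
    inv_ne_zero (hne _ (by omega))
  have hc : ∀ j ≤ b', c j = (lam + j - α) * c (j - 1) := by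
    intro j hj
    simp only [c]
    rw [show (b' - (j - 1)).toNat = (b' - j).toNat + 1 by omega, Finset.prod_range_succ,
      show b' - (((b' - j).toNat : ℕ) : ℤ) = j by omega]
    rw [mul_comm, mul_assoc, inv_mul_cancel₀ (hne j hj), mul_one]
  refine ⟨α, b', c, w, by omega, hw, fun j _ => hc0 j, ?_⟩
  have hc1 : ∀ j ≤ b' - 1, c (j + 1) = (lam + j + 1 - α) * c j := fun j hj => by
    have := hc (j + 1) (by omega)
    rw [show j + 1 - 1 = j by ring] at this
    rw [this]; push_cast; ring
  have hc2 : ∀ j ≤ b', c j = (lam + j - α) * (lam + j - α - 1) * c (j - 2) := fun j hj => by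
    rw [hc j hj, hc (j - 1) (by omega), show j - 1 - 1 = j - 2 by ring]
    push_cast; ring
  refine density_of_generators e he lam α b' (fun j => T j (c j • w)) ?_
  intro k hk j hj hjk
  simp only [Set.mem_insert_iff, Set.mem_singleton_iff] at hk
  rcases hk with rfl | rfl | rfl | rfl | rfl
  · have := hD j (by omega)
    rw [hF (-2) j (by omega) (by omega), ← map_smul, mulVec_smul, hc2 j hj, show j + -2 = j - 2 by ring]
    congr 1
    push_cast
    linear_combination (norm := module) c (j - 2) • this
  · rw [hm j (by omega), ← map_smul, hc j hj, show j + -1 = j - 1 by ring]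
    congr 1
    push_cast
    module
  · rw [h0 j (by omega), add_zero]; push_cast; module
  · rw [hF 1 j (by omega) (by omega), ← map_smul, mulVec_smul, hc1 j (by omega), hA j (by omega),
      add_mulVec, smul_mulVec, one_mulVec, hAw]
    congr 1
    push_cast
    module
  · have h5 := hc2 (j + 2) (by omega)
    rw [show j + 2 - 2 = j by ring] at h5
    rw [hF 2 j (by omega) (by omega), ← map_smul, mulVec_smul, h5, hB j (by omega),
      add_mulVec, add_mulVec, smul_mulVec, smul_mulVec, one_mulVec, hAw, hBw]
    congr 1
    push_cast
    module

end Density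

end

end WSuper

namespace WSuper


noncomputable section

open Polynomial Matrix

/-- A graded module with finite-dimensional pieces over the centreless Virasoro algebra. -/
structure GWitt (M : Type*) [AddCommGroup M] [Module ℂ M] where
  e : ℤ → Module.End ℂ M
  he : ∀ i j, e i * e j - e j * e i = ((j - i : ℤ) : ℂ) • e (i + j)
  lam : ℂ
  G : ℤ → Submodule ℂ M
  map : ∀ k j v, v ∈ G j → e k v ∈ G (j + k)
  wt : ∀ j v, v ∈ G j → e 0 v = (lam + j) • v
  fd : ∀ j, FiniteDimensional ℂ (G j)

lemma alternating_sum_eval {p : ℂ[X]} (hp : p.natDegree ≤ 5) :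
    ∑ r ∈ Finset.range 7, ((-1 : ℂ) ^ r * ((6 : ℕ).choose r : ℂ)) * p.eval (r : ℂ) = 0 := by
  simp only [eval_eq_sum_range' (Nat.lt_succ_of_le hp)]
  simp only [Finset.sum_range_succ, Finset.sum_range_zero]
  norm_num [Nat.choose]
  ring

namespace GWitt

variable {M : Type*} [AddCommGroup M] [Module ℂ M] (g : GWitt M)

lemma comm (i j : ℤ) (v : M) : g.e i (g.e j v) = g.e j (g.e i v) + ((j : ℂ) - i) • g.e (i + j) v :=
  witt_apply g.e g.he i j v

lemma eq_zero_of_mem {i j : ℤ} (hij : i ≠ j) {v : M} (hi : v ∈ g.G i) (hj : v ∈ g.G j) : v = 0 := by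
  have h := (g.wt i v hi).symm.trans (g.wt j v hj)
  have h2 : ((i : ℂ) - j) • v = 0 := by linear_combination (norm := module) h
  exact (smul_eq_zero.mp h2).resolve_left (sub_ne_zero.mpr (by exact_mod_cast hij))

lemma map' {k j l : ℤ} (h : j + k = l) {v : M} (hv : v ∈ g.G j) : g.e k v ∈ g.G l :=
  h ▸ g.map k j v hv

lemma Om_mem {m : ℕ} (k s : ℤ) {j l : ℤ} (h : j + k + s = l) {v : M} (hv : v ∈ g.G j) :
    Om g.e g.e m k s v ∈ g.G l := by
  rw [Om, LinearMap.sum_apply]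
  refine Submodule.sum_mem _ fun r _ => ?_
  rw [LinearMap.smul_apply, Module.End.mul_apply]
  exact Submodule.smul_mem _ _ (g.map' (j := j + (s + r)) (by rw [← h]; ring) (g.map _ _ _ hv))

/-- Iterated vanishing of the sixth order difference operators. -/
def Kill : ℕ → M → Prop
  | 0, v => v = 0
  | K + 1, v => ∀ k s, Kill K (Om g.e g.e 6 k s v)

lemma kill_succ {K : ℕ} (h : ∀ j, ∀ v ∈ g.G j, g.Kill K v) (j : ℤ) (v : M) (hv : v ∈ g.G j) :
    g.Kill (K + 1) v :=
  fun k s => h _ _ (g.Om_mem k s rfl hv)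

lemma Kill.pow {K : ℕ} {v : M} (h : g.Kill K v) : ∀ x ∈ SS g.e 6 ^ K, x v = 0 := by
  induction K generalizing v with
  | zero => intro x _; rw [show v = 0 from h, map_zero]
  | succ K ih =>
    intro x hx
    rw [pow_succ] at hx
    refine Submodule.mul_induction_on hx (fun y hy z hz => ?_) fun y z hy hz => ?_
    · have : SS g.e 6 ≤ LinearMap.ker
          ((LinearMap.applyₗ v).comp (LinearMap.mulLeft ℂ y) : Module.End ℂ M →ₗ[ℂ] M) :=
        SS_le_of_Om _ _ _ fun k s => by
          simpa using ih (h k s) y hy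
      simpa using this hz
    · rw [LinearMap.add_apply, hy, hz, add_zero]

/-- The vectors killed by products of two difference operators. -/
def N2 : Submodule ℂ M where
  carrier := {v | ∀ x ∈ SS g.e 6 * SS g.e 6, x v = 0}
  zero_mem' _ _ := map_zero _
  add_mem' ha hb x hx := by rw [map_add, ha x hx, hb x hx, add_zero]
  smul_mem' c v hv x hx := by rw [map_smul, hv x hx, smul_zero]

lemma N2_stable (j : ℤ) {v : M} (hv : v ∈ g.N2) : g.e j v ∈ g.N2 := by
  intro x hx
  have key : ∀ x ∈ SS g.e 6 * SS g.e 6, g.e j * x - x * g.e j ∈ SS g.e 6 * SS g.e 6 := by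
    intro x hx
    refine Submodule.mul_induction_on hx (fun y hy z hz => ?_) fun y z hy hz => ?_
    · have : g.e j * (y * z) - y * z * g.e j
          = (g.e j * y - y * g.e j) * z + y * (g.e j * z - z * g.e j) := by noncomm_ring
      rw [this]
      exact add_mem (Submodule.mul_mem_mul (SS_ad g.e g.he 6 j hy) hz)
        (Submodule.mul_mem_mul hy (SS_ad g.e g.he 6 j hz))
    · rw [mul_add, add_mul, add_sub_add_comm]; exact add_mem hy hz
  have h1 := hv _ (key x hx)
  rw [LinearMap.sub_apply, Module.End.mul_apply, Module.End.mul_apply, hv x hx, map_zero, zero_sub,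
    neg_eq_zero] at h1
  exact h1

lemma mem_N2 {v : M} (h : ∀ k s k' s', Om g.e g.e 6 k s (Om g.e g.e 6 k' s' v) = 0) : v ∈ g.N2 := by
  have := Kill.pow g (K := 2) (v := v) (fun k' s' k s => h k s k' s')
  rwa [pow_two] at this

lemma kill_two {v : M} (h : v ∈ g.N2) : g.Kill 2 v := fun _ _ _ _ =>
  h _ (Submodule.mul_mem_mul (Om_mem_SS _ _ _ _) (Om_mem_SS _ _ _ _))

/-- The quotient by a stable submodule. -/
def quot (N : Submodule ℂ M) (hN : ∀ j, ∀ v ∈ N, g.e j v ∈ N) : GWitt (M ⧸ N) where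
  e j := N.mapQ N (g.e j) (fun v hv => hN j v hv)
  he i j := by
    refine Submodule.linearMap_qext _ (LinearMap.ext fun v => ?_)
    have := congrArg (fun f : Module.End ℂ M => N.mkQ (f v)) (g.he i j)
    simpa using this
  lam := g.lam
  G j := (g.G j).map N.mkQ
  map := by
    rintro k j _ ⟨v, hv, rfl⟩
    exact ⟨g.e k v, g.map k j v hv, by simp⟩
  wt := by
    rintro j _ ⟨v, hv, rfl⟩
    rw [← map_smul, ← g.wt j v hv]
    simp
  fd j := by
    have := g.fd j
    infer_instance

lemma quot_Om (N : Submodule ℂ M) (hN : ∀ j, ∀ v ∈ N, g.e j v ∈ N) (k s : ℤ) (v : M) :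
    Om (g.quot N hN).e (g.quot N hN).e 6 k s (N.mkQ v) = N.mkQ (Om g.e g.e 6 k s v) := by
  simp only [Om, LinearMap.sum_apply, map_sum, LinearMap.smul_apply, Module.End.mul_apply, map_smul]
  rfl

lemma kill_of_quot (K : ℕ) (v : M)
    (h : (g.quot g.N2 fun j _ hv => g.N2_stable j hv).Kill K (g.N2.mkQ v)) : g.Kill (K + 2) v := by
  induction K generalizing v with
  | zero =>
    have h' : g.N2.mkQ v = 0 := h
    rw [Submodule.mkQ_apply, Submodule.Quotient.mk_eq_zero] at h'
    exact g.kill_two h'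
  | succ K ih => exact fun k s => ih _ (by rw [← quot_Om]; exact h k s)

/-- Reversal of the grading. -/
def flip : GWitt M where
  e j := -g.e (-j)
  he i j := by
    have := g.he (-i) (-j)
    rw [neg_mul_neg, neg_mul_neg, this, show -i + -j = -(i + j) by ring, smul_neg, ← neg_smul]
    congr 1; push_cast; ring
  lam := -g.lam
  G j := g.G (-j)
  map k j v hv := by
    rw [LinearMap.neg_apply]
    exact neg_mem (g.map' (by ring) hv)
  wt j v hv := by
    rw [LinearMap.neg_apply, neg_zero, g.wt _ v hv]; push_cast; module
  fd j := g.fd (-j)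

lemma flip_Om (k s : ℤ) : Om g.flip.e g.flip.e 6 k s = Om g.e g.e 6 (6 - k) (-s - 6) := by
  rw [Om, Om, ← Finset.sum_range_reflect]
  refine Finset.sum_congr rfl fun r hr => ?_
  have hr : r ≤ 6 := by simpa [Nat.lt_succ_iff] using hr
  simp only [flip, neg_mul_neg]
  congr 1
  · rw [show 6 + 1 - 1 - r = 6 - r by omega, Nat.choose_symm hr]
    interval_cases r <;> norm_num
  · rw [show 6 + 1 - 1 - r = 6 - r by omega, Nat.cast_sub hr]
    congr 2 <;> push_cast <;> ring

lemma kill_flip (K : ℕ) (v : M) (h : g.flip.Kill K v) : g.Kill K v := by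
  induction K generalizing v with
  | zero => exact h
  | succ K ih =>
    intro k s
    have := h (6 - k) (-s - 6)
    rw [flip_Om] at this
    simpa using ih _ this

end GWitt

end

end WSuper

namespace WSuper


noncomputable section

open Polynomial Matrix

namespace GWitt

variable {M : Type*} [AddCommGroup M] [Module ℂ M] (g : GWitt M)

lemma pow_mem_up (k : ℕ) {j : ℤ} {v : M} (hv : v ∈ g.G j) : (g.e 1 ^ k) v ∈ g.G (j + k) := by
  induction k with
  | zero => simpa using hv
  | succ k ih =>
    rw [pow_succ', Module.End.mul_apply]
    exact g.map' (by push_cast; ring) ih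

lemma pow_mem_down (k : ℕ) {j : ℤ} {v : M} (hv : v ∈ g.G j) : (g.e (-1) ^ k) v ∈ g.G (j - k) := by
  induction k with
  | zero => simpa using hv
  | succ k ih =>
    rw [pow_succ', Module.End.mul_apply]
    exact g.map' (by push_cast; ring) ih

lemma lowest_step {μ : ℤ} {v : M} (hv : v ∈ g.G μ) (h0 : g.e (-1) v = 0) (k : ℕ) :
    g.e (-1) ((g.e 1 ^ (k + 1)) v)
      = (((k : ℂ) + 1) * (2 * (g.lam + μ) + k)) • (g.e 1 ^ k) v := by
  induction k with
  | zero =>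
    have := g.comm (-1) 1 v
    rw [h0, map_zero, show (-1 : ℤ) + 1 = 0 by rfl, g.wt _ v hv] at this
    simp only [zero_add, pow_one, pow_zero, Module.End.one_apply, this]
    push_cast; module
  | succ k ih =>
    rw [pow_succ', Module.End.mul_apply, g.comm, ih, show (-1 : ℤ) + 1 = 0 by rfl,
      g.wt _ _ (g.pow_mem_up (k + 1) hv), map_smul, ← Module.End.mul_apply, ← pow_succ']
    push_cast; module

lemma lowest_pow {μ : ℤ} {v : M} (hv : v ∈ g.G μ) (h0 : g.e (-1) v = 0) (k : ℕ)
    (hk : ∀ i < k, 2 * (g.lam + μ) + i ≠ 0) :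
    ∃ c : ℂ, c ≠ 0 ∧ (g.e (-1) ^ k) ((g.e 1 ^ k) v) = c • v := by
  induction k with
  | zero => exact ⟨1, one_ne_zero, by simp⟩
  | succ k ih =>
    obtain ⟨c, hc, h⟩ := ih fun i hi => hk i (by omega)
    refine ⟨((k : ℂ) + 1) * (2 * (g.lam + μ) + k) * c,
      mul_ne_zero (mul_ne_zero (by exact_mod_cast k.succ_ne_zero) (hk k (by omega))) hc, ?_⟩
    rw [pow_succ (g.e (-1)), Module.End.mul_apply, g.lowest_step hv h0, map_smul, h, smul_smul]

lemma injective_far : ∃ b : ℤ, ∀ j ≤ b, ∀ v ∈ g.G j, g.e (-1) v = 0 → v = 0 := by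
  have := g.fd 0
  let f : ℕ →o Submodule ℂ (g.G 0) :=
    ⟨fun k => (LinearMap.ker (g.e (-1) ^ k)).comap (g.G 0).subtype, by
      refine monotone_nat_of_le_succ fun k v hv => ?_
      simp only [Submodule.mem_comap, LinearMap.mem_ker] at hv ⊢
      rw [pow_succ', Module.End.mul_apply, hv, map_zero]⟩
  obtain ⟨n, hn⟩ := monotone_stabilizes_iff_noetherian.mpr (inferInstance : IsNoetherian ℂ (g.G 0)) f
  obtain ⟨N, hN⟩ := exists_nat_gt (2 * g.lam.re)
  refine ⟨-(n + N + 1), fun j hj v hv h0 => ?_⟩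
  obtain ⟨k, rfl⟩ : ∃ k : ℕ, j = -k := ⟨j.natAbs, by omega⟩
  obtain ⟨c, hc, h⟩ := g.lowest_pow hv h0 k (fun i hi h => by
    have := congrArg Complex.re h
    simp at this
    have h1 : (i : ℝ) < k := by exact_mod_cast hi
    have h2 : (n : ℝ) + N + 1 ≤ k := by
      have : (n : ℤ) + N + 1 ≤ k := by omega
      exact_mod_cast this
    have h3 : (0 : ℝ) ≤ n := n.cast_nonneg
    linarith)
  have hu : (g.e 1 ^ k) v ∈ g.G 0 := by simpa using g.pow_mem_up k hv
  have hk1 : (⟨_, hu⟩ : g.G 0) ∈ f (k + 1) := by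
    change (g.e (-1) ^ (k + 1)) ((g.e 1 ^ k) v) = 0
    rw [pow_succ', Module.End.mul_apply, h, map_smul, h0, smul_zero]
  rw [← hn (k + 1) (by omega), hn k (by omega)] at hk1
  have hk2 : (g.e (-1) ^ k) ((g.e 1 ^ k) v) = 0 := hk1
  rw [h] at hk2
  exact (smul_eq_zero.mp hk2).resolve_left hc

/-- A sequence of vectors spanning a density module far to the left. -/
lemma exists_density_seq (b : ℤ) (d : ℕ) (hd : 0 < d)
    (hfr : ∀ j ≤ b, Module.finrank ℂ (g.G j) = d)
    (hinj : ∀ j ≤ b, ∀ v ∈ g.G j, g.e (-1) v = 0 → v = 0) :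
    ∃ (α : ℂ) (b' : ℤ) (v : ℤ → M), b' ≤ b ∧ (∀ j ≤ b', v j ≠ 0 ∧ v j ∈ g.G j) ∧
      ∀ k j : ℤ, j ≤ b' → j + k ≤ b' → g.e k (v j) = (g.lam + j + k * α) • v (j + k) := by
  have := g.fd b
  have : Nonempty (Fin d) := ⟨⟨0, hd⟩⟩
  let ψ : (Fin d → ℂ) ≃ₗ[ℂ] g.G b :=
    (Module.finBasisOfFinrankEq ℂ (g.G b) (hfr b le_rfl)).equivFun.symm
  let T : ℤ → (Fin d → ℂ) →ₗ[ℂ] M := fun j =>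
    (g.e (-1) ^ (b - j).toNat) ∘ₗ (g.G b).subtype ∘ₗ ψ.toLinearMap
  have hTmem : ∀ j ≤ b, ∀ u, T j u ∈ g.G j := by
    intro j hj u
    have := g.pow_mem_down (b - j).toNat (ψ u).2
    rwa [show b - ((b - j).toNat : ℤ) = j by omega] at this
  have hm : ∀ j ≤ b, ∀ u, g.e (-1) (T j u) = T (j - 1) u := by
    intro j hj u
    simp only [T, LinearMap.comp_apply]
    rw [show (b - (j - 1)).toNat = (b - j).toNat + 1 by omega, pow_succ', Module.End.mul_apply]
  have hTinj : ∀ j ≤ b, Function.Injective (T j) := by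
    intro j hj
    induction j, hj using Int.leInductionDown with
    | base =>
      intro u u' h
      simpa [T] using h
    | pred j hj ih =>
      rw [← LinearMap.ker_eq_bot, LinearMap.ker_eq_bot']
      intro u hu
      rw [← hm j hj] at hu
      have := hinj j hj _ (hTmem j hj u) hu
      exact (map_eq_zero_iff _ ih).mp this
  have hrange : ∀ j ≤ b, LinearMap.range (T j) = g.G j := by
    intro j hj
    have := g.fd j
    refine Submodule.eq_of_le_of_finrank_eq ?_ ?_
    · rintro _ ⟨u, rfl⟩; exact hTmem j hj u
    · rw [LinearMap.finrank_range_of_inj (hTinj j hj), hfr j hj]; simp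
  obtain ⟨α, b', c, w, hb', hw, hc, h⟩ := exists_density g.e g.he g.lam b T hTinj
    (fun j hj u => g.wt j _ (hTmem j hj u)) hm (by
      intro k j hj hjk
      obtain ⟨L, hL⟩ := LinearMap.exists_leftInverse_of_injective (T (j + k))
        (LinearMap.ker_eq_bot.mpr (hTinj _ hjk))
      refine ⟨LinearMap.toMatrix' (L ∘ₗ g.e k ∘ₗ T j), fun u => ?_⟩
      rw [LinearMap.toMatrix'_mulVec]
      have hr : g.e k (T j u) ∈ LinearMap.range (T (j + k)) := by
        rw [hrange _ hjk]; exact g.map _ _ _ (hTmem j hj u)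
      obtain ⟨u', hu'⟩ := hr
      simp only [LinearMap.comp_apply, ← hu']
      have := LinearMap.congr_fun hL u'
      simp only [LinearMap.comp_apply, LinearMap.id_apply] at this
      rw [this])
  refine ⟨α, b', fun j => T j (c j • w), hb', fun j hj => ⟨?_, hTmem j (by omega) _⟩, h⟩
  rw [Ne, map_eq_zero_iff _ (hTinj j (by omega))]
  exact smul_ne_zero (hc j hj) hw

section Seq

variable {α : ℂ} {b : ℤ} {v : ℤ → M}

lemma density_polynomial
    (h : ∀ k j : ℤ, j ≤ b → j + k ≤ b → g.e k (v j) = (g.lam + j + k * α) • v (j + k))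
    (t : ℤ) (ht : g.lam + t ≠ 0) (φ : M →ₗ[ℂ] ℂ) :
    ∃ p : ℂ[X], p.natDegree ≤ 3 ∧ ∃ b' ≤ b, ∀ j ≤ b', φ (g.e (t - j) (v j)) = p.eval (g.lam + (j : ℂ)) := by
  by_cases htb : b ≤ t
  · refine cross_polynomial g.lam α t b htb ht (fun j => φ (g.e (t - j) (v j))) ?_
    intro i hi j hj
    have h1 := h (t - i) (i + j - t) (by omega) (by omega)
    have h2 := h (t - j) (i + j - t) (by omega) (by omega)
    rw [show i + j - t + (t - i) = j by ring] at h1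
    rw [show i + j - t + (t - j) = i by ring] at h2
    have h3 := congrArg φ (g.comm (t - j) (t - i) (v (i + j - t)))
    rw [h1, h2, show t - j + (t - i) = t - (i + j - t) by ring] at h3
    simp only [map_add, map_smul, smul_eq_mul] at h3
    push_cast at h3 ⊢
    linear_combination h3
  · refine ⟨C (φ (v t)) * (C (1 - α) * X + C ((t + g.lam) * α)), by compute_degree; norm_num, b, le_rfl,
      fun j hj => ?_⟩
    rw [h _ _ hj (by omega), show j + (t - j) = t by ring, map_smul]
    simp
    ring

lemma density_Om_eq_zero
    (h : ∀ k j : ℤ, j ≤ b → j + k ≤ b → g.e k (v j) = (g.lam + j + k * α) • v (j + k)) :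
    ∃ b' ≤ b, ∀ μ ≤ b', ∀ k s : ℤ, g.lam + (μ + k + s : ℤ) ≠ 0 →
    Om g.e g.e 6 k s (v μ) = 0 := by
  obtain ⟨b1, hb1, hne⟩ := eventually_eval_ne_zero (X_ne_zero (R := ℂ)) g.lam b
  refine ⟨b1, hb1, fun μ hμ k s hT => ?_⟩
  simp only [eval_X] at hne
  rw [← Module.forall_dual_apply_eq_zero_iff ℂ]
  intro φ
  obtain ⟨p, hp, b2, hb2, hpol⟩ := g.density_polynomial h _ hT φ
  obtain ⟨j0, hj0⟩ : ∃ j0 : ℤ, ∀ j ≥ j0, μ - j + |k| + |s| + 6 ≤ b2 := ⟨μ + |k| + |s| + 6 - b2, fun j hj => by omega⟩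
  obtain ⟨j, hj, hc⟩ : ∃ j ≥ j0, g.lam + μ + (α - 1) * j ≠ 0 := by
    by_contra! hcon
    have e1 := hcon j0 le_rfl
    have e2 := hcon (j0 + 1) (by omega)
    push_cast at e2
    have : α - 1 = 0 := by linear_combination e2 - e1
    rw [this] at e1
    exact hne μ hμ (by linear_combination e1)
  have hj := hj0 j hj
  have hk1 := le_abs_self k
  have hk2 := neg_abs_le k
  have hs1 := le_abs_self s
  have hs2 := neg_abs_le s
  have hks : g.e j (v (μ - j)) = (g.lam + μ + (α - 1) * j) • v μ := by
    rw [h j (μ - j) (by omega) (by omega), sub_add_cancel]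
    congr 1; push_cast; ring
  suffices hs : φ (Om g.e g.e 6 k s (g.e j (v (μ - j)))) = 0 by
    rw [hks, map_smul, map_smul, smul_eq_mul] at hs
    exact (mul_eq_zero.mp hs).resolve_left hc
  set w : ℂ := g.lam + μ - j with hw
  let P : ℂ[X] :=
    C (φ (g.e j (v (μ - j + k + s)))) * ((C (w + s * α) + C α * X) * (C (w + s + k * α) + C (1 - α) * X))
    + (C (j - k : ℂ) + X) * (C (w + s * α) + C α * X) * p.comp (C (w + s) + X)
    + (C (j - s : ℂ) - X) * (C (w + k * α) - C α * X) * p.comp (C (w + k) - X)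
    + C (φ (g.e (k + s + j) (v (μ - j)))) * ((C (j - s : ℂ) - X) * (C (s + j - k : ℂ) + C 2 * X))
  have hP : P.natDegree ≤ 5 := by
    have d1 : (p.comp (C (w + s) + X)).natDegree ≤ 3 := by
      refine natDegree_comp_le.trans ?_
      have : (C (w + s) + X : ℂ[X]).natDegree ≤ 1 := by compute_degree
      nlinarith
    have d2 : (p.comp (C (w + k) - X)).natDegree ≤ 3 := by
      refine natDegree_comp_le.trans ?_
      have : (C (w + k) - X : ℂ[X]).natDegree ≤ 1 := by compute_degree
      nlinarith
    refine natDegree_add_le_of_degree_le (natDegree_add_le_of_degree_le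
      (natDegree_add_le_of_degree_le (by compute_degree; norm_num) ?_) ?_) (by compute_degree; norm_num)
    · exact natDegree_mul_le_of_le (m := 2) (n := 3) (by compute_degree) d1
    · exact natDegree_mul_le_of_le (m := 2) (n := 3) (by compute_degree) d2
  rw [← alternating_sum_eval hP, Om, LinearMap.sum_apply, map_sum]
  refine Finset.sum_congr rfl fun r hr => ?_
  have hr : (r : ℤ) ≤ 6 := by
    have := Finset.mem_range.mp hr
    omega
  have hr0 : (0 : ℤ) ≤ r := by positivity
  rw [LinearMap.smul_apply, map_smul, smul_eq_mul]
  congr 1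
  have a1 := hpol (μ - j + (s + r)) (by omega)
  have a2 := hpol (μ - j + (k - r)) (by omega)
  rw [show μ + k + s - (μ - j + (s + r)) = k - r + j by ring] at a1
  rw [show μ + k + s - (μ - j + (k - r)) = s + r + j by ring] at a2
  rw [Module.End.mul_apply, g.comm (s + r) j, map_add, map_smul, g.comm (k - r) j,
    g.comm (k - r) (s + r + j), h (s + r) (μ - j) (by omega) (by omega),
    h (k - r) (μ - j) (by omega) (by omega), map_smul, map_smul, map_smul,
    h (k - r) (μ - j + (s + r)) (by omega) (by omega),
    show μ - j + (s + r) + (k - r) = μ - j + k + s by ring,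
    show k - r + (s + r + j) = k + s + j by ring]
  simp only [map_add, map_smul, smul_eq_mul, a1, a2]
  simp only [P, eval_add, eval_sub, eval_mul, eval_C, eval_X, eval_comp]
  have c1 : g.lam + ((μ - j + (s + r) : ℤ) : ℂ) = w + s + r := by push_cast; ring
  have c2 : g.lam + ((μ - j + (k - r) : ℤ) : ℂ) = w + k - r := by push_cast; ring
  rw [c1, c2, show w + (k : ℂ) - r = w + k - r by ring]
  push_cast
  rw [hw]
  ring

lemma density_mem_N2 (hv : ∀ j ≤ b, v j ∈ g.G j)
    (h : ∀ k j : ℤ, j ≤ b → j + k ≤ b → g.e k (v j) = (g.lam + j + k * α) • v (j + k)) :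
    ∃ b' ≤ b, ∀ μ ≤ b', v μ ∈ g.N2 := by
  obtain ⟨b', hb', hz⟩ := g.density_Om_eq_zero h
  refine ⟨b' - 2, by omega, fun μ hμ => g.mem_N2 fun k s k' s' => ?_⟩
  by_cases hT : g.lam + (μ + k' + s' : ℤ) = 0
  swap
  · rw [hz μ (by omega) k' s' hT, map_zero]
  set z := Om g.e g.e 6 k' s' (v μ) with hzdef
  have hzmem : z ∈ g.G (μ + k' + s') := g.Om_mem _ _ rfl (hv μ (by omega))
  have h1 : ∀ j : ℤ, j ≤ 2 → g.e j z = 0 := by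
    intro j hj
    rcases eq_or_ne j 0 with rfl | hj0
    · rw [g.wt _ _ hzmem, hT, zero_smul]
    have h2 : Om g.e g.e 6 k' s' (g.e j (v μ)) = 0 := by
      rw [h j μ (by omega) (by omega), map_smul, hz (μ + j) (by omega), smul_zero]
      intro h0
      have : (j : ℂ) = 0 := by push_cast at h0 hT; linear_combination h0 - hT
      exact hj0 (by exact_mod_cast this)
    have h3 : (g.e j * Om g.e g.e 6 k' s' - Om g.e g.e 6 k' s' * g.e j) (v μ) ∈ g.G (μ + k' + s') := by
      have hle : SS g.e 6 ≤ (g.G (μ + k' + s')).comap (LinearMap.applyₗ (v μ)) :=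
        SS_le_of_Om _ _ _ fun k'' s'' => by
          simp only [Submodule.mem_comap, LinearMap.applyₗ_apply_apply]
          by_cases hc : μ + k'' + s'' = μ + k' + s'
          · exact g.Om_mem _ _ hc (hv μ (by omega))
          · rw [hz μ (by omega)]
            · exact zero_mem _
            · intro h0
              have : ((μ + k'' + s'' : ℤ) : ℂ) = (μ + k' + s' : ℤ) := by linear_combination h0 - hT
              exact hc (by exact_mod_cast this)
      exact hle (SS_ad g.e g.he 6 j (Om_mem_SS _ _ _ _))
    rw [LinearMap.sub_apply, Module.End.mul_apply, Module.End.mul_apply, h2, sub_zero] at h3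
    exact g.eq_zero_of_mem (by omega) h3 (g.map j _ _ hzmem)
  have h2 : ∀ j : ℤ, g.e j z = 0 := by
    intro j
    rcases le_total j 2 with hj | hj
    · exact h1 j hj
    induction j, hj using Int.leInduction with
    | base => exact h1 2 le_rfl
    | succ j hj ih =>
      have := g.comm 1 j z
      rw [ih, h1 1 (by omega), map_zero, map_zero, zero_add, eq_comm, smul_eq_zero] at this
      rw [add_comm]
      refine this.resolve_left fun h0 => ?_
      have : (j : ℂ) = 1 := by push_cast at h0; linear_combination h0
      have : j = 1 := by exact_mod_cast this
      omega
  rw [Om, LinearMap.sum_apply]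
  exact Finset.sum_eq_zero fun r _ => by
    rw [LinearMap.smul_apply, Module.End.mul_apply, h2, map_zero, smul_zero]

end Seq

/-- Eventual dimension bounds force iterated vanishing of difference operators. -/
theorem kill_of_bounds (D : ℕ) : ∀ (M : Type) [AddCommGroup M] [Module ℂ M] (g : GWitt M) (dl dr : ℕ),
    dl + dr = D → (∃ b, ∀ j ≤ b, Module.finrank ℂ (g.G j) ≤ dl) →
    (∃ b, ∀ j ≥ b, Module.finrank ℂ (g.G j) ≤ dr) → ∀ j, ∀ v ∈ g.G j, g.Kill (2 * D + 1) v := by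
  induction D with
  | zero =>
    intro M _ _ g dl dr hD hl hr j v hv k s
    obtain ⟨rfl, rfl⟩ : dl = 0 ∧ dr = 0 := by omega
    obtain ⟨b, hb⟩ := hr
    obtain ⟨a, ha⟩ := hl
    have hG : ∀ j, Module.finrank ℂ (g.G j) ≤ 0 → ∀ v ∈ g.G j, v = 0 := by
      intro j hj v hv
      have := g.fd j
      have := Submodule.finrank_eq_zero.mp (Nat.le_zero.mp hj)
      rw [this] at hv
      exact (Submodule.mem_bot ℂ).mp hv
    have hz : ∀ j, ∀ v ∈ g.G j, ∀ i, g.e i v = 0 := by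
      intro j v hv i
      obtain ⟨k, h1, h2, h3⟩ : ∃ k : ℤ, b ≤ j + k ∧ j + (i - k) ≤ a ∧ i - 2 * k < 0 :=
        ⟨|b| + |j| + |i| + |a| + 1, by
          have := le_abs_self b; have := neg_abs_le j; have := abs_nonneg i; have := abs_nonneg a
          omega, by
          have := abs_nonneg b; have := le_abs_self j; have := le_abs_self i; have := neg_abs_le a
          omega, by
          have := abs_nonneg b; have := abs_nonneg j; have := le_abs_self i; have := abs_nonneg a
          have := abs_nonneg i
          omega⟩
      have := g.comm k (i - k) v
      rw [hG _ (hb _ h1) _ (g.map k j v hv), hG _ (ha _ h2) _ (g.map (i - k) j v hv), map_zero,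
        map_zero, zero_add, add_sub_cancel, eq_comm, smul_eq_zero] at this
      refine this.resolve_left fun h0 => ?_
      have : ((i - 2 * k : ℤ) : ℂ) = 0 := by push_cast at h0 ⊢; linear_combination h0
      have : i - 2 * k = 0 := by exact_mod_cast this
      omega
    change Om g.e g.e 6 k s v = 0
    rw [Om, LinearMap.sum_apply]
    exact Finset.sum_eq_zero fun r _ => by
      rw [LinearMap.smul_apply, Module.End.mul_apply, hz j v hv, map_zero, smul_zero]
  | succ D ih =>
    have step : ∀ (M : Type) [AddCommGroup M] [Module ℂ M] (g : GWitt M) (dl dr : ℕ),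
        dl + 1 + dr = D + 1 → (∃ b, ∀ j ≤ b, Module.finrank ℂ (g.G j) ≤ dl + 1) →
        (∃ b, ∀ j ≥ b, Module.finrank ℂ (g.G j) ≤ dr) →
        ∀ j, ∀ v ∈ g.G j, g.Kill (2 * (D + 1) + 1) v := by
      intro M _ _ g dl dr hD hl hr
      obtain ⟨b1, hb1⟩ := hl
      obtain ⟨b2, hinj⟩ := g.injective_far
      have hmono : ∀ j ≤ b2, Module.finrank ℂ (g.G j) ≤ Module.finrank ℂ (g.G (j - 1)) := by
        intro j hj
        have := g.fd (j - 1)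
        refine LinearMap.finrank_le_finrank_of_injective
          (f := (g.e (-1)).restrict (p := g.G j) (q := g.G (j - 1)) fun v hv => g.map _ _ _ hv) ?_
        rw [← LinearMap.ker_eq_bot, LinearMap.ker_eq_bot']
        intro v hv
        exact Subtype.ext (hinj j hj v v.2 (congrArg Subtype.val hv))
      by_cases hex : ∃ b3 ≤ min b1 b2, Module.finrank ℂ (g.G b3) = dl + 1
      · obtain ⟨b3, hb3, hfr⟩ := hex
        have hall : ∀ j ≤ b3, Module.finrank ℂ (g.G j) = dl + 1 := by
          intro j hj
          induction j, hj using Int.leInductionDown with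
          | base => exact hfr
          | pred j hj ih =>
            exact le_antisymm (hb1 _ (by omega)) (ih ▸ hmono j (by omega))
        obtain ⟨α, b4, v, hb4, hv, hden⟩ := g.exists_density_seq b3 (dl + 1) (by omega) hall
          (fun j hj => hinj j (by omega))
        obtain ⟨b5, hb5, hN⟩ := g.density_mem_N2 (fun j hj => (hv j hj).2) hden
        intro j x hx
        rw [show 2 * (D + 1) + 1 = (2 * D + 1) + 2 by ring]
        refine g.kill_of_quot _ _ (ih _ (g.quot g.N2 fun j _ hv => g.N2_stable j hv) dl dr (by omega)
          ⟨b5, fun j hj => ?_⟩ ?_ j _ ⟨x, hx, rfl⟩)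
        · have := g.fd j
          have h1 : Module.finrank ℂ (g.G j) = dl + 1 := hall j (by omega)
          let f : g.G j →ₗ[ℂ] (M ⧸ g.N2) := g.N2.mkQ ∘ₗ (g.G j).subtype
          have h2 := LinearMap.finrank_range_add_finrank_ker f
          have h3 : 0 < Module.finrank ℂ (LinearMap.ker f) := by
            rw [Module.finrank_pos_iff_exists_ne_zero]
            refine ⟨⟨⟨v j, (hv j (by omega)).2⟩, ?_⟩, fun h0 => (hv j (by omega)).1 ?_⟩
            · simp only [f, LinearMap.mem_ker, LinearMap.comp_apply, Submodule.subtype_apply,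
                Submodule.mkQ_apply, Submodule.Quotient.mk_eq_zero]
              exact hN j hj
            · exact congrArg (fun x : LinearMap.ker f => ((x : g.G j) : M)) h0
          have h4 : LinearMap.range f = (g.quot g.N2 fun j _ hv => g.N2_stable j hv).G j := by
            rw [LinearMap.range_comp, Submodule.range_subtype]; rfl
          rw [← h4]
          omega
        · obtain ⟨b, hb⟩ := hr
          refine ⟨b, fun j hj => (?_ : _ ≤ _).trans (hb j hj)⟩
          have := g.fd j
          exact Submodule.finrank_map_le _ _
      · push Not at hex
        intro j v hv
        have := ih M g dl dr (by omega) ⟨min b1 b2, fun j hj =>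
          Nat.lt_succ_iff.mp (lt_of_le_of_ne (hb1 j (by omega)) (hex j hj))⟩ hr
        exact g.kill_succ (g.kill_succ this) j v hv
    intro M _ _ g dl dr hD hl hr j v hv
    rcases dl with _ | dl
    · obtain ⟨dr, rfl⟩ : ∃ d, dr = d + 1 := ⟨D, by omega⟩
      refine g.kill_flip _ _ (step M g.flip dr 0 (by omega) ?_ ?_ (-j) v ?_)
      · obtain ⟨b, hb⟩ := hr; exact ⟨-b, fun j hj => hb (-j) (by omega)⟩
      · obtain ⟨b, hb⟩ := hl; exact ⟨-b, fun j hj => hb (-j) (by omega)⟩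
      · simpa [flip] using hv
    · exact step M g dl dr hD hl hr j v hv

end GWitt

/-- Uniformly bounded dimensions give a uniform order of vanishing. -/
theorem rank_one_vanishing (C : ℕ) : ∃ N : ℕ, ∀ (M : Type) [AddCommGroup M] [Module ℂ M] (g : GWitt M),
    (∀ j, Module.finrank ℂ (g.G j) ≤ C) → ∀ k s j, ∀ v ∈ g.G j, Om g.e g.e N k s v = 0 := by
  obtain ⟨q, hq⟩ : ∃ q : ℕ, 2 * (C + C) + 1 ≤ 2 ^ q := ⟨_, Nat.lt_two_pow_self.le⟩
  refine ⟨4 ^ q * 6, fun M _ _ g hC k s j v hv => ?_⟩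
  have h1 : ∀ K, 2 * (C + C) + 1 ≤ K → ∀ j, ∀ v ∈ g.G j, g.Kill K v := by
    intro K hK
    induction K, hK using Nat.le_induction with
    | base => exact g.kill_of_bounds (C + C) M C C rfl ⟨0, fun j _ => hC j⟩ ⟨0, fun j _ => hC j⟩
    | succ K hK ih => exact g.kill_succ ih
  exact (h1 _ hq j v hv).pow g _ (SS_four_pow_le g.e g.he (by norm_num) q (Om_mem_SS _ _ _ _))

end

end WSuper

namespace WSuper

open scoped AddMonoidAlgebra


noncomputable section

section Transfer

variable {R : Type*} [Ring R] [Algebra ℂ R]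

private def inclPair : (ℤ × ℤ) →+ (ℤ × ℤ × ℤ) where
  toFun p := (p.1, p.2, 0)
  map_zero' := rfl
  map_add' a b := by ext <;> simp

private def fuse12 : (ℤ × ℤ × ℤ) →+ (ℤ × ℤ) where
  toFun p := (p.1 + p.2.2, p.2.1)
  map_zero' := rfl
  map_add' a b := by ext <;> simp; ring

private def fuse23 : (ℤ × ℤ × ℤ) →+ (ℤ × ℤ) where
  toFun p := (p.1, p.2.1 + p.2.2)
  map_zero' := rfl
  map_add' a b := by ext <;> simp; ring

lemma evl_zero_of_ev2 (X Y : ℤ → R) (N : ℕ) (h : ∀ g, ev2 X Y ((xA - xB) ^ N * g) = 0)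
    (L : ℤ → R →ₗ[ℂ] R) (g) :
    evl (fun a : ℤ × ℤ × ℤ => L a.2.2 (X a.1 * Y a.2.1)) ((yA - yB) ^ N * g) = 0 := by
  have key : ∀ f c, evl (fun a : ℤ × ℤ × ℤ => L a.2.2 (X a.1 * Y a.2.1))
      (mapMon inclPair f * mon (0, 0, c)) = L c (ev2 X Y f) := by
    intro f c
    induction f using laurent_induct with
    | h0 => simp
    | hadd f g hf hg => simp only [map_add, add_mul, hf, hg]
    | hs a d => simp [inclPair, ev2]
  induction g using laurent_induct with
  | h0 => simp
  | hadd f g hf hg => rw [mul_add, map_add, hf, hg, add_zero]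
  | hs a c =>
    have e1 : (yA - yB) ^ N * (c • mon a)
        = c • (mapMon inclPair ((xA - xB) ^ N * mon (a.1, a.2.1)) * mon (0, 0, a.2.2)) := by
      rw [map_mul, map_pow, map_sub, mul_smul_comm]
      simp only [AddMonoidAlgebra.mapDomainRingHom_apply, AddMonoidAlgebra.mapDomain_single,
        inclPair, AddMonoidHom.coe_mk, ZeroHom.coe_mk, mul_assoc, AddMonoidAlgebra.single_mul_single]
      simp
    rw [e1, map_smul, key, h, map_zero, smul_zero]

/-- The order of vanishing passes from `e, e` to `Y, e`. -/
lemma ev2_vanish_left (e Y : ℤ → R) (κ η : ℂ) (hη : η + 1 ≠ 0)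
    (hY : ∀ a c : ℤ, e a * Y c - Y c * e a = (κ + c - η * a) • Y (a + c)) (N : ℕ)
    (hN : ∀ g, ev2 e e ((xA - xB) ^ N * g) = 0) (g) : ev2 Y e ((xA - xB) ^ (N + 2) * g) = 0 := by
  induction g using laurent_induct with
  | h0 => simp
  | hadd f g hf hg => rw [mul_add, map_add, hf, hg, add_zero]
  | hs a c =>
  rw [mul_smul_comm, map_smul]
  suffices hs : ev2 Y e ((xA - xB) ^ (N + 2) * mon a) = 0 by rw [hs, smul_zero]
  set f : AddMonoidAlgebra ℂ (ℤ × ℤ × ℤ) := (yB - yC) ^ 2 * (yA - yC) * mon (a.1 - 1, a.2, 0)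
  have z1 := evl_zero_of_ev2 e e N hN (fun c => LinearMap.mulRight ℂ (Y c)) f
  have z2 := evl_zero_of_ev2 e e N hN (fun c => LinearMap.mulLeft ℂ (Y c)) f
  have s1 : evl (fun a : ℤ × ℤ × ℤ => (κ + a.2.2 - η * a.2.1) • (e a.1 * Y (a.2.1 + a.2.2)))
      ((yA - yB) ^ N * f) = 0 := by
    have := evl_contract_sq fuse23 (fun p : ℤ × ℤ => e p.1 * Y p.2)
      (fun a => κ + a.2.2 - η * a.2.1) (-1 - η) (0, 1, 0) (0, 0, 1) (by simp [fuse23])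
      (fun a => by simp; ring) ((yA - yB) ^ N * ((yA - yC) * mon (a.1 - 1, a.2, 0)))
    rw [← this]
    simp only [fuse23, f]
    congr 1
    ring
  have s2 : evl (fun a : ℤ × ℤ × ℤ => (κ + a.2.2 - η * a.1) • (Y (a.1 + a.2.2) * e a.2.1))
      ((yA - yB) ^ N * f) = (-1 - η) • ev2 Y e ((xA - xB) ^ (N + 2) * mon a) := by
    have := evl_contract fuse12 (fun p : ℤ × ℤ => Y p.1 * e p.2)
      (fun a => κ + a.2.2 - η * a.1) (-1 - η) (1, 0, 0) (0, 0, 1) (by simp [fuse12])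
      (fun a => by simp; ring) ((yA - yB) ^ N * ((yB - yC) ^ 2 * mon (a.1 - 1, a.2, 0)))
    rw [show (xA - xB) ^ (N + 2) * mon a = mapMon fuse12
      (mon (1, 0, 0) * ((yA - yB) ^ N * ((yB - yC) ^ 2 * mon (a.1 - 1, a.2, 0)))) from ?_, ev2, ← this]
    · simp only [fuse12, f]
      congr 1
      ring
    · simp only [map_mul, map_pow, map_sub, AddMonoidAlgebra.mapDomainRingHom_apply,
        AddMonoidAlgebra.mapDomain_single, fuse12, AddMonoidHom.coe_mk, ZeroHom.coe_mk]
      rw [show (mon a : AddMonoidAlgebra ℂ (ℤ × ℤ)) = xA * mon (a.1 - 1 + 0, a.2) from ?_]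
      · simp only [add_zero, zero_add]
        ring
      · simp
  have : (evl (fun a : ℤ × ℤ × ℤ => (κ + a.2.2 - η * a.2.1) • (e a.1 * Y (a.2.1 + a.2.2)))
      ((yA - yB) ^ N * f)) + evl (fun a : ℤ × ℤ × ℤ => (κ + a.2.2 - η * a.1) • (Y (a.1 + a.2.2) * e a.2.1))
      ((yA - yB) ^ N * f) = 0 := by
    rw [evl_add, ← sub_eq_zero.mpr (z1.trans z2.symm), evl_sub]
    congr 2
    funext p
    simp only [LinearMap.mulRight_apply, LinearMap.mulLeft_apply]
    rw [← mul_smul_comm, ← smul_mul_assoc, ← hY, ← hY]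
    noncomm_ring
  rw [s1, s2, zero_add, smul_eq_zero] at this
  exact this.resolve_left fun h0 => hη (by linear_combination -h0)

/-- The order of vanishing passes from `Y, e` to `Y, Z`. -/
lemma ev2_vanish_right (e Y Z P Q : ℤ → R) (ε κ η p0 p1 p2 q0 q1 q2 : ℂ) (hη : η + 1 ≠ 0)
    (hε : ε ≠ 0)
    (hZ : ∀ a c : ℤ, e a * Z c - Z c * e a = (κ + c - η * a) • Z (a + c))
    (hZY : ∀ x z : ℤ, Z z * Y x = ε • (Y x * Z z) + (p0 + p1 * x + p2 * z) • P (x + z)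
      + (q0 + q1 * x + q2 * z) • Q (x + z)) (N : ℕ)
    (hN : ∀ g, ev2 Y e ((xA - xB) ^ N * g) = 0) (g) : ev2 Y Z ((xA - xB) ^ (N + 2) * g) = 0 := by
  induction g using laurent_induct with
  | h0 => simp
  | hadd f g hf hg => rw [mul_add, map_add, hf, hg, add_zero]
  | hs a c =>
  rw [mul_smul_comm, map_smul]
  suffices hs : ev2 Y Z ((xA - xB) ^ (N + 2) * mon a) = 0 by rw [hs, smul_zero]
  set f : AddMonoidAlgebra ℂ (ℤ × ℤ × ℤ) := (yA - yC) ^ 2 * (yC - yB) * mon (a.1, a.2 - 1, 0)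
  have z1 := evl_zero_of_ev2 Y e N hN (fun c => ε • LinearMap.mulRight ℂ (Z c)) f
  have z2 := evl_zero_of_ev2 Y e N hN (fun c => LinearMap.mulLeft ℂ (Z c)) f
  have s1 : ∀ (P : ℤ → R) (p0 p1 p2 : ℂ),
      evl (fun a : ℤ × ℤ × ℤ => (p0 + p1 * a.1 + p2 * a.2.2) • (P (a.1 + a.2.2) * e a.2.1))
      ((yA - yB) ^ N * f) = 0 := by
    intro P p0 p1 p2
    have := evl_contract_sq fuse12 (fun p : ℤ × ℤ => P p.1 * e p.2)
      (fun a => p0 + p1 * a.1 + p2 * a.2.2) (p1 - p2) (1, 0, 0) (0, 0, 1) (by simp [fuse12])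
      (fun a => by simp; ring) ((yA - yB) ^ N * ((yC - yB) * mon (a.1, a.2 - 1, 0)))
    rw [← this]
    simp only [fuse12, f]
    congr 1
    ring
  have s2 : evl (fun a : ℤ × ℤ × ℤ => (κ + a.2.2 - η * a.2.1) • (Y a.1 * Z (a.2.1 + a.2.2)))
      ((yA - yB) ^ N * f) = (1 + η) • ev2 Y Z ((xA - xB) ^ (N + 2) * mon a) := by
    have := evl_contract fuse23 (fun p : ℤ × ℤ => Y p.1 * Z p.2)
      (fun a => κ + a.2.2 - η * a.2.1) (1 + η) (0, 0, 1) (0, 1, 0) (by simp [fuse23])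
      (fun a => by simp; ring) ((yA - yB) ^ N * ((yA - yC) ^ 2 * mon (a.1, a.2 - 1, 0)))
    rw [show (xA - xB) ^ (N + 2) * mon a = mapMon fuse23
      (mon (0, 0, 1) * ((yA - yB) ^ N * ((yA - yC) ^ 2 * mon (a.1, a.2 - 1, 0)))) from ?_, ev2, ← this]
    · simp only [fuse23, f]
      congr 1
      ring
    · simp only [map_mul, map_pow, map_sub, AddMonoidAlgebra.mapDomainRingHom_apply,
        AddMonoidAlgebra.mapDomain_single, fuse23, AddMonoidHom.coe_mk, ZeroHom.coe_mk]
      rw [show (mon a : AddMonoidAlgebra ℂ (ℤ × ℤ)) = xB * mon (a.1, a.2 - 1 + 0) from ?_]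
      · simp only [add_zero, zero_add]
        ring
      · simp
  have : (-ε) • (evl (fun a : ℤ × ℤ × ℤ => (κ + a.2.2 - η * a.2.1) • (Y a.1 * Z (a.2.1 + a.2.2)))
      ((yA - yB) ^ N * f))
      + (evl (fun a : ℤ × ℤ × ℤ => (p0 + p1 * a.1 + p2 * a.2.2) • (P (a.1 + a.2.2) * e a.2.1))
      ((yA - yB) ^ N * f) + evl (fun a : ℤ × ℤ × ℤ => (q0 + q1 * a.1 + q2 * a.2.2) • (Q (a.1 + a.2.2) * e a.2.1))
      ((yA - yB) ^ N * f)) = 0 := by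
    rw [← LinearMap.lsmul_apply (R := ℂ), evl_comp, evl_add, evl_add,
      ← sub_eq_zero.mpr (z2.trans z1.symm), evl_sub]
    congr 2
    funext p
    simp only [LinearMap.mulRight_apply, LinearMap.mulLeft_apply, LinearMap.smul_apply,
      LinearMap.lsmul_apply]
    rw [← mul_assoc, hZY, add_mul, add_mul, smul_mul_assoc, smul_mul_assoc, smul_mul_assoc,
      mul_assoc (Y p.1), mul_assoc (Y p.1), ← mul_smul_comm, ← hZ, mul_sub]
    module
  rw [s1, s1, s2, add_zero, add_zero, smul_smul, smul_eq_zero] at this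
  exact this.resolve_left fun h0 => by
    rcases mul_eq_zero.mp h0 with h | h
    · exact hε (neg_eq_zero.mp h)
    · exact hη (by rw [add_comm]; exact h)

end Transfer

end

end WSuper

namespace WSuper


noncomputable section

section Grassmann

variable {n : ℕ}

/-- The bicharacter `(-1)^{inv(s,q)}`. -/
def bich (s q : GExp n) : ℂ := (-1 : ℂ) ^ invCount s q

/-- The parity character. -/
def gsgn (s : GExp n) : ℂ := (-1 : ℂ) ^ gdeg s

/-- The exponent of a single Grassmann generator. -/
def gone (a : Fin n) : GExp n := fun x => decide (x = a)

/-- Disjointness of exponents. -/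
def Dj (s q : GExp n) : Prop := ∀ a, ¬(s a = true ∧ q a = true)

lemma neg_one_pow_card_filter {ι : Type*} (S : Finset ι) (p : ι → Prop) [DecidablePred p] :
    (-1 : ℂ) ^ (S.filter p).card = ∏ x ∈ S, if p x then (-1 : ℂ) else 1 := by
  rw [Finset.prod_ite, Finset.prod_const, Finset.prod_const_one, mul_one]

lemma gsgn_eq (s : GExp n) : gsgn s = ∏ x, if s x = true then (-1 : ℂ) else 1 := by
  rw [gsgn, gdeg, neg_one_pow_card_filter]

lemma bich_eq (s q : GExp n) :
    bich s q = ∏ x, ∏ y, if s x = true ∧ q y = true ∧ y < x then (-1 : ℂ) else 1 := by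
  rw [bich, invCount, neg_one_pow_card_filter, Finset.prod_product]

lemma bich_xor_left (s s' q : GExp n) : bich (xorE s s') q = bich s q * bich s' q := by
  simp only [bich_eq, ← Finset.prod_mul_distrib]
  refine Finset.prod_congr rfl fun x _ => Finset.prod_congr rfl fun y _ => ?_
  simp only [xorE]
  by_cases h1 : s x = true <;> by_cases h2 : s' x = true <;>
    by_cases h : q y = true <;> by_cases h' : y < x <;> simp_all

lemma bich_xor_right (s q q' : GExp n) : bich s (xorE q q') = bich s q * bich s q' := by
  simp only [bich_eq, ← Finset.prod_mul_distrib]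
  refine Finset.prod_congr rfl fun x _ => Finset.prod_congr rfl fun y _ => ?_
  simp only [xorE]
  by_cases h1 : q y = true <;> by_cases h2 : q' y = true <;>
    by_cases h : s x = true <;> by_cases h' : y < x <;> simp_all

lemma gsgn_xor (s q : GExp n) : gsgn (xorE s q) = gsgn s * gsgn q := by
  simp only [gsgn_eq, ← Finset.prod_mul_distrib]
  refine Finset.prod_congr rfl fun x _ => ?_
  simp only [xorE]
  by_cases h1 : s x = true <;> by_cases h2 : q x = true <;> simp_all

lemma gsgn_mul_self (s : GExp n) : gsgn s * gsgn s = 1 := by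
  rw [gsgn, ← pow_add, ← two_mul, pow_mul]; simp

lemma bich_mul_self (s q : GExp n) : bich s q * bich s q = 1 := by
  rw [bich, ← pow_add, ← two_mul, pow_mul]; simp

lemma neg_one_pow_gdeg_mul (s q : GExp n) :
    (-1 : ℂ) ^ (gdeg s * gdeg q) = ∏ x, ∏ y, if s x = true ∧ q y = true then (-1 : ℂ) else 1 := by
  rw [← Finset.prod_product', ← neg_one_pow_card_filter, gdeg, gdeg, ← Finset.card_product]
  congr 2
  ext p
  simp

lemma bich_swap {s q : GExp n} (h : Dj s q) :
    bich s q * bich q s = (-1 : ℂ) ^ (gdeg s * gdeg q) := by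
  rw [neg_one_pow_gdeg_mul, bich_eq, bich_eq, Finset.prod_comm (f := fun x y => if q x = true ∧ _ then _ else _)]
  simp only [← Finset.prod_mul_distrib]
  refine Finset.prod_congr rfl fun x _ => Finset.prod_congr rfl fun y _ => ?_
  rcases lt_trichotomy x y with hxy | rfl | hxy
  · by_cases h1 : s x = true <;> by_cases h2 : q y = true <;> simp_all [hxy.not_gt]
  · have := h x
    simp [this]
  · by_cases h1 : s x = true <;> by_cases h2 : q y = true <;> simp_all [hxy.not_gt]

lemma gdeg_gone (a : Fin n) : gdeg (gone a) = 1 := by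
  simp [gdeg, gone, Finset.filter_eq']

lemma bich_gone_left (a : Fin n) (s : GExp n) :
    bich (gone a) s = (-1 : ℂ) ^ (Finset.univ.filter fun x => s x = true ∧ x < a).card := by
  rw [bich_eq, neg_one_pow_card_filter, Finset.prod_eq_single a]
  · simp [gone]
  · intro b _ hb; simp [gone, hb]
  · simp

lemma bich_gone_right (a : Fin n) (s : GExp n) :
    bich s (gone a) = bich (gone a) s * gsgn s * (if s a = true then -1 else 1) := by
  have h1 : bich s (gone a) = ∏ x, if s x = true ∧ a < x then (-1 : ℂ) else 1 := by
    rw [bich_eq]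
    refine Finset.prod_congr rfl fun x _ => ?_
    rw [Finset.prod_eq_single a]
    · simp [gone]
    · intro b _ hb; simp [gone, hb]
    · simp
  have h2 : (if s a = true then (-1 : ℂ) else 1) = ∏ x, if s x = true ∧ x = a then (-1 : ℂ) else 1 := by
    rw [Finset.prod_eq_single a]
    · simp
    · intro b _ hb; simp [hb]
    · simp
  rw [h1, h2, bich_gone_left, neg_one_pow_card_filter, gsgn_eq, ← Finset.prod_mul_distrib,
    ← Finset.prod_mul_distrib]
  refine Finset.prod_congr rfl fun x _ => ?_
  rcases lt_trichotomy x a with hxy | rfl | hxy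
  · by_cases h1 : s x = true <;> simp [h1, hxy, hxy.not_gt, hxy.ne]
  · by_cases h1 : s x = true <;> simp [h1]
  · by_cases h1 : s x = true <;> simp [h1, hxy, hxy.not_gt, hxy.ne']

lemma bich_gone_gone {a b : Fin n} (h : a ≠ b) :
    bich (gone a) (gone b) = -bich (gone b) (gone a) := by
  rw [bich_gone_right, gsgn, gdeg_gone]
  simp [gone, h.symm]

open Classical in
lemma mulSgn_eq (s q : GExp n) : mulSgn s q = if Dj s q then bich s q else 0 := by
  unfold mulSgn Dj bich
  by_cases h : ∃ a, s a = true ∧ q a = true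
  · rw [if_pos h, if_neg (by push Not; simpa using h)]
  · rw [if_neg h, if_pos (by simpa using h)]

lemma derC_eq (a : Fin n) (s : GExp n) : derC a s = if s a = true then bich (gone a) s else 0 := by
  rw [derC, bich_gone_left]

lemma derE_eq {a : Fin n} {s : GExp n} (h : s a = true) : derE a s = xorE s (gone a) := by
  funext x
  by_cases hx : x = a
  · subst hx; simp [derE, xorE, gone, h]
  · simp [derE, xorE, gone, hx]

lemma xorE_assoc (s q u : GExp n) : xorE (xorE s q) u = xorE s (xorE q u) := by
  funext x; simp [xorE]

lemma xorE_comm (s q : GExp n) : xorE s q = xorE q s := by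
  funext x; simp [xorE, Bool.xor_comm]

lemma xorE_zero (s : GExp n) : xorE s (fun _ => false) = s := by
  funext x; simp [xorE]

lemma zero_xorE (s : GExp n) : xorE (fun _ => false) s = s := by
  funext x; simp [xorE]

@[simp] lemma gdeg_zero : gdeg (fun _ => false : GExp n) = 0 := by simp [gdeg]

@[simp] lemma mulSgn_zero_left (s : GExp n) : mulSgn (fun _ => false) s = 1 := by
  simp [mulSgn, invCount]

@[simp] lemma mulSgn_zero_right (s : GExp n) : mulSgn s (fun _ => false) = 1 := by
  simp [mulSgn, invCount]

@[simp] lemma derC_zero (a : Fin n) : derC a (fun _ => false) = 0 := by simp [derC]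

lemma mulSgn_assoc (s q u : GExp n) :
    mulSgn s q * mulSgn (xorE s q) u = mulSgn q u * mulSgn s (xorE q u) := by
  classical
  have : (Dj s q ∧ Dj (xorE s q) u) ↔ (Dj q u ∧ Dj s (xorE q u)) := by
    simp only [Dj, ← forall_and, xorE]
    refine forall_congr' fun a => ?_
    cases s a <;> cases q a <;> cases u a <;> simp
  simp only [mulSgn_eq, ite_mul, mul_ite, zero_mul, mul_zero, ← ite_and]
  rw [if_congr (and_comm.trans this) rfl rfl, if_congr (and_comm (a := Dj s (xorE q u))) rfl rfl,
    bich_xor_left, bich_xor_right]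
  congr 1
  ring

lemma mulSgn_comm (s q : GExp n) : mulSgn s q = (-1 : ℂ) ^ (gdeg s * gdeg q) * mulSgn q s := by
  classical
  have : Dj s q ↔ Dj q s := forall_congr' fun a => by rw [and_comm]
  rw [mulSgn_eq, mulSgn_eq, ← this]
  split_ifs with h
  · rw [← bich_swap h, mul_assoc, bich_mul_self, mul_one]
  · rw [mul_zero]

end Grassmann

end

end WSuper

namespace WSuper


noncomputable section

section SuperCalculus

variable {m n : ℕ} {b : Bool}

/-- Multiplication of `A`. -/
def mulA : AAlg m n →ₗ[ℂ] AAlg m n →ₗ[ℂ] AAlg m n :=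
  Finsupp.linearCombination ℂ fun x => Finsupp.linearCombination ℂ (amulB x)

/-- Parity of a direction. -/
def dpar : Dir m n b → ℕ
  | .di _ => 0
  | .pa _ => 1
  | .d0 => 0

/-- The derivation of `A` attached to a direction. -/
def derD (D : Dir m n b) : AAlg m n →ₗ[ℂ] AAlg m n :=
  Finsupp.linearCombination ℂ fun x => match D with
    | .di i => (x.1 i : ℂ) • asng x
    | .pa α => derC α x.2 • asng (x.1, derE α x.2)
    | .d0 => 0

/-- `f ↦ f D`. -/
def emb (D : Dir m n b) : AAlg m n →ₗ[ℂ] W m n b :=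
  Finsupp.linearCombination ℂ fun x => sng (x.1, x.2, D)

/-- The `A`-module structure of the Lie superalgebra. -/
def wmul : AAlg m n →ₗ[ℂ] W m n b →ₗ[ℂ] W m n b :=
  Finsupp.linearCombination ℂ fun x =>
    Finsupp.linearCombination ℂ fun X => emb X.2.2 (amulB x (X.1, X.2.1))

/-- The action of the Lie superalgebra on `A`. -/
def Der : W m n b →ₗ[ℂ] AAlg m n →ₗ[ℂ] AAlg m n :=
  Finsupp.linearCombination ℂ fun X => Finsupp.linearCombination ℂ (wOnA X)

/-- The Lie superbracket. -/
def brL : W m n b →ₗ[ℂ] W m n b →ₗ[ℂ] W m n b :=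
  Finsupp.linearCombination ℂ fun X => Finsupp.linearCombination ℂ (brB X)

/-- The `k`-th power of the parity involution of `A`. -/
def twA (k : ℕ) : AAlg m n →ₗ[ℂ] AAlg m n :=
  Finsupp.linearCombination ℂ fun x => ((-1 : ℂ) ^ (k * apar x)) • asng x

/-- The `k`-th power of the parity involution of the Lie superalgebra. -/
def twW (k : ℕ) : W m n b →ₗ[ℂ] W m n b :=
  Finsupp.linearCombination ℂ fun X => ((-1 : ℂ) ^ (k * par X)) • sng X

@[simp] lemma mulA_asng (x y : ABasis m n) : mulA (asng x) (asng y) = amulB x y := by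
  simp [mulA, asng]

@[simp] lemma derD_di (i : Fin m) (x : ABasis m n) :
    derD (.di i : Dir m n b) (asng x) = (x.1 i : ℂ) • asng x := by simp [derD, asng]

@[simp] lemma derD_pa (α : Fin n) (x : ABasis m n) :
    derD (.pa α : Dir m n b) (asng x) = derC α x.2 • asng (x.1, derE α x.2) := by
  simp [derD, asng]

@[simp] lemma derD_d0 (f : AAlg m n) : derD (.d0 : Dir m n true) f = 0 := by
  simp [derD, Finsupp.linearCombination_apply]

@[simp] lemma emb_asng (D : Dir m n b) (x : ABasis m n) :
    emb D (asng x) = sng (x.1, x.2, D) := by simp [emb, asng]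

lemma wmul_sng (f : AAlg m n) (X : WBasis m n b) :
    wmul f (sng X) = emb X.2.2 (mulA f (asng (X.1, X.2.1))) := by
  induction f using Finsupp.induction_linear with
  | zero => simp
  | add f g hf hg => simp [hf, hg]
  | single x c => simp [wmul, mulA, sng, asng]

lemma wmul_emb (f g : AAlg m n) (D : Dir m n b) : wmul f (emb D g) = emb D (mulA f g) := by
  induction g using Finsupp.induction_linear with
  | zero => simp
  | add g h hg hh => simp [hg, hh]
  | single x c =>
    rw [← mul_one c, ← smul_eq_mul, ← Finsupp.smul_single]
    change wmul f (emb D (c • asng x)) = emb D (mulA f (c • asng x))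
    simp [wmul_sng]

@[simp] lemma Der_sng (X : WBasis m n b) (x : ABasis m n) : Der (sng X) (asng x) = wOnA X x := by
  simp [Der, sng, asng]

@[simp] lemma brL_sng (X Y : WBasis m n b) : brL (sng X) (sng Y) = brB X Y := by
  simp [brL, sng]

@[simp] lemma twA_asng (k : ℕ) (x : ABasis m n) :
    twA k (asng x) = ((-1 : ℂ) ^ (k * apar x)) • asng x := by simp [twA, asng]

@[simp] lemma twW_sng (k : ℕ) (X : WBasis m n b) :
    twW k (sng X) = ((-1 : ℂ) ^ (k * par X)) • sng X := by simp [twW, sng]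

/-- Linear maps out of `A` agree if they agree on monomials. -/
lemma A_ext {M : Type*} [AddCommMonoid M] [Module ℂ M] {F G : AAlg m n →ₗ[ℂ] M}
    (h : ∀ x, F (asng x) = G (asng x)) : F = G :=
  Finsupp.lhom_ext' fun x => LinearMap.ext_ring (h x)

lemma A_ind {P : AAlg m n → Prop} (zero : P 0) (add : ∀ f g, P f → P g → P (f + g))
    (smul : ∀ (c : ℂ) f, P f → P (c • f)) (mon : ∀ x, P (asng x)) (f : AAlg m n) : P f := by
  induction f using Finsupp.induction_linear with
  | zero => exact zero
  | add f g hf hg => exact add f g hf hg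
  | single x c => simpa [asng] using smul c _ (mon x)

lemma W_ind {P : W m n b → Prop} (zero : P 0) (add : ∀ f g, P f → P g → P (f + g))
    (smul : ∀ (c : ℂ) f, P f → P (c • f)) (mon : ∀ x, P (sng x)) (f : W m n b) : P f := by
  induction f using Finsupp.induction_linear with
  | zero => exact zero
  | add f g hf hg => exact add f g hf hg
  | single x c => simpa [sng] using smul c _ (mon x)

lemma W_ind_emb {P : W m n b → Prop} (zero : P 0) (add : ∀ f g, P f → P g → P (f + g))
    (smul : ∀ (c : ℂ) f, P f → P (c • f)) (emb : ∀ D f, P (emb D f)) (f : W m n b) : P f :=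
  W_ind zero add smul (fun X => by simpa using emb X.2.2 (asng (X.1, X.2.1))) f

lemma mulA_assoc (f g h : AAlg m n) : mulA (mulA f g) h = mulA f (mulA g h) := by
  induction f using A_ind with
  | zero => simp
  | add f f' hf hf' => simp [hf, hf']
  | smul c f hf => simp [hf]
  | mon x =>
  induction g using A_ind with
  | zero => simp
  | add f f' hf hf' => simp [hf, hf']
  | smul c f hf => simp [hf]
  | mon y =>
  induction h using A_ind with
  | zero => simp
  | add f f' hf hf' => simp only [map_add, hf, hf']
  | smul c f hf => simp only [map_smul, hf]
  | mon z =>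
    simp only [mulA_asng, amulB, map_smul, LinearMap.smul_apply, smul_smul, xorE_assoc, add_assoc]
    rw [mulSgn_assoc, mul_comm (mulSgn y.2 z.2)]

lemma apar_pow (x y : ABasis m n) : (-1 : ℂ) ^ (apar x * apar y) = (-1) ^ (gdeg x.2 * gdeg y.2) := by
  rw [apar, apar, neg_one_pow_eq_pow_mod_two, neg_one_pow_eq_pow_mod_two (n := _ * gdeg _), Nat.mul_mod,
    Nat.mod_mod, Nat.mod_mod, ← Nat.mul_mod]

lemma apar_lt (x : ABasis m n) : apar x = 0 ∨ apar x = 1 := Nat.mod_two_eq_zero_or_one _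

lemma gsgn_apar (x : ABasis m n) : gsgn x.2 = (-1) ^ apar x := by
  rw [apar, gsgn, neg_one_pow_eq_pow_mod_two]

lemma mulA_comm (f : AAlg m n) (y : ABasis m n) :
    mulA f (asng y) = mulA (asng y) (twA (apar y) f) := by
  induction f using A_ind with
  | zero => simp
  | add f f' hf hf' => simp [hf, hf']
  | smul c f hf => simp [hf]
  | mon x =>
    simp only [mulA_asng, amulB, map_smul, twA_asng, smul_smul]
    rw [mulSgn_comm, apar_pow, add_comm, xorE_comm, mul_comm (gdeg x.2)]

lemma one_mulA (f : AAlg m n) : mulA (aone m n) f = f := by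
  induction f using A_ind with
  | zero => simp
  | add f f' hf hf' => simp [hf, hf']
  | smul c f hf => simp [hf]
  | mon x => simp [aone, amulB, zero_xorE]

lemma mulA_one (f : AAlg m n) : mulA f (aone m n) = f := by
  induction f using A_ind with
  | zero => simp
  | add f f' hf hf' => simp [hf, hf']
  | smul c f hf => simp [hf]
  | mon x => simp [aone, amulB, xorE_zero]

lemma apar_even (k : ℕ) (x y : ABasis m n) :
    (-1 : ℂ) ^ (k * apar (x.1 + y.1, xorE x.2 y.2)) = (-1) ^ (k * apar x) * (-1) ^ (k * apar y) := by
  rw [mul_comm k, mul_comm k, mul_comm k, pow_mul, pow_mul, pow_mul, ← gsgn_apar, ← gsgn_apar,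
    ← gsgn_apar, ← mul_pow, gsgn_xor]

lemma twA_mulA (k : ℕ) (f g : AAlg m n) : twA k (mulA f g) = mulA (twA k f) (twA k g) := by
  induction f using A_ind with
  | zero => simp
  | add f f' hf hf' => simp [hf, hf']
  | smul c f hf => simp [hf]
  | mon x =>
  induction g using A_ind with
  | zero => simp
  | add f f' hf hf' => simp [hf, hf']
  | smul c f hf => simp [hf]
  | mon y =>
    simp only [mulA_asng, amulB, map_smul, twA_asng, LinearMap.smul_apply, smul_smul, apar_even]
    ring_nf

lemma gsgn_derE {α : Fin n} {s : GExp n} (h : s α = true) : gsgn (derE α s) = -gsgn s := by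
  rw [derE_eq h, gsgn_xor, gsgn, gsgn, gdeg_gone]; simp

lemma twA_derD (k : ℕ) (D : Dir m n b) (f : AAlg m n) :
    twA k (derD D f) = ((-1 : ℂ) ^ (k * dpar D)) • derD D (twA k f) := by
  induction f using A_ind with
  | zero => simp
  | add f f' hf hf' => simp [hf, hf']
  | smul c f hf => simp only [map_smul, hf, smul_comm c]
  | mon x =>
    cases D with
    | di i => simp [dpar, smul_smul, mul_comm]
    | d0 => simp
    | pa α =>
      simp only [derD_pa, map_smul, twA_asng, smul_smul, dpar, mul_one]
      by_cases h : x.2 α = true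
      · have : (-1 : ℂ) ^ (k * apar (x.1, derE α x.2)) = (-1) ^ k * (-1) ^ (k * apar x) := by
          rw [mul_comm k, mul_comm k, pow_mul, pow_mul, ← gsgn_apar, ← gsgn_apar, gsgn_derE h,
            neg_pow]
        rw [this]; ring_nf
      · simp [derC, h]

lemma derE_apply_self (α : Fin n) (s : GExp n) : derE α s α = false := by simp [derE]

lemma derE_apply_of_ne {α β : Fin n} (h : β ≠ α) (s : GExp n) : derE α s β = s β := by
  simp [derE, h]

lemma mulSgn_eq_zero {s q : GExp n} {α : Fin n} (h : s α = true) (h' : q α = true) :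
    mulSgn s q = 0 := if_pos ⟨α, h, h'⟩

lemma Dj_derE_left {α : Fin n} {s q : GExp n} (h : q α = false) : Dj (derE α s) q ↔ Dj s q := by
  refine forall_congr' fun x => ?_
  by_cases hx : x = α
  · subst hx; simp [h]
  · rw [derE_apply_of_ne hx]

lemma Dj_comm {s q : GExp n} : Dj s q ↔ Dj q s := forall_congr' fun a => by rw [and_comm]

lemma Dj_derE_derE {α : Fin n} {s q : GExp n} : Dj (derE α s) q ↔ Dj s (derE α q) := by
  refine forall_congr' fun x => ?_
  by_cases hx : x = α
  · subst hx; simp [derE]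
  · rw [derE_apply_of_ne hx, derE_apply_of_ne hx]

lemma derC_leibniz (r : LExp m) (α : Fin n) (s q : GExp n) :
    (mulSgn s q * derC α (xorE s q)) • (asng (r, derE α (xorE s q)) : AAlg m n)
    = (derC α s * mulSgn (derE α s) q) • asng (r, xorE (derE α s) q)
      + (gsgn s * (derC α q * mulSgn s (derE α q))) • asng (r, xorE s (derE α q)) := by
  classical
  by_cases hs : s α = true <;> by_cases hq : q α = true
  · rw [mulSgn_eq_zero hs hq, zero_mul, zero_smul, mulSgn_eq, mulSgn_eq s, ← Dj_derE_derE]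
    split_ifs with h
    · rw [derE_eq hs, derE_eq hq, xorE_assoc, xorE_comm (gone α), ← add_smul, derC_eq, derC_eq,
        if_pos hs, if_pos hq, bich_xor_left, bich_xor_right, bich_gone_right, if_pos hs]
      have := gsgn_mul_self s
      rw [show ∀ z w : ℂ, z = -w → z + w = 0 from fun z w h => by rw [h]; ring, zero_smul]
      linear_combination (-(bich (gone α) s * bich s q * bich (gone α) q)) * this
    · simp
  · have hq' : q α = false := by simpa using hq
    have hx : xorE s q α = true := by simp [xorE, hs, hq']
    have h0 : derC α q = 0 := by simp [derC, hq']
    rw [h0, zero_mul, mul_zero, zero_smul, add_zero, mulSgn_eq, mulSgn_eq, Dj_derE_left hq',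
      derE_eq hx, derE_eq hs, xorE_assoc, xorE_comm q, ← xorE_assoc]
    split_ifs with h
    · rw [derC_eq, derC_eq, if_pos hx, if_pos hs, bich_xor_left, bich_xor_right]
      ring_nf
    · simp
  · have hs' : s α = false := by simpa using hs
    have hx : xorE s q α = true := by simp [xorE, hs', hq]
    have h0 : derC α s = 0 := by simp [derC, hs']
    rw [h0, zero_mul, zero_smul, zero_add, mulSgn_eq, mulSgn_eq, Dj_comm (q := derE α q),
      Dj_derE_left hs', Dj_comm (q := s), derE_eq hx, derE_eq hq, ← xorE_assoc]
    split_ifs with h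
    · rw [derC_eq, derC_eq, if_pos hx, if_pos hq, bich_xor_right, bich_xor_right, bich_gone_right,
        if_neg hs]
      have := gsgn_mul_self s
      congr 1
      linear_combination (-(bich (gone α) s * bich s q * bich (gone α) q)) * this
    · simp
  · have hx : xorE s q α = false := by simp_all [xorE]
    simp [derC, hx, hs, hq]

lemma derD_mulA (D : Dir m n b) (f g : AAlg m n) :
    derD D (mulA f g) = mulA (derD D f) g + mulA (twA (dpar D) f) (derD D g) := by
  induction f using A_ind with
  | zero => simp
  | add f f' hf hf' => simp only [map_add, hf, hf', LinearMap.add_apply]; abel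
  | smul c f hf => simp only [map_smul, hf, LinearMap.smul_apply, smul_add]
  | mon x =>
  induction g using A_ind with
  | zero => simp
  | add f f' hf hf' => simp only [map_add, hf, hf']; abel
  | smul c f hf => simp only [map_smul, hf, smul_add]
  | mon y =>
    cases D with
    | di i =>
      simp only [mulA_asng, amulB, map_smul, derD_di, twA_asng, LinearMap.smul_apply, smul_smul,
        dpar, zero_mul, pow_zero, one_mul, ← add_smul]
      congr 1
      push_cast [Pi.add_apply]
      ring
    | d0 => simp
    | pa α =>
      simp only [mulA_asng, amulB, map_smul, derD_pa, twA_asng, LinearMap.smul_apply, smul_smul,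
        dpar, one_mul, ← gsgn_apar]
      rw [derC_leibniz]
      congr 2
      ring

lemma derC_anticomm {α β : Fin n} (h : α ≠ β) (s : GExp n) :
    derC β s * derC α (derE β s) = -(derC α s * derC β (derE α s)) := by
  by_cases hs : s α = true <;> by_cases hq : s β = true
  · have h1 : derE β s α = true := by rw [derE_apply_of_ne h, hs]
    have h2 : derE α s β = true := by rw [derE_apply_of_ne h.symm, hq]
    rw [derC_eq, derC_eq, derC_eq, derC_eq, if_pos hs, if_pos hq, if_pos h1, if_pos h2, derE_eq hs,
      derE_eq hq, bich_xor_right, bich_xor_right, bich_gone_gone h]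
    ring
  all_goals simp [derC, hs, hq, derE_apply_of_ne h, derE_apply_of_ne h.symm]

lemma derD_comm (D D' : Dir m n b) (f : AAlg m n) :
    derD D (derD D' f) = ((-1 : ℂ) ^ (dpar D * dpar D')) • derD D' (derD D f) := by
  induction f using A_ind with
  | zero => simp
  | add f f' hf hf' => simp [hf, hf']
  | smul c f hf => simp only [map_smul, hf, smul_comm c]
  | mon x =>
    cases D with
    | d0 => simp
    | di i =>
      cases D' with
      | d0 => simp
      | di j => simp [dpar, smul_smul, mul_comm]
      | pa β => simp [dpar, smul_smul, mul_comm]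
    | pa α =>
      cases D' with
      | d0 => simp
      | di j => simp [dpar, smul_smul, mul_comm]
      | pa β =>
        simp only [derD_pa, map_smul, smul_smul, dpar, mul_one, pow_one]
        by_cases h : α = β
        · subst h; simp [derC, derE_apply_self]
        · rw [derC_anticomm h, derE, derE, derE, derE, Function.update_comm h]
          congr 1; ring

lemma Der_emb (D : Dir m n b) (f g : AAlg m n) : Der (emb D f) g = mulA f (derD D g) := by
  induction f using A_ind with
  | zero => simp
  | add f f' hf hf' => simp [hf, hf']
  | smul c f hf => simp [hf]
  | mon x =>
  induction g using A_ind with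
  | zero => simp
  | add f f' hf hf' => simp only [map_add, hf, hf']
  | smul c f hf => simp only [map_smul, hf]
  | mon y =>
    cases D <;> simp [wOnA, amulB, smul_smul]

lemma par_emb (D : Dir m n b) (x : ABasis m n) :
    (-1 : ℂ) ^ par ((x.1, x.2, D) : WBasis m n b) = (-1) ^ apar x * (-1) ^ dpar D := by
  cases D <;>
  simp only [par, apar, dpar, ← neg_one_pow_eq_pow_mod_two, pow_add, pow_zero, mul_one]

lemma par_emb_mul (k : ℕ) (D : Dir m n b) (x : ABasis m n) :
    (-1 : ℂ) ^ (k * par ((x.1, x.2, D) : WBasis m n b)) = (-1) ^ (k * (apar x + dpar D)) := by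
  rw [mul_comm k, mul_comm k, pow_mul, pow_mul, par_emb, pow_add]

lemma twW_emb (k : ℕ) (D : Dir m n b) (f : AAlg m n) :
    twW k (emb D f) = ((-1 : ℂ) ^ (k * dpar D)) • emb D (twA k f) := by
  induction f using A_ind with
  | zero => simp
  | add f f' hf hf' => simp [hf, hf']
  | smul c f hf => simp only [map_smul, hf, smul_comm c]
  | mon x =>
    simp only [emb_asng, twW_sng, twA_asng, map_smul, par_emb_mul, smul_smul]
    rw [mul_add, pow_add, mul_comm]

/-- The superbracket in terms of the multiplication and the derivations of `A`. -/
lemma brL_emb (D D' : Dir m n b) (x y : ABasis m n) :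
    brL (emb D (asng x)) (emb D' (asng y)) = emb D' (mulA (asng x) (derD D (asng y)))
      - ((-1 : ℂ) ^ ((apar x + dpar D) * (apar y + dpar D'))) •
          emb D (mulA (asng y) (derD D' (asng x))) := by
  have h1 (k l k' l') : (-1 : ℂ) ^ ((k % 2 + k') * (l % 2 + l')) = (-1) ^ ((k + k') * (l + l')) := by
    rw [neg_one_pow_eq_pow_mod_two, neg_one_pow_eq_pow_mod_two (n := (k + k') * (l + l'))]
    congr 1
    exact ((Nat.mod_modEq k 2).add_right k').mul ((Nat.mod_modEq l 2).add_right l')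
  rw [emb_asng, emb_asng, brL_sng, apar, apar, h1]
  have h2 := mulSgn_comm x.2 y.2
  cases D <;> cases D' <;>
  simp [brB, dpar, amulB, smul_smul, mul_add, add_mul, xorE_comm y.2 x.2, add_comm y.1 x.1, h2] <;>
  congr 1 <;> ring

end SuperCalculus

end

end WSuper

namespace WSuper


noncomputable section

section SuperCalculus

variable {m n : ℕ} {b : Bool}

lemma twA_even {k : ℕ} (hk : Even k) (f : AAlg m n) : twA k f = f := by
  induction f using A_ind with
  | zero => simp
  | add f f' hf hf' => simp only [map_add, hf, hf']
  | smul c f hf => simp only [map_smul, hf]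
  | mon x => simp [(hk.mul_right _).neg_one_pow]

lemma twW_even {k : ℕ} (hk : Even k) (f : W m n b) : twW k f = f := by
  induction f using W_ind with
  | zero => simp
  | add f f' hf hf' => simp only [map_add, hf, hf']
  | smul c f hf => simp only [map_smul, hf]
  | mon x => simp [(hk.mul_right _).neg_one_pow]

lemma twA_zero (f : AAlg m n) : twA 0 f = f := twA_even Even.zero f

lemma twW_zero (f : W m n b) : twW 0 f = f := twW_even Even.zero f

lemma twW_wmul (k : ℕ) (f : AAlg m n) (X : W m n b) :
    twW k (wmul f X) = wmul (twA k f) (twW k X) := by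
  induction X using W_ind_emb with
  | zero => simp
  | add f f' hf hf' => simp only [map_add, hf, hf']
  | smul c f hf => simp only [map_smul, hf]
  | emb D g => simp only [wmul_emb, twW_emb, twA_mulA, map_smul]

lemma wmul_mulA (f g : AAlg m n) (X : W m n b) : wmul (mulA f g) X = wmul f (wmul g X) := by
  induction X using W_ind_emb with
  | zero => simp
  | add f f' hf hf' => simp only [map_add, hf, hf']
  | smul c f hf => simp only [map_smul, hf]
  | emb D g => simp only [wmul_emb, mulA_assoc]

lemma Der_wmul (f g : AAlg m n) (X : W m n b) : Der (wmul f X) g = mulA f (Der X g) := by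
  induction X using W_ind_emb with
  | zero => simp
  | add f f' hf hf' => simp only [map_add, hf, hf', LinearMap.add_apply]
  | smul c f hf => simp only [map_smul, hf, LinearMap.smul_apply]
  | emb D g => simp only [wmul_emb, Der_emb, mulA_assoc]

lemma mulA_asng_comm (x y : ABasis m n) :
    mulA (asng x) (asng y) = ((-1 : ℂ) ^ (apar y * apar x)) • mulA (asng y) (asng x) := by
  rw [mulA_comm, twA_asng, map_smul]

lemma sng_eq_emb (X : WBasis m n b) : sng X = emb X.2.2 (asng (X.1, X.2.1)) :=
  (emb_asng X.2.2 (X.1, X.2.1)).symm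

lemma par_pow (X : WBasis m n b) (k : ℕ) :
    (-1 : ℂ) ^ (par X * k) = (-1) ^ ((apar (X.1, X.2.1) + dpar X.2.2) * k) := by
  rw [mul_comm, mul_comm _ k]
  exact par_emb_mul k X.2.2 (X.1, X.2.1)

lemma Der_mulA (X : WBasis m n b) (f g : AAlg m n) :
    Der (sng X) (mulA f g) = mulA (Der (sng X) f) g + mulA (twA (par X) f) (Der (sng X) g) := by
  induction f using A_ind with
  | zero => simp
  | add f f' hf hf' => simp only [map_add, hf, hf', LinearMap.add_apply]; abel
  | smul c f hf => simp only [map_smul, hf, LinearMap.smul_apply, smul_add]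
  | mon y =>
    simp only [sng_eq_emb X, Der_emb, derD_mulA, map_add, twA_asng, map_smul, LinearMap.smul_apply,
      par_pow]
    rw [← mulA_assoc, ← mulA_assoc, mulA_asng_comm, ← mulA_assoc]
    simp only [map_smul, LinearMap.smul_apply, smul_smul]
    congr 2
    ring

/-- The bracket with `f D` on the left, on all `g D'`. -/
lemma brL_emb_left (D D' : Dir m n b) (x : ABasis m n) (g : AAlg m n) :
    brL (emb D (asng x)) (emb D' g) = emb D' (mulA (asng x) (derD D g))
      - ((-1 : ℂ) ^ ((apar x + dpar D) * dpar D')) •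
          emb D (mulA (twA (apar x + dpar D) g) (derD D' (asng x))) := by
  induction g using A_ind with
  | zero => simp
  | add f f' hf hf' => simp only [map_add, hf, hf', LinearMap.add_apply, smul_add]; abel
  | smul c f hf => simp only [map_smul, hf, LinearMap.smul_apply, smul_sub, smul_comm c]
  | mon y =>
    rw [brL_emb]
    simp only [twA_asng, map_smul, LinearMap.smul_apply, smul_smul]
    congr 2
    ring

lemma brL_wmul (X : WBasis m n b) (f : AAlg m n) (Z : W m n b) :
    brL (sng X) (wmul f Z) = wmul (Der (sng X) f) Z + wmul (twA (par X) f) (brL (sng X) Z) := by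
  induction f using A_ind with
  | zero => simp
  | add f f' hf hf' => simp only [map_add, hf, hf', LinearMap.add_apply]; abel
  | smul c f hf => simp only [map_smul, hf, LinearMap.smul_apply, smul_add]
  | mon y =>
  induction Z using W_ind_emb with
  | zero => simp
  | add f f' hf hf' => simp only [map_add, hf, hf']; abel
  | smul c f hf => simp only [map_smul, hf, smul_add]
  | emb D g =>
    simp only [sng_eq_emb X, wmul_emb, brL_emb_left, twA_asng, map_smul, LinearMap.smul_apply,
      map_sub, Der_emb, derD_mulA, map_add, twA_mulA, mulA_assoc, par_pow]
    rw [add_sub_assoc]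
    congr 1
    rw [← mulA_assoc (asng (X.1, X.2.1)), mulA_asng_comm]
    simp only [map_smul, LinearMap.smul_apply, mulA_assoc, smul_smul]
    congr 2; ring

lemma Der_brL (X Y : WBasis m n b) (h : AAlg m n) :
    Der (brB X Y) h = Der (sng X) (Der (sng Y) h)
      - ((-1 : ℂ) ^ (par X * par Y)) • Der (sng Y) (Der (sng X) h) := by
  rw [← brL_sng]
  simp only [sng_eq_emb X, sng_eq_emb Y, brL_emb, map_sub, map_smul, LinearMap.sub_apply,
    LinearMap.smul_apply, Der_emb, derD_mulA, map_add, twA_asng, mulA_assoc, smul_add, par_pow]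
  rw [mul_comm _ (par Y), par_pow, derD_comm X.2.2]
  generalize derD Y.2.2 (derD X.2.2 h) = w
  rw [map_smul, map_smul, ← mulA_assoc (asng _) (asng _) w, mulA_asng_comm,
    mul_comm (apar (Y.1, Y.2.1) + _)]
  simp only [map_smul, LinearMap.smul_apply, mulA_assoc, smul_smul]
  have : (-1 : ℂ) ^ ((apar (X.1, X.2.1) + dpar X.2.2) * (apar (Y.1, Y.2.1) + dpar Y.2.2)) *
      (-1) ^ (dpar Y.2.2 * apar (X.1, X.2.1)) = (-1) ^ (dpar X.2.2 * apar (Y.1, Y.2.1)) *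
      ((-1) ^ (dpar X.2.2 * dpar Y.2.2) * (-1) ^ (apar (Y.1, Y.2.1) * apar (X.1, X.2.1))) := by
    rw [← pow_add, ← pow_add, ← pow_add]
    refine neg_one_pow_congr ?_
    simp only [parity_simps]
    tauto
  rw [this]
  module

end SuperCalculus

end

end WSuper

namespace WSuper


noncomputable section

section Generators

variable {m n : ℕ} {b : Bool}

/-- The generators `t_i`, `ξ_α` of `A`. -/
def gen : GlIdx m n → ABasis m n
  | .inl i => (Pi.single i 1, fun _ => false)
  | .inr α => (0, gone α)

/-- The derivations `∂/∂t_i`, `∂/∂ξ_α`. -/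
def dW : GlIdx m n → WBasis m n b
  | .inl i => (-Pi.single i 1, fun _ => false, .di i)
  | .inr α => (0, fun _ => false, .pa α)

/-- The Euler derivations `t_i ∂/∂t_i`, `ξ_α ∂/∂ξ_α`. -/
def ddW : GlIdx m n → WBasis m n b
  | .inl i => (0, fun _ => false, .di i)
  | .inr α => (0, gone α, .pa α)

/-- The direction of an index. -/
def dirG : GlIdx m n → Dir m n b
  | .inl i => .di i
  | .inr α => .pa α

lemma apar_gen (a : GlIdx m n) : apar (gen a) = gpar a := by
  cases a <;> simp [apar, gen, gpar, gdeg_gone]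

lemma par_dW (a : GlIdx m n) : par (dW a : WBasis m n b) = gpar a := by
  cases a <;> simp [par, dW, gpar]

lemma par_ddW (a : GlIdx m n) : par (ddW a : WBasis m n b) = 0 := by
  cases a <;> simp [par, ddW, gdeg_gone]

lemma mulSgn_gone_self_aux (α : Fin n) : derC α (gone α) = 1 := by
  rw [derC, if_pos (by simp [gone])]
  rw [Finset.filter_false_of_mem]
  · simp
  · rintro x - ⟨h, h'⟩
    simp only [gone, decide_eq_true_eq] at h
    exact h'.ne h

lemma derE_gone (α : Fin n) : derE α (gone α) = fun _ => false := by
  funext x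
  by_cases h : x = α
  · subst h; simp [derE]
  · simp [derE, gone, h]

lemma Der_dW_gen (a c : GlIdx m n) :
    Der (sng (dW a : WBasis m n b)) (asng (gen c)) = if a = c then aone m n else 0 := by
  rw [Der_sng]
  rcases a with i | α <;> rcases c with j | β
  · by_cases h : i = j
    · subst h; simp [dW, gen, wOnA, aone, xorE_zero]
    · simp [dW, gen, wOnA, h]
  · simp [dW, gen, wOnA]
  · simp [dW, gen, wOnA]
  · by_cases h : α = β
    · subst h; simp [dW, gen, wOnA, aone, mulSgn_gone_self_aux, derE_gone, xorE_zero]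
    · simp [dW, gen, wOnA, h, derC, gone]

lemma wmul_gen_dW (a : GlIdx m n) :
    wmul (asng (gen a)) (sng (dW a : WBasis m n b)) = sng (ddW a) := by
  rw [wmul_sng]
  cases a <;> simp [gen, dW, ddW, amulB, xorE_zero]

lemma Der_ddW_gen (a c : GlIdx m n) :
    Der (sng (ddW a : WBasis m n b)) (asng (gen c)) = if a = c then asng (gen a) else 0 := by
  rw [← wmul_gen_dW, Der_wmul, Der_dW_gen]
  split_ifs <;> simp [mulA_one]

/-- Whether a direction is a derivation of `A`. -/
def isder : Dir m n b → ℂ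
  | .di _ => 1
  | .pa _ => 1
  | .d0 => 0

lemma brL_ddW (a : GlIdx m n) (X : WBasis m n b) [Decidable (X.2.2 = dirG a)] :
    brL (sng (ddW a)) (sng X) = wmul (asng (gen a)) (brL (sng (dW a)) (sng X))
      - (if X.2.2 = dirG a then sng X else 0) := by
  obtain ⟨p, q, D⟩ := X
  have h1 := emb_asng D (p, q)
  simp only at h1 ⊢
  rw [sng_eq_emb (ddW a), sng_eq_emb (dW a), ← h1, brL_emb, brL_emb]
  simp only [map_sub, map_smul, wmul_emb, ← mulA_assoc]
  rcases a with i | α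
  · cases D with
    | di j =>
      by_cases h : j = i
      · subst h
        simp [ddW, dW, dirG, dpar, gen, amulB, zero_xorE, xorE_zero, apar, smul_smul]
      · simp [ddW, dW, dirG, dpar, gen, amulB, zero_xorE, xorE_zero, apar, h, smul_smul]
    | pa β => simp [ddW, dW, dirG, dpar, gen, amulB, zero_xorE, xorE_zero, apar, smul_smul]
    | d0 => simp [ddW, dW, dirG, dpar, gen, amulB, zero_xorE, xorE_zero, apar, smul_smul]
  · cases D with
    | di j => simp [ddW, dW, dirG, dpar, gen, amulB, zero_xorE, xorE_zero, apar, smul_smul]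
    | pa β =>
      by_cases h : β = α
      · subst h
        simp [ddW, dW, dirG, dpar, gen, amulB, zero_xorE, xorE_zero, apar, smul_smul,
          mulSgn_gone_self_aux, derE_gone, gdeg_gone]
      · have : derC β (gone α) = 0 := by simp [derC, gone, h]
        simp [ddW, dW, dirG, dpar, gen, amulB, zero_xorE, xorE_zero, apar, h, smul_smul, this]
    | d0 => simp [ddW, dW, dirG, dpar, gen, amulB, zero_xorE, xorE_zero, apar, smul_smul]

lemma sum_brL_ddW (X : WBasis m n b) :
    ∑ a, brL (sng (ddW a)) (sng X)
      = ∑ a, wmul (asng (gen a)) (brL (sng (dW a)) (sng X)) - isder X.2.2 • sng X := by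
  classical
  simp only [brL_ddW, Finset.sum_sub_distrib]
  congr 1
  obtain ⟨p, q, D⟩ := X
  cases D with
  | di i =>
    rw [Finset.sum_eq_single (.inl i)]
    · simp [isder, dirG]
    · rintro (j | β) - hj
      · simp only [dirG, Dir.di.injEq]; rw [if_neg]; rintro rfl; exact hj rfl
      · simp [dirG]
    · simp
  | pa i =>
    rw [Finset.sum_eq_single (.inr i)]
    · simp [isder, dirG]
    · rintro (j | β) - hj
      · simp [dirG]
      · simp only [dirG, Dir.pa.injEq]; rw [if_neg]; rintro rfl; exact hj rfl
    · simp
  | d0 =>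
    rw [Finset.sum_eq_zero]
    · simp [isder]
    · rintro (j | β) -  <;> simp [dirG]

end Generators

end

end WSuper

namespace WSuper


noncomputable section

section Theta

variable {m n : ℕ} {b : Bool} (ρ : AVRep m n b)

namespace AVRep

/-- The action of the Lie superalgebra, valued in the ring of endomorphisms. -/
def X : W m n b →ₗ[ℂ] Module.End ℂ ρ.M := ρ.act

/-- The action of `A`, valued in the ring of endomorphisms. -/
def μ : AAlg m n →ₗ[ℂ] Module.End ℂ ρ.M := ρ.aact

lemma μ_one : ρ.μ (aone m n) = 1 := ρ.aact_one

lemma μ_mul (f g : AAlg m n) : ρ.μ (mulA f g) = ρ.μ f * ρ.μ g := by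
  induction f using A_ind with
  | zero => simp
  | add f f' hf hf' => simp only [map_add, hf, hf', LinearMap.add_apply, add_mul]
  | smul c f hf => simp only [map_smul, hf, LinearMap.smul_apply, smul_mul_assoc]
  | mon x =>
  induction g using A_ind with
  | zero => simp
  | add f f' hf hf' => simp only [map_add, hf, hf', mul_add]
  | smul c f hf => simp only [map_smul, hf, mul_smul_comm]
  | mon y => rw [mulA_asng]; exact ρ.aact_mul x y

lemma X_μ (Y : WBasis m n b) (f : AAlg m n) :
    ρ.X (sng Y) * ρ.μ f = ρ.μ (Der (sng Y) f) + ρ.μ (twA (par Y) f) * ρ.X (sng Y) := by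
  induction f using A_ind with
  | zero => simp
  | add f f' hf hf' => simp only [map_add, hf, hf', mul_add, add_mul]; abel
  | smul c f hf => simp only [map_smul, hf, mul_smul_comm, smul_add, smul_mul_assoc]
  | mon x =>
    rw [Der_sng, twA_asng, map_smul, smul_mul_assoc]
    exact ρ.leibniz Y x

lemma X_μ' (Y : W m n b) (x : ABasis m n) :
    ρ.X Y * ρ.μ (asng x) = ρ.μ (Der Y (asng x)) + ρ.μ (asng x) * ρ.X (twW (apar x) Y) := by
  induction Y using W_ind with
  | zero => simp
  | add f f' hf hf' => simp only [map_add, hf, hf', mul_add, add_mul, LinearMap.add_apply]; abel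
  | smul c f hf =>
    simp only [map_smul, hf, mul_smul_comm, smul_add, smul_mul_assoc, LinearMap.smul_apply]
  | mon Y =>
    rw [X_μ, twA_asng, twW_sng, map_smul, map_smul, smul_mul_assoc, mul_smul_comm, mul_comm (par Y)]

lemma X_brL (Y : WBasis m n b) (Z : W m n b) :
    ρ.X (brL (sng Y) Z) = ρ.X (sng Y) * ρ.X Z - ρ.X (twW (par Y) Z) * ρ.X (sng Y) := by
  induction Z using W_ind with
  | zero => simp
  | add f f' hf hf' => simp only [map_add, hf, hf', mul_add, add_mul]; abel
  | smul c f hf => simp only [map_smul, hf, mul_smul_comm, smul_sub, smul_mul_assoc]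
  | mon Z =>
    rw [brL_sng, twW_sng, map_smul, smul_mul_assoc]
    exact ρ.super Y Z

/-- Total parity of a list of indices. -/
def lpar (l : List (GlIdx m n)) : ℕ := (l.map gpar).sum

@[simp] lemma lpar_nil : lpar ([] : List (GlIdx m n)) = 0 := rfl

@[simp] lemma lpar_cons (a : GlIdx m n) (l : List (GlIdx m n)) :
    lpar (a :: l) = gpar a + lpar l := by simp [lpar]

/-- The iterated differences of the action of the Lie superalgebra against multiplications. -/
def Th : List (GlIdx m n) → W m n b →ₗ[ℂ] Module.End ℂ ρ.M
  | [] => ρ.X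
  | a :: l => ((-1 : ℂ) ^ (gpar a * lpar l)) • (Th l ∘ₗ wmul (asng (gen a)))
      - LinearMap.mulLeft ℂ (ρ.μ (asng (gen a))) ∘ₗ Th l

@[simp] lemma Th_nil : ρ.Th [] = ρ.X := rfl

lemma Th_cons (a : GlIdx m n) (l : List (GlIdx m n)) (Y : W m n b) :
    ρ.Th (a :: l) Y = ((-1 : ℂ) ^ (gpar a * lpar l)) • ρ.Th l (wmul (asng (gen a)) Y)
      - ρ.μ (asng (gen a)) * ρ.Th l Y := rfl

lemma gpar_eq (a : GlIdx m n) : gpar a = 0 ∨ gpar a = 1 := by cases a <;> simp [gpar]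

lemma μ_comm (x y : ABasis m n) :
    ρ.μ (asng x) * ρ.μ (asng y) = ((-1 : ℂ) ^ (apar y * apar x)) • (ρ.μ (asng y) * ρ.μ (asng x)) := by
  rw [← μ_mul, mulA_asng_comm, map_smul, μ_mul]

lemma wmul_comm (x y : ABasis m n) (Y : W m n b) : wmul (asng x) (wmul (asng y) Y)
    = ((-1 : ℂ) ^ (apar y * apar x)) • wmul (asng y) (wmul (asng x) Y) := by
  rw [← wmul_mulA, mulA_asng_comm, map_smul, LinearMap.smul_apply, wmul_mulA]

lemma Th_swap (a c : GlIdx m n) (l : List (GlIdx m n)) :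
    ρ.Th (a :: c :: l) = ((-1 : ℂ) ^ (gpar a * gpar c)) • ρ.Th (c :: a :: l) := by
  refine LinearMap.ext fun Y => ?_
  rw [LinearMap.smul_apply]
  simp only [Th_cons, mul_sub, mul_smul_comm, smul_sub, lpar_cons, ← mul_assoc, map_smul, smul_smul]
  rw [μ_comm ρ (gen a), wmul_comm (gen a), apar_gen, apar_gen]
  rcases gpar_eq a with ha | ha <;> rcases gpar_eq c with hc | hc <;>
  rcases Nat.even_or_odd (lpar l) with hl | hl <;>
  simp [ha, hc, hl.neg_one_pow, pow_add] <;> abel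

lemma Th_μ (l : List (GlIdx m n)) (Y : W m n b) (x : ABasis m n) :
    ρ.Th l Y * ρ.μ (asng x) = (if l = [] then ρ.μ (Der Y (asng x)) else 0)
      + ((-1 : ℂ) ^ (apar x * lpar l)) • (ρ.μ (asng x) * ρ.Th l (twW (apar x) Y)) := by
  induction l generalizing Y with
  | nil => simp [X_μ']
  | cons a l ih =>
    rw [if_neg (List.cons_ne_nil a l), Th_cons, sub_mul, smul_mul_assoc, ih, mul_assoc, ih,
      Th_cons, twW_wmul, twA_asng, Der_wmul, apar_gen, mul_add, μ_mul]
    simp only [mul_sub, mul_smul_comm, ← mul_assoc]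
    rw [μ_comm ρ (gen a) x, apar_gen]
    by_cases hl0 : l = []
    · subst hl0
      rcases gpar_eq a with ha | ha <;> rcases apar_lt x with hc | hc <;>
      (simp [ha, hc, pow_add]; try abel)
    · rw [if_neg hl0, if_neg hl0]
      rcases gpar_eq a with ha | ha <;> rcases apar_lt x with hc | hc <;>
      rcases Nat.even_or_odd (lpar l) with hl | hl <;>
      simp [ha, hc, hl.neg_one_pow, pow_add] <;> abel

lemma dW_Th (y : GlIdx m n) (l : List (GlIdx m n)) (Y : W m n b) :
    ρ.X (sng (dW y)) * ρ.Th l Y = ((-1 : ℂ) ^ (gpar y * lpar l)) •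
      (ρ.Th l (twW (gpar y) Y) * ρ.X (sng (dW y)) + ρ.Th l (brL (sng (dW y)) Y)) := by
  induction l generalizing Y with
  | nil => simp [X_brL, par_dW]
  | cons a l ih =>
    rw [Th_cons, mul_sub, mul_smul_comm, ih, ← mul_assoc, X_μ, add_mul, mul_assoc, ih, Th_cons,
      Th_cons, brL_wmul, Der_dW_gen, par_dW, twA_asng, apar_gen, twW_wmul, twA_asng, apar_gen]
    by_cases hy : y = a
    · subst hy
      have : wmul (aone m n) Y = Y := by
        induction Y using W_ind_emb with
        | zero => simp
        | add f f' hf hf' => simp only [map_add, hf, hf']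
        | smul c f hf => simp only [map_smul, hf]
        | emb D f => rw [wmul_emb, one_mulA]
      rcases gpar_eq y with ha | ha <;>
      rcases Nat.even_or_odd (lpar l) with hl | hl <;>
      simp [ha, hl.neg_one_pow, pow_add, μ_one, this, sub_mul, mul_add, mul_assoc] <;> abel
    · rcases gpar_eq a with ha | ha <;> rcases gpar_eq y with hc | hc <;>
      rcases Nat.even_or_odd (lpar l) with hl | hl <;>
      simp [ha, hc, hy, hl.neg_one_pow, pow_add, sub_mul, mul_add, mul_assoc] <;> abel

lemma ddW_Th (y : GlIdx m n) (l : List (GlIdx m n)) (Y : W m n b) :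
    ρ.X (sng (ddW y)) * ρ.Th l Y = ρ.Th l Y * ρ.X (sng (ddW y)) + ρ.Th l (brL (sng (ddW y)) Y)
      + (Multiset.count y (l : Multiset (GlIdx m n)) : ℂ) • ρ.Th l Y := by
  induction l generalizing Y with
  | nil => simp [X_brL, par_ddW, twW_zero]
  | cons a l ih =>
    rw [Th_cons, mul_sub, mul_smul_comm, ih, ← mul_assoc, X_μ, add_mul, mul_assoc, ih,
      Th_cons, brL_wmul, Der_ddW_gen, par_ddW, twA_zero]
    by_cases hy : y = a
    · subst hy
      rw [if_pos rfl, ← Multiset.cons_coe, Multiset.count_cons_self]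
      push_cast
      simp only [sub_mul, mul_add, mul_assoc, smul_mul_assoc, map_add, smul_add, mul_smul_comm,
        smul_sub, add_smul, one_smul]
      simp only [smul_comm (Multiset.count y (l : Multiset (GlIdx m n)) : ℂ)]
      abel
    · rw [if_neg hy, ← Multiset.cons_coe, Multiset.count_cons_of_ne hy]
      simp only [sub_mul, mul_add, mul_assoc, smul_mul_assoc, map_add, smul_add, mul_smul_comm,
        smul_sub, map_zero, LinearMap.zero_apply, zero_add, zero_mul]
      simp only [smul_comm (Multiset.count y (l : Multiset (GlIdx m n)) : ℂ)]
      abel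

/-- The Euler operator. -/
def Eu : Module.End ℂ ρ.M := ∑ y, ρ.Th [y] (sng (dW y))

lemma Eu_eq : ρ.Eu = ∑ y, (ρ.X (sng (ddW y)) - ρ.μ (asng (gen y)) * ρ.X (sng (dW y))) := by
  refine Finset.sum_congr rfl fun y _ => ?_
  simp [Th_cons, wmul_gen_dW]

lemma Eu_Th (l : List (GlIdx m n)) (hl : l ≠ []) (Y : WBasis m n b) :
    ρ.Eu * ρ.Th l (sng Y) = ρ.Th l (sng Y) * ρ.Eu + ((l.length : ℂ) - isder Y.2.2) • ρ.Th l (sng Y)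
      + ∑ y, ((-1 : ℂ) ^ (gpar y * lpar l)) • ρ.Th (y :: l) (brL (sng (dW y)) (sng Y)) := by
  have hlen : (l.length : ℂ) = ∑ y, (Multiset.count y (l : Multiset (GlIdx m n)) : ℂ) := by
    rw [← Nat.cast_sum]
    congr 1
    exact (Multiset.sum_count_eq_card (s := Finset.univ) (m := (l : Multiset (GlIdx m n)))
      (fun _ _ => Finset.mem_univ _)).symm.trans rfl
  have h := congrArg (ρ.Th l) (sum_brL_ddW (b := b) Y)
  rw [map_sub, map_sum, map_sum, map_smul] at h
  rw [sub_smul]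
  have key (y : GlIdx m n) : (ρ.X (sng (ddW y)) - ρ.μ (asng (gen y)) * ρ.X (sng (dW y))) * ρ.Th l (sng Y)
      = ρ.Th l (sng Y) * (ρ.X (sng (ddW y)) - ρ.μ (asng (gen y)) * ρ.X (sng (dW y)))
        + ρ.Th l (brL (sng (ddW y)) (sng Y)) + (Multiset.count y (l : Multiset (GlIdx m n)) : ℂ) • ρ.Th l (sng Y)
        - ((-1 : ℂ) ^ (gpar y * lpar l)) • (ρ.μ (asng (gen y)) * ρ.Th l (brL (sng (dW y)) (sng Y))) := by
    rw [sub_mul, ddW_Th, mul_assoc, dW_Th, mul_sub, ← mul_assoc (ρ.Th l (sng Y)), Th_μ, if_neg hl,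
      apar_gen]
    simp only [zero_add, mul_smul_comm, mul_add, smul_mul_assoc, mul_assoc]
    module
  have key2 (y : GlIdx m n) :
      ((-1 : ℂ) ^ (gpar y * lpar l)) • ρ.Th (y :: l) (brL (sng (dW y)) (sng Y)) =
      ρ.Th l (wmul (asng (gen y)) (brL (sng (dW y)) (sng Y)))
       - ((-1 : ℂ) ^ (gpar y * lpar l)) • (ρ.μ (asng (gen y)) * ρ.Th l (brL (sng (dW y)) (sng Y))) := by
    rw [Th_cons, smul_sub, smul_smul, ← pow_add, ← two_mul, pow_mul]
    simp
  rw [Eu_eq, Finset.sum_mul, Finset.mul_sum]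
  simp only [key, key2, Finset.sum_add_distrib, Finset.sum_sub_distrib, h, hlen, Finset.sum_smul]
  abel

end AVRep

end Theta

end

end WSuper

namespace WSuper


noncomputable section

section Core

variable {m n : ℕ} {b : Bool} (ρ : AVRep m n b)

namespace AVRep

/-- The operator of multiplication by the Laurent monomial `t^r`. -/
def tm (r : LExp m) : Module.End ℂ ρ.M := ρ.μ (asng (r, fun _ => false))

lemma tm_add (r s : LExp m) : ρ.tm (r + s) = ρ.tm r * ρ.tm s := by
  rw [tm, tm, tm, ← μ_mul, mulA_asng]
  simp [amulB, xorE_zero]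

lemma tm_zero : ρ.tm 0 = 1 := ρ.μ_one

lemma tm_neg_tm (r : LExp m) (v : ρ.M) : ρ.tm (-r) (ρ.tm r v) = v := by
  rw [← Module.End.mul_apply, ← tm_add, neg_add_cancel, tm_zero, Module.End.one_apply]

lemma tm_injective (r : LExp m) {v : ρ.M} (h : ρ.tm r v = 0) : v = 0 := by
  rw [← tm_neg_tm ρ r v, h, map_zero]

lemma tm_μ (r : LExp m) (x : ABasis m n) : ρ.tm r * ρ.μ (asng x) = ρ.μ (asng x) * ρ.tm r := by
  rw [tm, μ_comm]
  simp [apar]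

lemma Th_tm {l : List (GlIdx m n)} (hl : l ≠ []) (Y : W m n b) (r : LExp m) :
    ρ.Th l Y * ρ.tm r = ρ.tm r * ρ.Th l Y := by
  rw [tm, Th_μ, if_neg hl]
  simp [apar, twW_zero]

lemma Eu_tm (r : LExp m) : ρ.Eu * ρ.tm r = ρ.tm r * ρ.Eu := by
  rw [Eu, Finset.sum_mul, Finset.mul_sum]
  exact Finset.sum_congr rfl fun y _ => ρ.Th_tm (List.cons_ne_nil _ _) _ _

lemma lpar_perm {l l' : List (GlIdx m n)} (h : l.Perm l') : lpar l = lpar l' :=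
  (h.map gpar).sum_eq

lemma Th_perm {l l' : List (GlIdx m n)} (h : l.Perm l') :
    ∃ c : ℂ, ρ.Th l = c • ρ.Th l' := by
  induction h with
  | nil => exact ⟨1, by simp⟩
  | cons a h ih =>
    obtain ⟨c, hc⟩ := ih
    refine ⟨c, LinearMap.ext fun Y => ?_⟩
    rw [LinearMap.smul_apply, Th_cons, Th_cons, lpar_perm h, hc]
    simp only [LinearMap.smul_apply, smul_sub, mul_smul_comm, smul_comm c]
  | swap a c l => exact ⟨_, ρ.Th_swap _ _ l⟩
  | trans _ _ ih ih' =>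
    obtain ⟨c, hc⟩ := ih
    obtain ⟨d, hd⟩ := ih'
    exact ⟨c * d, by rw [hc, hd, smul_smul]⟩

lemma Th_append_apply (l l' : List (GlIdx m n)) (u : ρ.M) (h : ∀ Y, ρ.Th l' Y u = 0) (Y : W m n b) :
    ρ.Th (l ++ l') Y u = 0 := by
  induction l generalizing Y with
  | nil => exact h Y
  | cons a l ih =>
    rw [List.cons_append, Th_cons, LinearMap.sub_apply, LinearMap.smul_apply, Module.End.mul_apply,
      ih, ih, map_zero, smul_zero, sub_zero]

lemma Th_odd_odd (α : Fin n) : ρ.Th [.inr α, .inr α] = 0 := by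
  have h := ρ.Th_swap (.inr α) (.inr α) []
  simp only [gpar, mul_one, pow_one, neg_smul, one_smul] at h
  have h2 : (2 : ℂ) • ρ.Th [.inr α, .inr α] = 0 := by
    rw [two_smul]
    nth_rewrite 1 [h]
    module
  exact (smul_eq_zero.mp h2).resolve_left two_ne_zero

/-- If all `N`-fold differences in a single even variable vanish on `u`, then all sufficiently long
differences vanish on `u`. -/
lemma Th_long {N : ℕ} (hN : 2 ≤ N) (u : ρ.M)
    (h : ∀ i Y, ρ.Th (List.replicate N (.inl i)) Y u = 0) {l : List (GlIdx m n)}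
    (hl : Fintype.card (GlIdx m n) * N < l.length) (Y : W m n b) : ρ.Th l Y u = 0 := by
  have hcard : (∑ y, Multiset.count y (l : Multiset (GlIdx m n))) = l.length :=
    Multiset.sum_count_eq_card (fun _ _ => Finset.mem_univ _)
  obtain ⟨a, ha⟩ : ∃ a, N ≤ Multiset.count a (l : Multiset (GlIdx m n)) := by
    by_contra! hlt
    have := Finset.sum_le_card_nsmul Finset.univ
      (fun y => Multiset.count y (l : Multiset (GlIdx m n))) N fun y _ => (hlt y).le
    rw [hcard, smul_eq_mul, Finset.card_univ] at this
    omega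
  obtain ⟨t, ht⟩ := Multiset.le_iff_exists_add.mp (Multiset.le_count_iff_replicate_le.mp ha)
  have hp : l.Perm (t.toList ++ List.replicate N a) := by
    rw [← Multiset.coe_eq_coe, ht, ← Multiset.coe_add, Multiset.coe_toList, Multiset.coe_replicate,
      add_comm]
  obtain ⟨c, hc⟩ := ρ.Th_perm hp
  rw [hc, LinearMap.smul_apply, LinearMap.smul_apply, Th_append_apply, smul_zero]
  intro Y
  cases a with
  | inl i => exact h i Y
  | inr α =>
    obtain ⟨k, rfl⟩ := Nat.exists_eq_add_of_le' hN
    rw [List.replicate_add]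
    refine ρ.Th_append_apply _ _ u (fun Y => ?_) Y
    change ρ.Th [.inr α, .inr α] Y u = 0
    rw [Th_odd_odd]
    rfl

end AVRep

/-- A finite-dimensional homogeneous subspace of an `AV`-module on which the iterated differences
are nilpotent. -/
structure Core where
  U : Submodule ℂ ρ.M
  fd : FiniteDimensional ℂ U
  ne : U ≠ ⊥
  nu : Fin m → ℂ
  nu0 : ℂ
  d_apply : ∀ i, ∀ u ∈ U, ρ.X (sng (0, fun _ => false, .di i)) u = nu i • u
  d0_apply : ∀ D : Dir m n b, isder D = 0 → ∀ u ∈ U, ρ.X (sng (0, fun _ => false, D)) u = nu0 • u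
  X_mem : ∀ r s D, ∀ u ∈ U, ρ.tm (-r) (ρ.X (sng (r, s, D)) u) ∈ U
  xi_mem : ∀ α, ∀ u ∈ U, ρ.μ (asng (0, gone α)) u ∈ U
  N : ℕ
  two_le : 2 ≤ N
  nilp : ∀ u ∈ U, ∀ i Y, ρ.Th (List.replicate N (.inl i)) Y u = 0

namespace Core

variable {ρ} (K : Core ρ)

lemma X_mem_zero (s : GExp n) (D : Dir m n b) {u : ρ.M} (hu : u ∈ K.U) :
    ρ.X (sng (0, s, D)) u ∈ K.U := by
  simpa [ρ.tm_zero] using K.X_mem 0 s D u hu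

/-- Total weight of a list of indices. -/
def lwt (l : List (GlIdx m n)) : LExp m := (l.map fun a => (gen a).1).sum

lemma Th_mem (l : List (GlIdx m n)) (r : LExp m) (s : GExp n) (D : Dir m n b) {u : ρ.M}
    (hu : u ∈ K.U) : ρ.tm (-(r + lwt l)) (ρ.Th l (sng (r, s, D)) u) ∈ K.U := by
  induction l generalizing r s with
  | nil => simpa [lwt] using K.X_mem r s D u hu
  | cons a l ih =>
    rw [AVRep.Th_cons, LinearMap.sub_apply, map_sub, LinearMap.smul_apply, map_smul, wmul_sng,
      mulA_asng, amulB, map_smul, emb_asng, map_smul, LinearMap.smul_apply, map_smul,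
      show lwt (a :: l) = (gen a).1 + lwt l by simp [lwt]]
    refine K.U.sub_mem (K.U.smul_mem _ (K.U.smul_mem _ ?_)) ?_
    · have := ih ((gen a).1 + r) (xorE (gen a).2 s)
      rwa [show (gen a).1 + r + lwt l = r + ((gen a).1 + lwt l) by abel] at this
    · have := ih r s
      cases a with
      | inl i =>
        rw [Module.End.mul_apply]
        change ρ.tm _ (ρ.tm (Pi.single i 1) _) ∈ _
        rw [← Module.End.mul_apply, ← ρ.tm_add]
        convert this using 3
        simp only [gen]
        abel
      | inr α =>
        rw [Module.End.mul_apply, ← Module.End.mul_apply, ρ.tm_μ]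
        refine K.xi_mem α _ ?_
        convert this using 3
        simp [gen]

lemma Th_single_mem (a c : GlIdx m n) {u : ρ.M} (hu : u ∈ K.U) :
    ρ.tm ((gen c).1 - (gen a).1) (ρ.Th [a] (sng (dW c)) u) ∈ K.U := by
  have := K.Th_mem [a] (dW c : WBasis m n b).1 (dW c : WBasis m n b).2.1 (dW c : WBasis m n b).2.2 hu
  convert this using 3
  cases c <;> simp [gen, dW, lwt]
  abel

lemma Eu_mem {u : ρ.M} (hu : u ∈ K.U) : ρ.Eu u ∈ K.U := by
  rw [AVRep.Eu, LinearMap.sum_apply]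
  refine K.U.sum_mem fun a _ => ?_
  simpa [ρ.tm_zero] using K.Th_single_mem a a hu

lemma exists_top_eigenvalue : ∃ c : ℂ, (∃ u ∈ K.U, u ≠ 0 ∧ ρ.Eu u = c • u) ∧
    ∀ j : ℕ, 1 ≤ j → ∀ u ∈ K.U, ρ.Eu u = (c + j) • u → u = 0 := by
  have := K.fd
  have : Nontrivial K.U := Submodule.nontrivial_iff_ne_bot.mpr K.ne
  let T : Module.End ℂ K.U := ρ.Eu.restrict fun u hu => K.Eu_mem hu
  have hne : {c | T.HasEigenvalue c}.Nonempty := Module.End.exists_eigenvalue T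
  have hfin : {c | T.HasEigenvalue c}.Finite := Module.End.finite_hasEigenvalue T
  obtain ⟨c, hc, hmax⟩ := Set.exists_max_image _ Complex.re hfin hne
  refine ⟨c, ?_, fun j hj u hu h => ?_⟩
  · obtain ⟨u, hu⟩ := Module.End.HasEigenvalue.exists_hasEigenvector hc
    refine ⟨u, u.2, fun h => hu.2 (Subtype.ext h), ?_⟩
    have := hu.apply_eq_smul
    exact congrArg Subtype.val this
  · by_contra hne
    have hev : T.HasEigenvalue (c + j) :=
      Module.End.hasEigenvalue_of_hasEigenvector (x := ⟨u, hu⟩)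
        ⟨Module.End.mem_eigenspace_iff.mpr (Subtype.ext h), fun h' => hne (congrArg Subtype.val h')⟩
    have := hmax _ hev
    simp only [Complex.add_re, Complex.natCast_re] at this
    have : (1 : ℝ) ≤ j := by exact_mod_cast hj
    linarith

end Core

end Core

end

end WSuper

namespace WSuper


noncomputable section

section Vacuum

variable {m n : ℕ} {b : Bool} (ρ : AVRep m n b)

namespace AVRep

lemma brL_dW_dW (a c : GlIdx m n) : brL (sng (dW a : WBasis m n b)) (sng (dW c)) = 0 := by
  rw [brL_sng]
  rcases a with i | α <;> rcases c with j | β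
  · by_cases h : i = j
    · subst h; simp [dW, brB]
    · simp [dW, brB, Pi.single_apply, h, Ne.symm h]
  all_goals simp [dW, brB, derC]

/-- The normalised operators of `gl(m,n)`. -/
def rh (a c : GlIdx m n) : Module.End ℂ ρ.M :=
  ρ.tm ((gen c).1 - (gen a).1) * ρ.Th [a] (sng (dW c))

lemma twW_dW (k : ℕ) (c : GlIdx m n) :
    twW k (sng (dW c : WBasis m n b)) = ((-1 : ℂ) ^ (k * gpar c)) • sng (dW c) := by
  rw [twW_sng, par_dW]

lemma dW_Th_dW (y a c : GlIdx m n) : ρ.X (sng (dW y)) * ρ.Th [a] (sng (dW c)) =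
    ((-1 : ℂ) ^ (gpar y * (gpar a + gpar c))) • (ρ.Th [a] (sng (dW c)) * ρ.X (sng (dW y))) := by
  rw [dW_Th, brL_dW_dW, twW_dW, map_zero, add_zero, map_smul, smul_mul_assoc, smul_smul, ← pow_add]
  simp [mul_add]

lemma dW_Eu (y : GlIdx m n) : ρ.X (sng (dW y)) * ρ.Eu = ρ.Eu * ρ.X (sng (dW y)) := by
  rw [Eu, Finset.mul_sum, Finset.sum_mul]
  refine Finset.sum_congr rfl fun a _ => ?_
  rw [dW_Th_dW, ← two_mul, mul_left_comm, pow_mul]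
  simp

lemma odd_dW_anticomm (α β : Fin n) : ρ.X (sng (dW (.inr α))) * ρ.X (sng (dW (.inr β)))
    = - (ρ.X (sng (dW (.inr β))) * ρ.X (sng (dW (.inr α)))) := by
  have h := ρ.X_brL (dW (.inr α)) (sng (dW (.inr β)))
  rw [brL_dW_dW, map_zero, par_dW, twW_dW] at h
  simp only [gpar, mul_one, pow_one, neg_smul, one_smul, map_neg, neg_mul, sub_neg_eq_add] at h
  exact eq_neg_of_add_eq_zero_left h.symm

lemma odd_dW_tm (α : Fin n) (r : LExp m) : ρ.X (sng (dW (.inr α))) * ρ.tm r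
    = ρ.tm r * ρ.X (sng (dW (.inr α))) := by
  rw [tm, X_μ, Der_sng, twA_asng]
  simp [dW, wOnA, derC, apar]

end AVRep

/-- Pairwise anticommuting endomorphisms have a common zero in any non-zero stable subspace. -/
lemma exists_common_zero {M ι : Type*} [AddCommGroup M] [Module ℂ M] (T : ι → Module.End ℂ M)
    (h : ∀ i j, T i * T j = -(T j * T i)) (Z : Submodule ℂ M) (hZ : Z ≠ ⊥)
    (hT : ∀ i, ∀ u ∈ Z, T i u ∈ Z) (S : Finset ι) : ∃ u ∈ Z, u ≠ 0 ∧ ∀ i ∈ S, T i u = 0 := by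
  classical
  have hsq (i : ι) : T i * T i = 0 := by
    have h2 : (2 : ℂ) • (T i * T i) = 0 := by
      rw [two_smul]
      nth_rewrite 1 [h]
      exact neg_add_cancel _
    exact (smul_eq_zero.mp h2).resolve_left two_ne_zero
  induction S using Finset.induction_on with
  | empty =>
    obtain ⟨u, hu, hu0⟩ := Submodule.exists_mem_ne_zero_of_ne_bot hZ
    exact ⟨u, hu, hu0, by simp⟩
  | insert i S _ ih =>
    obtain ⟨u, hu, hu0, hS⟩ := ih
    by_cases hi : T i u = 0
    · exact ⟨u, hu, hu0, by simpa [hi] using hS⟩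
    · refine ⟨T i u, hT i u hu, hi, fun j hj => ?_⟩
      rcases Finset.mem_insert.mp hj with rfl | hj
      · exact LinearMap.congr_fun (hsq j) u
      · have := LinearMap.congr_fun (h j i) u
        simpa [hS j hj] using this

namespace Core

variable {ρ} (K : Core ρ)

lemma Th_eq_zero_step {c : ℂ} (hc : ∀ j : ℕ, 1 ≤ j → ∀ u ∈ K.U, ρ.Eu u = (c + j) • u → u = 0)
    {u : ρ.M} (hu : u ∈ K.U) (hE : ρ.Eu u = c • u) {l : List (GlIdx m n)} (hl : l ≠ [])
    (h : ∀ y Y, ρ.Th (y :: l) Y u = 0) (Y : WBasis m n b) (j : ℕ) (hj : 1 ≤ j)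
    (hlj : (l.length : ℂ) - isder Y.2.2 = j) : ρ.Th l (sng Y) u = 0 := by
  have h1 := LinearMap.congr_fun (ρ.Eu_Th l hl Y) u
  simp only [LinearMap.add_apply, Module.End.mul_apply, LinearMap.smul_apply, LinearMap.sum_apply,
    h, smul_zero, Finset.sum_const_zero, add_zero, hE, map_smul, hlj] at h1
  refine ρ.tm_injective (-(Y.1 + lwt l)) (hc j hj _ (K.Th_mem l Y.1 Y.2.1 Y.2.2 hu) ?_)
  rw [← Module.End.mul_apply, ρ.Eu_tm, Module.End.mul_apply, ← map_smul, add_smul, ← h1]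

lemma isder_cases (D : Dir m n b) : isder D = 0 ∨ isder D = 1 := by cases D <;> simp [isder]

lemma Th_eq_zero {c : ℂ} (hc : ∀ j : ℕ, 1 ≤ j → ∀ u ∈ K.U, ρ.Eu u = (c + j) • u → u = 0)
    {u : ρ.M} (hu : u ∈ K.U) (hE : ρ.Eu u = c • u) {l : List (GlIdx m n)} (hl : 2 ≤ l.length)
    (Y : W m n b) : ρ.Th l Y u = 0 := by
  have key (d : ℕ) : ∀ l : List (GlIdx m n), 2 ≤ l.length →
      Fintype.card (GlIdx m n) * K.N < l.length + d → ∀ Y, ρ.Th l Y u = 0 := by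
    induction d with
    | zero => exact fun l _ hl Y => ρ.Th_long K.two_le u (K.nilp u hu) hl Y
    | succ d ih =>
      intro l hl hd Y
      induction Y using W_ind with
      | zero => simp
      | add f f' hf hf' => simp only [map_add, LinearMap.add_apply, hf, hf', add_zero]
      | smul c f hf => simp only [map_smul, LinearMap.smul_apply, hf, smul_zero]
      | mon Y =>
        have hn (y : GlIdx m n) (Y : W m n b) : ρ.Th (y :: l) Y u = 0 :=
          ih _ (by rw [List.length_cons]; omega) (by rw [List.length_cons]; omega) Y
        have hne : l ≠ [] := by rintro rfl; simp at hl
        rcases isder_cases Y.2.2 with h | h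
        · exact K.Th_eq_zero_step hc hu hE hne hn Y l.length (by omega) (by simp [h])
        · refine K.Th_eq_zero_step hc hu hE hne hn Y (l.length - 1) (by omega) ?_
          rw [h, Nat.cast_sub (by omega), Nat.cast_one]
  exact key (Fintype.card (GlIdx m n) * K.N + 1) l hl (by omega) Y

lemma exists_vacuum : ∃ Z : Submodule ℂ ρ.M, Z ≤ K.U ∧ Z ≠ ⊥ ∧
    (∀ u ∈ Z, ∀ l : List (GlIdx m n), 2 ≤ l.length → ∀ Y, ρ.Th l Y u = 0) ∧
    (∀ u ∈ Z, ∀ a, ∀ Y : WBasis m n b, isder Y.2.2 = 0 → ρ.Th [a] (sng Y) u = 0) ∧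
    (∀ u ∈ Z, ∀ α, ρ.X (sng (dW (.inr α))) u = 0) ∧
    ∀ u ∈ Z, ∀ a c, ρ.rh a c u ∈ Z := by
  obtain ⟨c, ⟨u₀, hu₀, hne, hE₀⟩, hc⟩ := K.exists_top_eigenvalue
  have hδ (α : Fin n) {u : ρ.M} (hu : u ∈ K.U) : ρ.X (sng (dW (.inr α))) u ∈ K.U :=
    K.X_mem_zero _ _ hu
  let Z : Submodule ℂ ρ.M := K.U ⊓ LinearMap.ker (ρ.Eu - c • 1)
  have hZ {u : ρ.M} : u ∈ Z ↔ u ∈ K.U ∧ ρ.Eu u = c • u := by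
    simp [Z, LinearMap.mem_ker, sub_eq_zero]
  have hV1 {u : ρ.M} (hu : u ∈ Z) {l : List (GlIdx m n)} (hl : 2 ≤ l.length) (Y : W m n b) :
      ρ.Th l Y u = 0 := K.Th_eq_zero hc (hZ.mp hu).1 (hZ.mp hu).2 hl Y
  have hδZ (α : Fin n) {u : ρ.M} (hu : u ∈ Z) : ρ.X (sng (dW (.inr α))) u ∈ Z := by
    refine hZ.mpr ⟨hδ α (hZ.mp hu).1, ?_⟩
    rw [← Module.End.mul_apply, ← ρ.dW_Eu, Module.End.mul_apply, (hZ.mp hu).2, map_smul]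
  have hrZ (a d : GlIdx m n) {u : ρ.M} (hu : u ∈ Z) : ρ.rh a d u ∈ Z := by
    refine hZ.mpr ⟨K.Th_single_mem a d (hZ.mp hu).1, ?_⟩
    have h1 := LinearMap.congr_fun (ρ.Eu_Th [a] (List.cons_ne_nil _ _) (dW d)) u
    have h2 : isder (dW d : WBasis m n b).2.2 = 1 := by cases d <;> rfl
    simp only [LinearMap.add_apply, Module.End.mul_apply, LinearMap.smul_apply, LinearMap.sum_apply,
      hV1 hu (l := [_, _]) le_rfl, smul_zero, Finset.sum_const_zero, add_zero, (hZ.mp hu).2, map_smul,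
      h2, List.length_singleton, Nat.cast_one, sub_self, zero_smul] at h1
    rw [AVRep.rh, Module.End.mul_apply, ← Module.End.mul_apply, ρ.Eu_tm, Module.End.mul_apply, h1,
      map_smul]
  refine ⟨Z ⊓ ⨅ α, LinearMap.ker (ρ.X (sng (dW (.inr α)))), inf_le_left.trans inf_le_left, ?_,
    fun u hu l hl Y => hV1 hu.1 hl Y, fun u hu a Y hY => ?_, fun u hu α => ?_, fun u hu a d => ?_⟩
  · obtain ⟨u, hu, hu0, hS⟩ := exists_common_zero (fun α => ρ.X (sng (dW (.inr α))))
      (fun α β => ρ.odd_dW_anticomm α β) Z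
      ((Submodule.ne_bot_iff _).mpr ⟨u₀, hZ.mpr ⟨hu₀, hE₀⟩, hne⟩) (fun α u hu => hδZ α hu)
      Finset.univ
    refine (Submodule.ne_bot_iff _).mpr ⟨u, ⟨hu, ?_⟩, hu0⟩
    simpa using fun α => hS α (Finset.mem_univ _)
  · exact K.Th_eq_zero_step hc (hZ.mp hu.1).1 (hZ.mp hu.1).2 (List.cons_ne_nil _ _)
      (fun y Y => hV1 hu.1 (by simp) Y) Y 1 le_rfl (by simp [hY])
  · exact (Submodule.mem_iInf _).mp hu.2 α
  · refine ⟨hrZ a d hu.1, ?_⟩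
    refine (Submodule.mem_iInf _).mpr fun α => ?_
    have : ρ.X (sng (dW (.inr α))) u = 0 := (Submodule.mem_iInf _).mp hu.2 α
    rw [LinearMap.mem_ker, ← Module.End.mul_apply, AVRep.rh, ← mul_assoc, ρ.odd_dW_tm, mul_assoc,
      ρ.dW_Th_dW]
    simp [this]

end Core

end Vacuum

end

end WSuper

namespace WSuper


noncomputable section

section Tensor

variable {m n : ℕ} {b : Bool} (ρ : AVRep m n b)

namespace AVRep

lemma X_Th_single (Y : WBasis m n b) (z : GlIdx m n) (Z : W m n b) :
    ρ.X (sng Y) * ρ.Th [z] Z =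
      (ρ.X (wmul (Der (sng Y) (asng (gen z))) Z) - ρ.μ (Der (sng Y) (asng (gen z))) * ρ.X Z)
      + ((-1 : ℂ) ^ (par Y * gpar z)) • (ρ.Th [z] (brL (sng Y) Z)
        + ρ.Th [z] (twW (par Y) Z) * ρ.X (sng Y)) := by
  have h := ρ.X_brL Y (wmul (asng (gen z)) Z)
  rw [brL_wmul, twW_wmul, twA_asng, apar_gen] at h
  simp only [map_add, map_smul, LinearMap.smul_apply, smul_mul_assoc] at h
  have h2 := ρ.X_μ Y (asng (gen z))
  rw [twA_asng, apar_gen, map_smul, smul_mul_assoc] at h2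
  simp only [Th_cons, Th_nil, lpar_nil, mul_zero, pow_zero, one_smul, mul_sub, sub_mul]
  rw [← mul_assoc, h2, ← sub_eq_iff_eq_add.mpr h.symm]
  have h3 := ρ.X_brL Y Z
  rw [add_mul, smul_mul_assoc, mul_assoc, h3]
  simp only [mul_sub, ← mul_assoc, smul_sub, smul_add, smul_mul_assoc, mul_assoc]
  abel

/-- The basis element `x ∂_y` of the Lie superalgebra. -/
def _root_.WSuper.gW (x y : GlIdx m n) : WBasis m n b :=
  ((gen x).1 + (dW y : WBasis m n b).1, (gen x).2, dirG y)

lemma wmul_gen_dW' (x y : GlIdx m n) :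
    wmul (asng (gen x)) (sng (dW y : WBasis m n b)) = sng (gW x y) := by
  rw [wmul_sng]
  cases x <;> cases y <;> simp [gen, dW, gW, dirG, amulB, xorE_zero]

lemma gW_par_pow (x y : GlIdx m n) (k : ℕ) :
    (-1 : ℂ) ^ (par (gW x y : WBasis m n b) * k) = (-1) ^ ((gpar x + gpar y) * k) := by
  rw [par_pow]
  congr 2
  cases x <;> cases y <;> simp [gW, dirG, dpar, gpar, gen, apar, gdeg_gone]

lemma brL_gW_dW (x y w : GlIdx m n) : brL (sng (gW x y : WBasis m n b)) (sng (dW w)) =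
    -((-1 : ℂ) ^ ((gpar x + gpar y) * gpar w)) • (if w = x then sng (dW y) else 0) := by
  rw [brL_sng]
  rcases x with i | α <;> rcases y with j | β <;> rcases w with k | γ
  · by_cases h1 : k = i
    · subst h1
      by_cases h2 : k = j
      · subst h2
        simp [gW, dW, dirG, brB, gen, gpar, zero_xorE]
      · simp [gW, dW, dirG, brB, gen, gpar, zero_xorE, Ne.symm h2, h2]
    · by_cases h2 : k = j
      · subst h2
        simp [gW, dW, dirG, brB, gen, gpar, zero_xorE, h1]
      · simp [gW, dW, dirG, brB, gen, gpar, zero_xorE, h1, h2, Ne.symm h1, Ne.symm h2]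
  · simp [gW, dW, dirG, brB, gen, gpar, derC]
  · by_cases h1 : k = i
    · subst h1
      simp [gW, dW, dirG, brB, gen, gpar, derC, zero_xorE]
    · simp [gW, dW, dirG, brB, gen, gpar, derC, zero_xorE, h1, Ne.symm h1]
  · simp [gW, dW, dirG, brB, gen, gpar, derC]
  · by_cases h2 : k = j
    · subst h2
      simp [gW, dW, dirG, brB, gen, gpar, derC]
    · simp [gW, dW, dirG, brB, gen, gpar, derC, h2]
  · by_cases h1 : γ = α
    · subst h1
      simp [gW, dW, dirG, brB, gen, gpar, mulSgn_gone_self_aux, derE_gone, gdeg_gone, zero_xorE]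
    · have : derC γ (gone α) = 0 := by simp [derC, gone, h1]
      simp [gW, dW, dirG, brB, gen, gpar, this, h1]
  · simp [gW, dW, dirG, brB, gen, gpar, derC]
  · have h0 : derC β (fun _ => false) = 0 := by simp [derC]
    by_cases h1 : γ = α
    · subst h1
      simp [gW, dW, dirG, brB, gen, gpar, h0, mulSgn_gone_self_aux, derE_gone, gdeg_gone, zero_xorE]
    · have : derC γ (gone α) = 0 := by simp [derC, gone, h1]
      simp [gW, dW, dirG, brB, gen, gpar, this, h0, h1]

lemma Th_rel (x y z w : GlIdx m n) :
    ρ.Th [x] (sng (dW y)) * ρ.Th [z] (sng (dW w))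
      - ((-1 : ℂ) ^ ((gpar x + gpar y) * (gpar z + gpar w))) •
        (ρ.Th [z] (sng (dW w)) * ρ.Th [x] (sng (dW y)))
      = (if y = z then ρ.Th [x] (sng (dW w)) else 0)
        - ((-1 : ℂ) ^ ((gpar x + gpar y) * (gpar z + gpar w))) •
            (if w = x then ρ.Th [z] (sng (dW y)) else 0) := by
  have e1 (x y : GlIdx m n) : ρ.Th [x] (sng (dW y)) =
      ρ.X (sng (gW x y)) - ρ.μ (asng (gen x)) * ρ.X (sng (dW y)) := by
    simp [Th_cons, wmul_gen_dW']
  have e2 : ρ.μ (asng (gen x)) * ρ.Th [z] (sng (dW w)) =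
      ((-1 : ℂ) ^ (gpar x * (gpar z + gpar w))) • (ρ.Th [z] (sng (dW w)) * ρ.μ (asng (gen x))) := by
    have h (k : ℕ) : (-1 : ℂ) ^ k * (-1) ^ k = 1 := by rw [← mul_pow]; simp
    rw [Th_μ, if_neg (List.cons_ne_nil _ _), twW_dW, apar_gen, map_smul, mul_smul_comm]
    simp only [zero_add, smul_smul, lpar_cons, lpar_nil, add_zero]
    rw [← pow_add, ← mul_add, h, one_smul]
  have e3 : Der (sng (gW x y : WBasis m n b)) (asng (gen z)) = if y = z then asng (gen x) else 0 := by
    rw [← wmul_gen_dW', Der_wmul, Der_dW_gen]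
    split_ifs <;> simp [mulA_one]
  have e4 := ρ.X_Th_single (gW x y) z (sng (dW w))
  rw [e3, brL_gW_dW, twW_dW, gW_par_pow, gW_par_pow] at e4
  have e5 : ρ.μ (asng (gen x)) * ρ.X (sng (dW y)) * ρ.Th [z] (sng (dW w)) =
      ((-1 : ℂ) ^ ((gpar x + gpar y) * (gpar z + gpar w))) •
        (ρ.Th [z] (sng (dW w)) * (ρ.μ (asng (gen x)) * ρ.X (sng (dW y)))) := by
    rw [mul_assoc, dW_Th_dW, mul_smul_comm, ← mul_assoc, e2, smul_mul_assoc, smul_smul, ← pow_add,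
      ← add_mul, add_comm (gpar y), mul_assoc]
  rw [e1 x y, sub_mul, mul_sub, e4, e5]
  have e6 : (ρ.X (wmul (if y = z then asng (gen x) else 0) (sng (dW w)))
      - ρ.μ (if y = z then asng (gen x) else 0) * ρ.X (sng (dW w)))
      = if y = z then ρ.Th [x] (sng (dW w)) else 0 := by
    split_ifs
    · rw [e1, wmul_gen_dW']
    · simp
  rw [e6]
  by_cases hw : w = x
  · simp only [hw, if_true, mul_add, pow_add, map_smul, smul_sub, smul_add, smul_smul, smul_mul_assoc]
    module
  · simp only [hw, if_false, mul_add, pow_add, map_smul, smul_sub, smul_add, smul_smul,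
      smul_mul_assoc, smul_zero, map_zero]
    module

lemma rh_rel (x y z w : GlIdx m n) :
    ρ.rh x y * ρ.rh z w
      - ((-1 : ℂ) ^ ((gpar x + gpar y) * (gpar z + gpar w))) • (ρ.rh z w * ρ.rh x y)
      = (if y = z then ρ.rh x w else 0)
        - ((-1 : ℂ) ^ ((gpar x + gpar y) * (gpar z + gpar w))) •
            (if w = x then ρ.rh z y else 0) := by
  have h (x y z w : GlIdx m n) : ρ.rh x y * ρ.rh z w =
      ρ.tm ((gen y).1 - (gen x).1 + ((gen w).1 - (gen z).1)) *
        (ρ.Th [x] (sng (dW y)) * ρ.Th [z] (sng (dW w))) := by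
    rw [tm_add, rh, rh, mul_assoc, ← mul_assoc (ρ.Th [x] _), ρ.Th_tm (List.cons_ne_nil _ _)]
    simp only [mul_assoc]
  rw [h, h, add_comm ((gen w).1 - (gen z).1), ← mul_smul_comm, ← mul_sub, Th_rel, mul_sub,
    mul_smul_comm]
  congr 1
  · split_ifs with h
    · subst h; rw [rh]; congr 2; abel
    · simp
  · congr 1
    split_ifs with h
    · subst h; rw [rh]; congr 2; abel
    · simp

end AVRep
end Tensor

end

end WSuper

namespace WSuper


noncomputable section

section TensorForm

variable {m n : ℕ} {b : Bool}

/-- Induction along the generators of `A`. -/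
lemma A_ind_gen {P : AAlg m n → Prop} (one : P (aone m n)) (add : ∀ f g, P f → P g → P (f + g))
    (smul : ∀ (c : ℂ) f, P f → P (c • f)) (gen_mul : ∀ a f, P f → P (mulA (asng (gen a)) f))
    (of_gen_mul : ∀ i f, P (mulA (asng (gen (.inl i))) f) → P f) (f : AAlg m n) : P f := by
  have zero : P 0 := by simpa using smul 0 _ one
  have hmul (i : Fin m) (r : LExp m) (s : GExp n) :
      mulA (asng (gen (.inl i))) (asng (r, s)) = asng (Pi.single i 1 + r, s) := by
    simp [gen, amulB, zero_xorE]
  have hshift (r : LExp m) (s : GExp n) (i : Fin m) (k : ℤ) :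
      P (asng (r, s)) → P (asng (Pi.single i k + r, s)) := by
    intro h
    induction k with
    | zero => simpa using h
    | succ k ih =>
      have := gen_mul (.inl i) _ ih
      rw [hmul, ← add_assoc, ← Pi.single_add, add_comm (1 : ℤ)] at this
      exact this
    | pred k ih =>
      refine of_gen_mul i _ ?_
      rw [hmul, ← add_assoc, ← Pi.single_add]
      simpa using ih
  have hr (s : GExp n) (h : P (asng (0, s))) (r : LExp m) : P (asng (r, s)) := by
    have key (S : Finset (Fin m)) : P (asng (∑ i ∈ S, Pi.single i (r i), s)) := by
      induction S using Finset.induction_on with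
      | empty => simpa using h
      | insert i S hi ih => rw [Finset.sum_insert hi]; exact hshift _ _ _ _ ih
    simpa [Finset.univ_sum_single] using key Finset.univ
  have hs (S : Finset (Fin n)) : P (asng (0, fun x => decide (x ∈ S))) := by
    induction S using Finset.induction_on with
    | empty => simpa [aone] using one
    | insert α S hα ih =>
      have h1 := gen_mul (.inr α) _ ih
      have h2 : xorE (gone α) (fun x => decide (x ∈ S)) = fun x => decide (x ∈ insert α S) := by
        funext x
        by_cases hx : x = α
        · subst hx; simp [xorE, gone, hα]
        · simp [xorE, gone, hx]
      have h3 : mulSgn (gone α) (fun x => decide (x ∈ S)) ≠ 0 := by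
        rw [mulSgn, if_neg]
        · exact pow_ne_zero _ (by norm_num)
        · rintro ⟨x, hx, hx'⟩
          simp only [gone, decide_eq_true_eq] at hx hx'
          exact hα (hx ▸ hx')
      simp only [gen, mulA_asng, amulB, h2, add_zero] at h1
      have := smul (mulSgn (gone α) (fun x => decide (x ∈ S)))⁻¹ _ h1
      rwa [smul_smul, inv_mul_cancel₀ h3, one_smul] at this
  refine A_ind zero add smul (fun x => ?_) f
  obtain ⟨r, s⟩ := x
  refine hr s ?_ r
  convert hs (Finset.univ.filter fun x => s x = true) using 3
  funext x
  simp

/-- The twisted partial derivatives of `A`. -/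
def dst (b : Bool) (a : GlIdx m n) : AAlg m n →ₗ[ℂ] AAlg m n :=
  twA (gpar a) ∘ₗ Der (sng (dW a : WBasis m n b))

lemma neg_one_pow_mul_self (k : ℕ) : (-1 : ℂ) ^ k * (-1) ^ k = 1 := by rw [← mul_pow]; simp

lemma dst_gen_mul (a c : GlIdx m n) (g : AAlg m n) : dst b a (mulA (asng (gen c)) g) =
    mulA (asng (gen c)) (dst b a g) + if a = c then twA (gpar a) g else 0 := by
  simp only [dst, LinearMap.comp_apply]
  rw [Der_mulA, Der_dW_gen, par_dW, twA_asng, apar_gen, map_add, map_smul, LinearMap.smul_apply,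
    map_smul, twA_mulA (f := asng (gen c)), twA_asng, apar_gen, map_smul, LinearMap.smul_apply,
    smul_smul, neg_one_pow_mul_self, one_smul, add_comm]
  split_ifs <;> simp [one_mulA]

lemma dst_inl (i : Fin m) (r : LExp m) (s : GExp n) :
    dst b (.inl i) (asng (r, s)) = (r i : ℂ) • asng (r - Pi.single i 1, s) := by
  simp only [dst, LinearMap.comp_apply]
  rw [Der_sng]
  simp [dW, wOnA, gpar, twA_zero, zero_xorE, sub_eq_add_neg, add_comm]

lemma dst_inr (α : Fin n) (r : LExp m) (s : GExp n) :
    dst b (.inr α) (asng (r, s)) = ((-1) ^ (gdeg s + 1) * derC α s) • asng (r, derE α s) := by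
  simp only [dst, LinearMap.comp_apply]
  rw [Der_sng]
  simp only [dW, wOnA, gpar, map_smul, twA_asng, zero_xorE, mulSgn_zero_left, mul_one, zero_add,
    one_mul, smul_smul]
  by_cases h : s α = true
  · congr 1
    rw [← gsgn_apar, gsgn_derE h, gsgn, pow_succ]
    ring
  · simp [derC, h]

namespace AVRep

variable (ρ : AVRep m n b) {u : ρ.M}

lemma Th_emb_apply (hu : ∀ a c Y, ρ.Th [a, c] Y u = 0) (c : GlIdx m n) (D : Dir m n b) (g : AAlg m n) :
    ρ.Th [c] (emb D g) u = ρ.μ (twA (gpar c) g) (ρ.Th [c] (emb D (aone m n)) u) := by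
  have hstep (a : GlIdx m n) (g : AAlg m n) : ρ.Th [c] (emb D (mulA (asng (gen a)) g)) u =
      ((-1 : ℂ) ^ (gpar c * gpar a)) • ρ.μ (asng (gen a)) (ρ.Th [c] (emb D g) u) := by
    have h := hu a c (emb D g)
    rw [Th_cons, wmul_emb, LinearMap.sub_apply, LinearMap.smul_apply, sub_eq_zero] at h
    rw [← Module.End.mul_apply, ← h, smul_smul]
    simp only [lpar_cons, lpar_nil, add_zero]
    rw [mul_comm (gpar c), neg_one_pow_mul_self, one_smul]
  have hstep' (a : GlIdx m n) (g : AAlg m n) (w : ρ.M) : ρ.μ (twA (gpar c) (mulA (asng (gen a)) g)) w =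
      ((-1 : ℂ) ^ (gpar c * gpar a)) • ρ.μ (asng (gen a)) (ρ.μ (twA (gpar c) g) w) := by
    rw [twA_mulA, twA_asng, apar_gen, map_smul, LinearMap.smul_apply, map_smul, μ_mul]
    rfl
  induction g using A_ind_gen with
  | one =>
    have : twA (gpar c) (aone m n) = aone m n := by simp [aone, apar]
    rw [this, μ_one, Module.End.one_apply]
  | add f g hf hg => simp only [map_add, LinearMap.add_apply, hf, hg]
  | smul c f hf => simp only [map_smul, LinearMap.smul_apply, hf]
  | gen_mul a f hf => rw [hstep, hf, hstep']
  | of_gen_mul i f hf =>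
    rw [hstep, hstep'] at hf
    simp only [gpar, mul_zero, pow_zero, one_smul] at hf
    exact sub_eq_zero.mp (ρ.tm_injective (Pi.single i 1) (by
      rw [map_sub, sub_eq_zero]; exact hf))

lemma X_emb_apply (hu : ∀ a c Y, ρ.Th [a, c] Y u = 0) (D : Dir m n b) (g : AAlg m n) :
    ρ.X (emb D g) u = ρ.μ g (ρ.X (emb D (aone m n)) u)
      + ∑ a, ρ.μ (dst b a g) (ρ.Th [a] (emb D (aone m n)) u) := by
  have hstep (c : GlIdx m n) (g : AAlg m n) : ρ.X (emb D (mulA (asng (gen c)) g)) u =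
      ρ.μ (asng (gen c)) (ρ.X (emb D g) u)
        + ρ.μ (twA (gpar c) g) (ρ.Th [c] (emb D (aone m n)) u) := by
    rw [← Th_emb_apply ρ hu, Th_cons, wmul_emb, LinearMap.sub_apply]
    simp
  have hstep' (c : GlIdx m n) (g : AAlg m n) :
      ρ.μ (mulA (asng (gen c)) g) (ρ.X (emb D (aone m n)) u)
      + ∑ a, ρ.μ (dst b a (mulA (asng (gen c)) g)) (ρ.Th [a] (emb D (aone m n)) u)
      = ρ.μ (asng (gen c)) (ρ.μ g (ρ.X (emb D (aone m n)) u)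
      + ∑ a, ρ.μ (dst b a g) (ρ.Th [a] (emb D (aone m n)) u))
        + ρ.μ (twA (gpar c) g) (ρ.Th [c] (emb D (aone m n)) u) := by
    have h (a : GlIdx m n) (w : ρ.M) : ρ.μ (if a = c then twA (gpar a) g else 0) w =
        if a = c then ρ.μ (twA (gpar a) g) w else 0 := by
      split_ifs <;> simp
    simp only [dst_gen_mul, map_add, LinearMap.add_apply, Finset.sum_add_distrib, μ_mul,
      Module.End.mul_apply, map_sum, h, Finset.sum_ite_eq', Finset.mem_univ, if_true]
    abel
  induction g using A_ind_gen with
  | one =>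
    have (a : GlIdx m n) : dst b a (aone m n) = 0 := by
      cases a with
      | inl i => rw [aone, dst_inl]; simp
      | inr α => rw [aone, dst_inr]; simp [derC]
    simp [this, μ_one]
  | add f g hf hg =>
    simp only [map_add, LinearMap.add_apply, hf, hg, Finset.sum_add_distrib]; abel
  | smul c f hf => simp only [map_smul, LinearMap.smul_apply, hf, smul_add, Finset.smul_sum]
  | gen_mul a f hf => rw [hstep, hf, hstep']
  | of_gen_mul i f hf =>
    rw [hstep, hstep', add_left_inj] at hf
    exact sub_eq_zero.mp (ρ.tm_injective (Pi.single i 1) (by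
      rw [map_sub, sub_eq_zero]; exact hf))

lemma Th_dirG_apply (hu : ∀ a c Y, ρ.Th [a, c] Y u = 0) (a c : GlIdx m n) :
    ρ.Th [a] (emb (dirG c) (aone m n)) u = ρ.tm (gen a).1 (ρ.rh a c u) := by
  have h1 : sng (dW c : WBasis m n b) = emb (dirG c) (asng (-(gen c).1, fun _ => false)) := by
    rw [emb_asng]; cases c <;> simp [dW, dirG, gen]
  have h2 : twA (gpar a) (asng (-(gen c).1, fun _ => false) : AAlg m n) = asng (-(gen c).1, fun _ => false) := by
    simp [apar]
  have h3 : ρ.Th [a] (sng (dW c)) u = ρ.tm (-(gen c).1) (ρ.Th [a] (emb (dirG c) (aone m n)) u) := by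
    rw [h1, Th_emb_apply ρ hu, h2]
    rfl
  rw [rh, Module.End.mul_apply, h3, ← Module.End.mul_apply, ← Module.End.mul_apply,
    ← tm_add, ← tm_add, show (gen a).1 + ((gen c).1 - (gen a).1) + -(gen c).1 = (0 : LExp m) by abel,
    tm_zero, Module.End.one_apply]

lemma μ_dst_tm (a : GlIdx m n) (r : LExp m) (s : GExp n) (w : ρ.M) :
    ρ.μ (dst b a (asng (r, s))) (ρ.tm (gen a).1 w) = (match a with
      | .inl i => (r i : ℂ) • ρ.μ (asng (r, s)) w
      | .inr α => ((-1) ^ (gdeg s + 1) * derC α s) • ρ.μ (asng (r, derE α s)) w) := by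
  cases a with
  | inl i =>
    rw [dst_inl, map_smul, LinearMap.smul_apply, ← Module.End.mul_apply, tm, ← μ_mul, mulA_asng]
    simp [amulB, gen, xorE_zero]
  | inr α =>
    rw [dst_inr, map_smul, LinearMap.smul_apply]
    simp [gen, tm_zero]

lemma X_dirG_apply (hu : ∀ a c Y, ρ.Th [a, c] Y u = 0) (c : GlIdx m n) (r : LExp m) (s : GExp n) :
    ρ.X (sng (r, s, dirG c)) u = ρ.μ (asng (r, s)) (ρ.X (sng (0, fun _ => false, dirG c)) u)
      + ((∑ i, (r i : ℂ) • ρ.μ (asng (r, s)) (ρ.rh (.inl i) c u))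
      + ∑ α, ((-1) ^ (gdeg s + 1) * derC α s) • ρ.μ (asng (r, derE α s)) (ρ.rh (.inr α) c u)) := by
  rw [← emb_asng (dirG c) (r, s), X_emb_apply ρ hu, ← emb_asng (dirG c) (0, fun _ => false), ← aone]
  simp only [Th_dirG_apply ρ hu, Fintype.sum_sum_type, μ_dst_tm]

end AVRep

end TensorForm

end

end WSuper

namespace WSuper


noncomputable section

section Tensor

variable {m n : ℕ} {b : Bool}

/-- A non-zero stable finite-dimensional subspace contains a minimal one. -/
lemma exists_minimal_stable {M ι : Type*} [AddCommGroup M] [Module ℂ M] (T : ι → Module.End ℂ M)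
    (Z : Submodule ℂ M) [FiniteDimensional ℂ Z] (hZ : Z ≠ ⊥) (hT : ∀ i, ∀ u ∈ Z, T i u ∈ Z) :
    ∃ V ≤ Z, V ≠ ⊥ ∧ (∀ i, ∀ u ∈ V, T i u ∈ V) ∧
      ∀ V' ≤ V, (∀ i, ∀ u ∈ V', T i u ∈ V') → V' = ⊥ ∨ V' = V := by
  let P (d : ℕ) : Prop := ∃ V ≤ Z, V ≠ ⊥ ∧ (∀ i, ∀ u ∈ V, T i u ∈ V) ∧ Module.finrank ℂ V = d
  have hP : ∃ d, P d := ⟨_, Z, le_rfl, hZ, hT, rfl⟩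
  classical
  obtain ⟨V, hV, hV0, hVT, hd⟩ := Nat.find_spec hP
  refine ⟨V, hV, hV0, hVT, fun V' hV' hV'T => ?_⟩
  by_cases h0 : V' = ⊥
  · exact .inl h0
  · right
    have := Submodule.finiteDimensional_of_le hV
    refine Submodule.eq_of_le_of_finrank_le hV' ?_
    rw [hd]
    exact Nat.find_min' hP ⟨V', hV'.trans hV, h0, hV'T, rfl⟩

variable {ρ : AVRep m n b} (K : Core ρ)

/-- A core contains an irreducible module of `gl(m,n)` on which the Lie superalgebra acts as on the
top of a tensor module. -/
theorem Core.exists_gl : ∃ (σ : GlRep m n) (ι : σ.V →ₗ[ℂ] ρ.M), FiniteDimensional ℂ σ.V ∧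
    σ.IsSimple ∧ Function.Injective ι ∧ (∀ v, ι v ∈ K.U) ∧
    (∀ r s j v, ρ.X (sng (r, s, .di j)) (ι v) = K.nu j • ρ.μ (asng (r, s)) (ι v)
      + ((∑ i, (r i : ℂ) • ρ.μ (asng (r, s)) (ι (σ.ρ (.inl i) (.inl j) v)))
      + ∑ α, ((-1) ^ (gdeg s + 1) * derC α s) •
          ρ.μ (asng (r, derE α s)) (ι (σ.ρ (.inr α) (.inl j) v)))) ∧
    (∀ r s β v, ρ.X (sng (r, s, .pa β)) (ι v) =
      (∑ i, (r i : ℂ) • ρ.μ (asng (r, s)) (ι (σ.ρ (.inl i) (.inr β) v)))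
      + ∑ α, ((-1) ^ (gdeg s + 1) * derC α s) •
          ρ.μ (asng (r, derE α s)) (ι (σ.ρ (.inr α) (.inr β) v))) ∧
    ∀ r s D v, isder D = 0 → ρ.X (sng (r, s, D)) (ι v) = K.nu0 • ρ.μ (asng (r, s)) (ι v) := by
  obtain ⟨Z, hZU, hZ0, h2, h1, h0, hrh⟩ := K.exists_vacuum
  have := K.fd
  have : FiniteDimensional ℂ Z := Submodule.finiteDimensional_of_le hZU
  obtain ⟨V, hVZ, hV0, hVT, hmin⟩ := exists_minimal_stable
    (fun p : GlIdx m n × GlIdx m n => ρ.rh p.1 p.2) Z hZ0 fun p u hu => hrh u hu p.1 p.2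
  have hV (x y : GlIdx m n) : ∀ u ∈ V, ρ.rh x y u ∈ V := hVT (x, y)
  let σ : GlRep m n :=
    { V := V
      ρ := fun x y => (ρ.rh x y).restrict (hV x y)
      rel := fun x y z w => by
        refine LinearMap.ext fun v => Subtype.ext ?_
        have := LinearMap.congr_fun (ρ.rh_rel x y z w) v
        by_cases h : y = z <;> by_cases h' : w = x <;>
        simpa [h, h'] using this }
  have hu2 (v : V) (a c : GlIdx m n) (Y : W m n b) : ρ.Th [a, c] Y v = 0 :=
    h2 v (hVZ v.2) _ le_rfl Y
  refine ⟨σ, V.subtype, Submodule.finiteDimensional_of_le hVZ, ⟨?_, fun N hN => ?_⟩,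
    V.injective_subtype, fun v => hZU (hVZ v.2), fun r s j v => ?_, fun r s β v => ?_,
    fun r s D v hD => ?_⟩
  · obtain ⟨v, hv, hv0⟩ := Submodule.exists_mem_ne_zero_of_ne_bot hV0
    exact ⟨⟨v, hv⟩, fun h => hv0 (congrArg Subtype.val h)⟩
  · have hN' : ∀ p : GlIdx m n × GlIdx m n, ∀ u ∈ Submodule.map V.subtype N,
        ρ.rh p.1 p.2 u ∈ Submodule.map V.subtype N := by
      rintro ⟨x, y⟩ _ ⟨u, hu, rfl⟩
      exact ⟨_, hN x y u hu, rfl⟩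
    rcases hmin (Submodule.map V.subtype N) (Submodule.map_subtype_le V N) hN' with h | h
    · exact .inl (Submodule.map_injective_of_injective V.injective_subtype (h.trans (Submodule.map_bot _).symm))
    · right
      refine Submodule.map_injective_of_injective V.injective_subtype ?_
      rw [h, Submodule.map_top, Submodule.range_subtype]
  · have := ρ.X_dirG_apply (hu2 v) (.inl j) r s
    rw [show (dirG (.inl j) : Dir m n b) = .di j from rfl, K.d_apply j _ (hZU (hVZ v.2)), map_smul] at this
    exact this
  · have := ρ.X_dirG_apply (hu2 v) (.inr β) r s
    rw [show (dirG (.inr β) : Dir m n b) = .pa β from rfl,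
      show ρ.X (sng (0, fun _ => false, .pa β)) (v : ρ.M) = 0 from h0 v (hVZ v.2) β, map_zero, zero_add] at this
    exact this
  · change ρ.X _ (v : V).1 = _ • ρ.μ _ (v : V).1
    rw [← emb_asng D (r, s), ρ.X_emb_apply (hu2 v), aone, emb_asng,
      K.d0_apply D hD _ (hZU (hVZ v.2)), map_smul, Finset.sum_eq_zero, add_zero]
    intro a _
    change ρ.μ _ (ρ.Th [a] (sng (0, fun _ => false, D)) (v : V).1) = 0
    rw [h1 v.1 (hVZ v.2) a _ hD, map_zero]

end Tensor

end

end WSuper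

namespace WSuper

open scoped AddMonoidAlgebra


noncomputable section

section Shift

variable {m n : ℕ} {b : Bool}

/-- Multiplication of a monomial by `t_i^c`. -/
def shf (i : Fin m) (c : ℤ) (x : ABasis m n) : ABasis m n := (c • Pi.single i 1 + x.1, x.2)

lemma shf_add (i : Fin m) (c d : ℤ) (x : ABasis m n) : shf i (c + d) x = shf i c (shf i d x) := by
  simp [shf, add_smul, add_assoc]

lemma shf_zero (i : Fin m) (x : ABasis m n) : shf i 0 x = x := by simp [shf]

lemma apar_shf (i : Fin m) (c : ℤ) (x : ABasis m n) : apar (shf i c x) = apar x := rfl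

lemma mulA_shf (i : Fin m) (c d : ℤ) (x y : ABasis m n) :
    mulA (asng (shf i c x)) (asng (shf i d y)) = mulA (asng x) (asng (shf i (c + d) y)) := by
  simp only [mulA_asng, amulB, shf]
  congr 3
  module

lemma derD_shf (D : Dir m n b) (i : Fin m) (y : ABasis m n) : ∃ (a0 a1 : ℂ) (y1 : ABasis m n),
    ∀ x : ℤ, derD D (asng (shf i x y)) = (a0 + a1 * x) • asng (shf i x y1) := by
  cases D with
  | di j =>
    refine ⟨y.1 j, (Pi.single i 1 : LExp m) j, y, fun x => ?_⟩
    rw [derD_di]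
    simp only [shf, Pi.add_apply, Pi.smul_apply, smul_eq_mul]
    congr 1; push_cast; ring
  | pa α => exact ⟨derC α y.2, 0, (y.1, derE α y.2), fun x => by rw [derD_pa]; simp [shf]⟩
  | d0 => exact ⟨0, 0, y, fun x => by simp⟩

/-- The power `t_i^c`. -/
def tpow (i : Fin m) (c : ℤ) : AAlg m n := asng (shf i c (0, fun _ => false))

lemma mulA_tpow (i : Fin m) (c : ℤ) (x : ABasis m n) : mulA (tpow i c) (asng x) = asng (shf i c x) := by
  simp [tpow, shf, amulB, zero_xorE]

lemma wmul_tpow_emb (i : Fin m) (c : ℤ) (D : Dir m n b) (x : ABasis m n) :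
    wmul (tpow i c) (emb D (asng x)) = emb D (asng (shf i c x)) := by
  rw [wmul_emb, mulA_tpow]

lemma wmul_tpow_add (i : Fin m) (c d : ℤ) (w : W m n b) :
    wmul (tpow i (c + d)) w = wmul (tpow i c) (wmul (tpow i d) w) := by
  rw [← wmul_mulA, tpow, shf_add, ← mulA_tpow]
  rfl

lemma wmul_tpow_zero (i : Fin m) (w : W m n b) : wmul (tpow i 0) w = w := by
  induction w using W_ind_emb with
  | zero => simp
  | add f f' hf hf' => simp only [map_add, hf, hf']
  | smul c f hf => simp only [map_smul, hf]
  | emb D f => rw [tpow, shf_zero, wmul_emb]; exact congrArg _ (one_mulA f)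

/-- The superbracket of shifted monomial vector fields. -/
lemma brL_shf (D D' : Dir m n b) (i : Fin m) (y y' : ABasis m n) :
    ∃ (p0 p1 q0 q1 : ℂ) (P Q : W m n b), ∀ x z : ℤ,
      brL (emb D (asng (shf i z y))) (emb D' (asng (shf i x y')))
        = (p0 + p1 * x) • wmul (tpow i (x + z)) P + (q0 + q1 * z) • wmul (tpow i (x + z)) Q := by
  obtain ⟨p0, p1, y1', h1⟩ := derD_shf D i y'
  obtain ⟨q0, q1, y1, h2⟩ := derD_shf D' i y
  refine ⟨p0, p1, q0, q1, emb D' (mulA (asng y) (asng y1')),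
    (-((-1 : ℂ) ^ ((apar y + dpar D) * (apar y' + dpar D')))) • emb D (mulA (asng y') (asng y1)),
    fun x z => ?_⟩
  have h3 (c : ℤ) (u w : ABasis m n) :
      mulA (tpow i c) (mulA (asng u) (asng w)) = mulA (asng u) (asng (shf i c w)) := by
    simp only [mulA_asng, amulB, map_smul, mulA_tpow, shf]
    congr 3
    abel
  rw [brL_emb, h1, h2]
  simp only [map_smul, mulA_shf, apar_shf, add_comm z x, wmul_emb, h3]
  module

end Shift

section Omega

variable {m n : ℕ} {b : Bool}

namespace WRep

variable (π : WRep m n b)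

/-- The action of a representation, valued in the ring of endomorphisms. -/
def E : W m n b →ₗ[ℂ] Module.End ℂ π.M := π.act

lemma E_brL (D D' : Dir m n b) (x y : ABasis m n) :
    π.E (brL (emb D (asng x)) (emb D' (asng y)))
      = π.E (emb D (asng x)) * π.E (emb D' (asng y))
        - ((-1 : ℂ) ^ ((apar x + dpar D) * (apar y + dpar D')))
          • (π.E (emb D' (asng y)) * π.E (emb D (asng x))) := by
  rw [emb_asng, emb_asng, brL_sng, ← par_emb_mul, mul_comm (apar x + dpar D), ← par_emb_mul,
    mul_comm (par _)]
  exact π.super _ _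

/-- The vector fields `t_i^c d_i`. -/
def eW (i : Fin m) (c : ℤ) : W m n b := emb (.di i) (asng (shf i c (0, fun _ => false)))

lemma E_eW_comm (i : Fin m) (D : Dir m n b) (x : ABasis m n) : ∃ η : ℂ, η + 1 ≠ 0 ∧ ∀ a c : ℤ,
    π.E (eW i a) * π.E (emb D (asng (shf i c x))) - π.E (emb D (asng (shf i c x))) * π.E (eW i a)
      = ((x.1 i : ℂ) + c - η * a) • π.E (emb D (asng (shf i (a + c) x))) := by
  have h0 (a : ℤ) : apar (shf i a ((0, fun _ => false) : ABasis m n)) = 0 := by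
    rw [apar_shf, apar, gdeg_zero]
  have h (a c : ℤ) := π.E_brL (.di i) D (shf i a (0, fun _ => false)) (shf i c x)
  simp only [h0, dpar, add_zero, zero_mul, pow_zero, one_smul, brL_emb] at h
  have h1 (a c : ℤ) : mulA (asng (shf i a (0, fun _ => false))) (derD (.di i : Dir m n b)
      (asng (shf i c x))) = ((x.1 i : ℂ) + c) • asng (shf i (a + c) x) := by
    rw [derD_di, map_smul, mulA_shf]
    congr 1
    · simp [shf, add_comm]
    · exact one_mulA _
  simp only [h1] at h
  cases D with
  | di j =>
    by_cases hj : i = j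
    · subst hj
      refine ⟨1, by norm_num, fun a c => ?_⟩
      have h2 : mulA (asng (shf i c x)) (asng (shf i a (0, fun _ => false)))
          = asng (shf i (a + c) x) := by
        rw [mulA_asng, amulB, shf, shf, shf]
        simp only [mulSgn_zero_right, one_smul, xorE_zero]
        congr 2
        module
      rw [eW, ← h, derD_di, map_smul, map_smul, map_smul, h2, ← sub_smul, map_smul]
      simp [shf]
    · refine ⟨0, by norm_num, fun a c => ?_⟩
      rw [eW, ← h, derD_di]
      simp [shf, hj]
  | pa α =>
    refine ⟨0, by norm_num, fun a c => ?_⟩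
    rw [eW, ← h, derD_pa]
    simp [shf, derC]
  | d0 =>
    refine ⟨0, by norm_num, fun a c => ?_⟩
    rw [eW, ← h, derD_d0]
    simp

lemma eW_eq_sng (i : Fin m) (k : ℤ) :
    (eW i k : W m n b) = sng (k • Pi.single i 1, fun _ => false, .di i) := by
  rw [eW, emb_asng]
  simp [shf]

/-- The vector fields `t_i^k d_i` satisfy the Witt relations. -/
lemma E_eW_witt (i : Fin m) (j k : ℤ) :
    π.E (eW i j) * π.E (eW i k) - π.E (eW i k) * π.E (eW i j)
      = ((k - j : ℤ) : ℂ) • π.E (eW i (j + k)) := by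
  have := π.super (j • Pi.single i 1, fun _ => false, .di i) (k • Pi.single i 1, fun _ => false, .di i)
  simp only [par, gdeg_zero, Nat.zero_mod, mul_zero, pow_zero, one_smul, brB] at this
  rw [eW_eq_sng, eW_eq_sng, eW_eq_sng]
  refine this.symm.trans ?_
  rw [← map_smul]
  change _ = π.act _
  congr 1
  simp [add_smul, xorE_zero, sub_smul]

lemma mem_wtG {π : WRep m n b} {lam : HIdx m b → ℂ} {v : π.M} :
    v ∈ wtG π.g lam ↔ ∀ h, π.act (sng (hB m n b h)) v = lam h • v := by
  simp [wtG, Submodule.mem_iInf, sub_eq_zero, g]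

lemma brB_hB (h : HIdx m b) (X : WBasis m n b) :
    brB (hB m n b h) X = (Sum.elim (fun i => (X.1 i : ℂ)) 0 h) • sng X := by
  obtain ⟨r, s, D⟩ := X
  rcases h with i | j
  · have h0 : hB m n b (.inl i) = (0, fun _ => false, .di i) := by cases b <;> rfl
    rw [h0]
    cases D <;> simp [brB, derC, zero_xorE, xorE_zero]
  · cases b
    · exact j.elim0
    · cases D <;> simp [hB, brB, derC]

lemma par_hB (h : HIdx m b) : par (hB m n b h) = 0 := by
  rcases h with i | j
  · cases b <;> simp [hB, par]
  · cases b
    · exact j.elim0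
    · simp [hB, par]

/-- The action of a basis element shifts weights. -/
lemma act_mem_wtG {lam : HIdx m b → ℂ} {v : π.M} (hv : v ∈ wtG π.g lam) (X : WBasis m n b) :
    π.act (sng X) v ∈ wtG π.g (lam + Sum.elim (fun i => (X.1 i : ℂ)) 0) := by
  rw [mem_wtG] at hv ⊢
  intro h
  have := congrArg (fun T => T v) (π.super (hB m n b h) X)
  simp only [par_hB, zero_mul, pow_zero, one_smul, brB_hB, map_smul, LinearMap.smul_apply,
    LinearMap.sub_apply, LinearMap.comp_apply, hv h] at this
  rw [Pi.add_apply, add_smul, this]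
  abel

/-- The graded Witt module through the weight `lam` in the direction `i`. -/
def witt (lam : HIdx m b → ℂ) (i : Fin m) (hfd : ∀ lam, FiniteDimensional ℂ (wtG π.g lam)) :
    GWitt π.M where
  e k := π.E (eW i k)
  he := π.E_eW_witt i
  lam := lam (.inl i)
  G j := wtG π.g (lam + Sum.elim (fun l => ((j • Pi.single i 1 : LExp m) l : ℂ)) 0)
  map k j v hv := by
    have := π.act_mem_wtG hv (k • Pi.single i 1, fun _ => false, .di i)
    rw [eW_eq_sng]
    change π.act _ v ∈ _
    convert this using 2
    funext h
    rcases h with l | l <;> simp [add_mul, add_assoc]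
  wt j v hv := by
    have := mem_wtG.1 hv (.inl i)
    rw [eW_eq_sng, zero_smul]
    have h0 : hB m n b (.inl i) = (0, fun _ => false, .di i) := by cases b <;> rfl
    rw [h0] at this
    refine this.trans ?_
    simp
  fd j := hfd _

end WRep

/-- On strongly cuspidal modules with a fixed bound on the multiplicities, products of shifted
vector fields satisfy difference equations of a fixed order. -/
lemma exists_omega (C : ℕ) : ∃ N, 2 ≤ N ∧ ∀ π : WRep m n b, (⨆ lam, wtG π.g lam) = ⊤ →
    (∀ lam, FiniteDimensional ℂ (wtG π.g lam)) → (∀ lam, Module.finrank ℂ (wtG π.g lam) ≤ C) →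
    ∀ (i : Fin m) (D D' : Dir m n b) (x x' : ABasis m n) (g : AddMonoidAlgebra ℂ (ℤ × ℤ)),
      ev2 (fun c => π.E (emb D (asng (shf i c x)))) (fun c => π.E (emb D' (asng (shf i c x'))))
        ((xA - xB) ^ N * g) = 0 := by
  obtain ⟨N, hN⟩ := rank_one_vanishing C
  refine ⟨N + 4, by omega, fun π hsup hfd hC i D D' x x' => ?_⟩
  have h1 : ∀ g, ev2 (fun c => π.E (WRep.eW i c)) (fun c => π.E (WRep.eW i c)) ((xA - xB) ^ N * g) = 0 := by
    refine ev2_eq_zero_of_Om (fun c => π.E (WRep.eW i c)) (fun c => π.E (WRep.eW i c)) N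
      (LinearMap.id : Module.End ℂ π.M →ₗ[ℂ] Module.End ℂ π.M) fun k s => ?_
    rw [LinearMap.id_apply]
    refine LinearMap.ker_eq_top.1 (top_unique (hsup.symm.le.trans (iSup_le fun lam v hv => ?_)))
    refine hN π.M (π.witt lam i hfd) (fun j => hC _) k s 0 v ?_
    change v ∈ wtG π.g _
    convert hv using 2
    funext h
    rcases h with l | l <;> simp
  obtain ⟨η, hη, h2⟩ := π.E_eW_comm i D x
  have h3 := ev2_vanish_left _ _ _ η hη h2 N h1
  obtain ⟨η', hη', h4⟩ := π.E_eW_comm i D' x'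
  obtain ⟨p0, p1, q0, q1, P, Q, hPQ⟩ := brL_shf D' D i x' x
  refine ev2_vanish_right _ _ _ (fun c => π.E (wmul (tpow i c) P))
    (fun c => π.E (wmul (tpow i c) Q))
    ((-1) ^ ((apar x' + dpar D') * (apar x + dpar D))) _ η' p0 p1 0 q0 0 q1 hη' (by simp) h4
    (fun y z => ?_) (N + 2) h3
  have := π.E_brL D' D (shf i z x') (shf i y x)
  rw [hPQ, apar_shf, apar_shf, map_add, map_smul, map_smul] at this
  rw [eq_comm, sub_eq_iff_eq_add] at this
  rw [this]
  module

end Omega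

end

end WSuper

namespace WSuper


noncomputable section

section Coinduced

variable {m n : ℕ} {b : Bool}

lemma twA_Der (k : ℕ) (X : WBasis m n b) (f : AAlg m n) :
    twA k (Der (sng X) f) = ((-1 : ℂ) ^ (k * par X)) • Der (sng X) (twA k f) := by
  rw [sng_eq_emb, Der_emb, Der_emb, twA_mulA, twA_derD, twA_asng]
  simp only [map_smul, LinearMap.smul_apply, smul_smul]
  congr 1
  have := par_emb_mul k X.2.2 (X.1, X.2.1)
  rw [mul_add, pow_add] at this
  rw [this, mul_comm]

lemma twW_brB (k : ℕ) (X Y : WBasis m n b) :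
    twW k (brB X Y) = ((-1 : ℂ) ^ (k * (par X + par Y))) • brB X Y := by
  have hX := par_emb_mul k X.2.2 (X.1, X.2.1)
  have hY := par_emb_mul k Y.2.2 (Y.1, Y.2.1)
  rw [mul_add, pow_add] at hX hY
  rw [mul_add, pow_add]
  change _ = ((-1 : ℂ) ^ (k * par (X.1, X.2.1, X.2.2)) * (-1 : ℂ) ^ (k * par (Y.1, Y.2.1, Y.2.2))) • _
  rw [← brL_sng, sng_eq_emb X, sng_eq_emb Y, brL_emb, hX, hY]
  simp only [map_sub, map_smul, twW_emb, twA_mulA, twA_derD, twA_asng, LinearMap.smul_apply,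
    smul_smul, smul_sub]
  congr 2 <;> ring

/-- Precomposition and postcomposition: the action of a basis vector field on `Hom(A, M)`. -/
def coindB (π : WRep m n b) (X : WBasis m n b) :
    (AAlg m n →ₗ[ℂ] π.M) →ₗ[ℂ] (AAlg m n →ₗ[ℂ] π.M) where
  toFun φ := π.act (sng X) ∘ₗ φ ∘ₗ twA (par X) - φ ∘ₗ Der (sng X) ∘ₗ twA (par X)
  map_add' φ ψ := by ext; simp; abel
  map_smul' c φ := by ext; simp [smul_sub]

/-- The `V`-module `Hom(A, M)`. -/
def coindAct (π : WRep m n b) :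
    W m n b →ₗ[ℂ] (AAlg m n →ₗ[ℂ] π.M) →ₗ[ℂ] (AAlg m n →ₗ[ℂ] π.M) :=
  Finsupp.linearCombination ℂ (coindB π)

lemma coindAct_sng (π : WRep m n b) (X : WBasis m n b) (φ : AAlg m n →ₗ[ℂ] π.M) (f : AAlg m n) :
    coindAct π (sng X) φ f = π.act (sng X) (φ (twA (par X) f)) - φ (Der (sng X) (twA (par X) f)) := by
  simp [coindAct, sng, coindB]

lemma coindAct_asng (π : WRep m n b) (w : W m n b) (φ : AAlg m n →ₗ[ℂ] π.M) (x : ABasis m n) :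
    coindAct π w φ (asng x)
      = π.act (twW (apar x) w) (φ (asng x)) - φ (Der (twW (apar x) w) (asng x)) := by
  induction w using W_ind with
  | zero => simp
  | add f f' hf hf' => simp only [map_add, hf, hf', LinearMap.add_apply]; abel
  | smul c f hf => simp only [map_smul, hf, LinearMap.smul_apply, smul_sub]
  | mon X => rw [coindAct_sng]; simp [mul_comm (par X)]

/-- The action of `A` on `Hom(A, M)`. -/
def coindMul (π : WRep m n b) :
    AAlg m n →ₗ[ℂ] (AAlg m n →ₗ[ℂ] π.M) →ₗ[ℂ] (AAlg m n →ₗ[ℂ] π.M) :=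
  LinearMap.mk₂ ℂ (fun g φ => φ ∘ₗ mulA.flip g) (fun g g' φ => by ext; simp)
    (fun c g φ => by ext; simp) (fun g φ ψ => by ext; simp) (fun c g φ => by ext; simp)

lemma coindMul_apply (π : WRep m n b) (g : AAlg m n) (φ : AAlg m n →ₗ[ℂ] π.M) (f : AAlg m n) :
    coindMul π g φ f = φ (mulA f g) := rfl

/-- The `AV`-module `Hom(A, M)`. -/
abbrev coind (π : WRep m n b) : AVRep m n b where
  M := AAlg m n →ₗ[ℂ] π.M
  act := coindAct π
  super X Y := by
    refine LinearMap.ext fun φ => A_ext fun x => ?_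
    rw [coindAct_asng, twW_brB, map_smul, map_smul, π.super, LinearMap.smul_apply,
      LinearMap.smul_apply, Der_brL]
    simp only [LinearMap.sub_apply, LinearMap.smul_apply, LinearMap.comp_apply, coindAct_sng,
      map_smul, twA_asng, twA_Der, map_sub]
    rcases apar_lt x with hx | hx <;> rcases Nat.even_or_odd (par X) with hX | hX <;>
    rcases Nat.even_or_odd (par Y) with hY | hY <;>
    simp [hx, hX.neg_one_pow, hY.neg_one_pow, pow_add, pow_mul] <;> abel
  aact := coindMul π
  aact_one := by
    refine LinearMap.ext fun φ => LinearMap.ext fun f => ?_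
    rw [coindMul_apply, mulA_one, LinearMap.id_apply]
  aact_mul x y := by
    refine LinearMap.ext fun φ => LinearMap.ext fun f => ?_
    rw [LinearMap.comp_apply, coindMul_apply, coindMul_apply, coindMul_apply, mulA_assoc, mulA_asng]
  leibniz X g := by
    refine LinearMap.ext fun φ => A_ext fun x => ?_
    simp only [LinearMap.add_apply, LinearMap.smul_apply, LinearMap.comp_apply, coindAct_sng,
      coindMul_apply, twA_mulA, twA_asng, map_smul, ← Der_sng, Der_mulA, map_add]
    rcases apar_lt x with hx | hx <;> rcases apar_lt g with hg | hg <;>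
    rcases Nat.even_or_odd (par X) with hX | hX <;>
    simp [hx, hg, hX.neg_one_pow, pow_add, pow_mul] <;> abel

lemma WRep.act_brL (π : WRep m n b) (Y : WBasis m n b) (Z : W m n b) (v : π.M) :
    π.act (brL (sng Y) Z) v
      = π.act (sng Y) (π.act Z v) - π.act (twW (par Y) Z) (π.act (sng Y) v) := by
  induction Z using W_ind with
  | zero => simp
  | add f f' hf hf' => simp only [map_add, LinearMap.add_apply, hf, hf']; abel
  | smul c f hf => simp only [map_smul, LinearMap.smul_apply, hf, smul_sub]
  | mon Z =>
    rw [brL_sng, twW_sng, map_smul, π.super]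
    rfl

/-- The element of `Hom(A, M)` given by `f ↦ (f w) v`. -/
def psi (π : WRep m n b) : W m n b →ₗ[ℂ] π.M →ₗ[ℂ] (AAlg m n →ₗ[ℂ] π.M) :=
  LinearMap.mk₂ ℂ (fun w v => LinearMap.flip π.act v ∘ₗ wmul.flip w)
    (fun w w' v => LinearMap.ext fun f => by simp) (fun c w v => LinearMap.ext fun f => by simp)
    (fun w v v' => LinearMap.ext fun f => by simp) (fun c w v => LinearMap.ext fun f => by simp)

lemma psi_apply (π : WRep m n b) (w : W m n b) (v : π.M) (f : AAlg m n) :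
    psi π w v f = π.act (wmul f w) v := rfl

lemma X_psi (π : WRep m n b) (Y : WBasis m n b) (w : W m n b) (v : π.M) :
    (coind π).X (sng Y) (psi π w v)
      = psi π (brL (sng Y) w) v + psi π (twW (par Y) w) (π.act (sng Y) v) := by
  refine A_ext fun x => ?_
  change coindAct π (sng Y) _ _ = _
  have h := π.act_brL Y (wmul (asng x) w) v
  rw [brL_wmul, twW_wmul] at h
  simp only [coindAct_sng, LinearMap.add_apply, psi_apply, twA_asng, map_smul, LinearMap.smul_apply,
    map_add, ← Der_sng] at h ⊢
  rw [eq_sub_iff_add_eq] at h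
  rw [← h]
  simp only [smul_add, smul_smul, neg_one_pow_mul_self, one_smul]
  abel

lemma μ_psi (π : WRep m n b) (g : AAlg m n) (w : W m n b) (v : π.M) :
    (coind π).μ g (psi π w v) = psi π (wmul g w) v := by
  refine LinearMap.ext fun f => ?_
  change coindMul π g _ _ = _
  rw [coindMul_apply, psi_apply, psi_apply, wmul_mulA]

end Coinduced

end

end WSuper

namespace WSuper

open scoped AddMonoidAlgebra


noncomputable section

section Graded

variable {m n : ℕ} {b : Bool}

/-- The vector fields of degree `r`. -/
def WDeg (r : LExp m) : Submodule ℂ (W m n b) := Finsupp.supported ℂ ℂ {x | x.1 = r}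

lemma sng_mem_WDeg (x : WBasis m n b) : sng x ∈ WDeg x.1 := Finsupp.single_mem_supported _ _ rfl

lemma WDeg_induct {r : LExp m} {p : W m n b → Prop} (h0 : p 0) (hadd : ∀ w w', p w → p w' → p (w + w'))
    (hs : ∀ (c : ℂ) w, p w → p (c • w)) (hsng : ∀ y, p (sng (r, y))) {w : W m n b}
    (hw : w ∈ WDeg r) : p w := by
  rw [WDeg, Finsupp.supported_eq_span_single] at hw
  induction hw using Submodule.span_induction with
  | mem x hx => obtain ⟨⟨s, y⟩, rfl, rfl⟩ := hx; exact hsng y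
  | zero => exact h0
  | add x y _ _ hx hy => exact hadd x y hx hy
  | smul c x _ hx => exact hs c x hx

lemma brB_mem_WDeg (x y : WBasis m n b) : brB x y ∈ WDeg (x.1 + y.1) := by
  obtain ⟨r, s, D⟩ := x
  obtain ⟨r', s', D'⟩ := y
  have h (c : ℂ) (z : GExp n × Dir m n b) : c • sng (r + r', z) ∈ WDeg (r + r') :=
    Submodule.smul_mem _ _ (sng_mem_WDeg _)
  cases D <;> cases D' <;> simp only [brB]
  all_goals with_reducible first
    | exact Submodule.sub_mem _ (h _ _) (h _ _)
    | exact h _ _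
    | exact Submodule.zero_mem _

lemma wmul_mem_WDeg (a : ABasis m n) (x : WBasis m n b) : wmul (asng a) (sng x) ∈ WDeg (a.1 + x.1) := by
  rw [wmul_sng, mulA_asng, amulB, map_smul, emb_asng]
  exact Submodule.smul_mem _ _ (sng_mem_WDeg _)

end Graded

section Cover

variable {m n : ℕ} {b : Bool} (π : WRep m n b)

/-- The `h'`-weight of the degree `r`. -/
def wr (b : Bool) (r : LExp m) : HIdx m b → ℂ := Sum.elim (fun i => (r i : ℂ)) 0

lemma wr_add (r s : LExp m) : wr b (r + s) = wr b r + wr b s := by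
  funext h; rcases h with h | h <;> simp [wr]

/-- The weight space of weight `ν` of the cuspidal cover. -/
def coverU (ν : HIdx m b → ℂ) : Submodule ℂ (AAlg m n →ₗ[ℂ] π.M) :=
  Submodule.span ℂ {φ | ∃ x : WBasis m n b, ∃ v ∈ wtG π.g (ν - wr b x.1), φ = psi π (sng x) v}

lemma psi_mem {ν : HIdx m b → ℂ} {r : LExp m} {w : W m n b} (hw : w ∈ WDeg r) {v : π.M}
    (hv : v ∈ wtG π.g (ν - wr b r)) : psi π w v ∈ coverU π ν := by
  refine WDeg_induct (p := fun w => psi π w v ∈ coverU π ν) ?_ (fun w w' h h' => ?_)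
    (fun c w h => ?_) (fun y => Submodule.subset_span ⟨(r, y), v, hv, rfl⟩) hw
  · simp
  · rw [map_add, LinearMap.add_apply]; exact Submodule.add_mem _ h h'
  · rw [map_smul, LinearMap.smul_apply]; exact Submodule.smul_mem _ _ h

lemma coverU_induct {ν : HIdx m b → ℂ} (N : Submodule ℂ (AAlg m n →ₗ[ℂ] π.M))
    (h : ∀ x : WBasis m n b, ∀ v ∈ wtG π.g (ν - wr b x.1), psi π (sng x) v ∈ N) : coverU π ν ≤ N := by
  refine Submodule.span_le.2 ?_
  rintro _ ⟨x, v, hv, rfl⟩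
  exact h x v hv

/-- The difference equations satisfied by a module, in the form of `exists_omega`. -/
def OmegaVanish (N : ℕ) : Prop :=
  ∀ (i : Fin m) (D D' : Dir m n b) (x x' : ABasis m n) (g : AddMonoidAlgebra ℂ (ℤ × ℤ)),
      ev2 (fun c => π.E (emb D (asng (shf i c x)))) (fun c => π.E (emb D' (asng (shf i c x'))))
        ((xA - xB) ^ N * g) = 0

variable {π}

lemma OmegaVanish.psi_eq_zero {N : ℕ} (hΩ : OmegaVanish π N) (i : Fin m) (D D' : Dir m n b)
    (x x' : ABasis m n) (v : π.M) (g : AddMonoidAlgebra ℂ (ℤ × ℤ)) :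
    evl (fun p : ℤ × ℤ => psi π (emb D (asng (shf i p.1 x))) (π.act (emb D' (asng (shf i p.2 x'))) v))
      ((xA - xB) ^ N * g) = 0 := by
  refine A_ext fun a => ?_
  have h1 := evl_comp (LinearMap.applyₗ (R := ℂ) v : Module.End ℂ π.M →ₗ[ℂ] π.M)
    (fun p : ℤ × ℤ => π.E (emb D (asng (shf i p.1 (a.1 + x.1, xorE a.2 x.2))))
      * π.E (emb D' (asng (shf i p.2 x')))) ((xA - xB) ^ N * g)
  have h := hΩ i D D' (a.1 + x.1, xorE a.2 x.2) x' g
  rw [ev2] at h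
  rw [h, map_zero] at h1
  have h2 := evl_comp (LinearMap.applyₗ (R := ℂ) (M₂ := π.M) (asng a))
    (fun p : ℤ × ℤ => psi π (emb D (asng (shf i p.1 x))) (π.act (emb D' (asng (shf i p.2 x'))) v))
    ((xA - xB) ^ N * g)
  have h3 := evl_comp (mulSgn a.2 x.2 • (LinearMap.id : π.M →ₗ[ℂ] π.M))
    (fun p : ℤ × ℤ => LinearMap.applyₗ (R := ℂ) v (π.E (emb D (asng (shf i p.1
      (a.1 + x.1, xorE a.2 x.2)))) * π.E (emb D' (asng (shf i p.2 x'))))) ((xA - xB) ^ N * g)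
  rw [← h1, map_zero] at h3
  rw [LinearMap.applyₗ_apply_apply] at h2
  rw [h2, LinearMap.zero_apply, h3]
  congr 2
  funext p
  simp only [LinearMap.applyₗ_apply_apply, psi_apply, wmul_emb, mulA_asng, amulB, map_smul,
    LinearMap.smul_apply, LinearMap.id_apply, Module.End.mul_apply, shf]
  rw [add_left_comm]
  rfl

end Cover

end

end WSuper

namespace WSuper

open scoped AddMonoidAlgebra


noncomputable section

section Nilpotent

variable {m n : ℕ} {b : Bool}

lemma AVRep.Th_replicate (ρ : AVRep m n b) (i : Fin m) (k : ℕ) (Y : W m n b) :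
    ρ.Th (List.replicate k (.inl i)) Y = (-1 : ℂ) ^ k •
      evl (fun p : ℤ × ℤ => ρ.μ (tpow i p.1) * ρ.X (wmul (tpow i p.2) Y)) ((xA - xB) ^ k) := by
  induction k generalizing Y with
  | zero =>
    have : (1 : AddMonoidAlgebra ℂ (ℤ × ℤ)) = mon 0 := rfl
    simp only [List.replicate_zero, Th_nil, pow_zero, one_smul, this, evl_single]
    rw [Prod.fst_zero, Prod.snd_zero, wmul_tpow_zero, tpow, shf_zero]
    exact (one_mul _).symm.trans (congrArg (· * _) ρ.μ_one.symm)
  | succ k ih =>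
    have hg : (asng (gen (.inl i)) : AAlg m n) = tpow i 1 := by simp [tpow, gen, shf]
    have h1 (a c : ℤ) : ρ.μ (tpow i (a + c)) = ρ.μ (tpow i a) * ρ.μ (tpow i c) := by
      simp only [tpow, shf, add_zero, add_smul]
      exact ρ.tm_add _ _
    have h2 := evl_comp (LinearMap.mulLeft ℂ (ρ.μ (tpow i 1)))
      (fun p : ℤ × ℤ => ρ.μ (tpow i p.1) * ρ.X (wmul (tpow i p.2) Y)) ((xA - xB) ^ k)
    rw [LinearMap.mulLeft_apply] at h2
    rw [List.replicate_succ, AVRep.Th_cons, ih, ih, hg, mul_smul_comm, h2, pow_succ' (xA - xB), sub_mul,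
      map_sub, xA, xB, evl_mon_mul, evl_mon_mul]
    simp only [gpar, zero_mul, pow_zero, one_smul, LinearMap.mulLeft_apply, ← mul_assoc, ← h1,
      ← wmul_tpow_add, Prod.fst_add, Prod.snd_add, zero_add, add_comm _ (1 : ℤ), pow_succ]
    module

variable {π : WRep m n b}

lemma OmegaVanish.Th_psi {N : ℕ} (hN : 2 ≤ N) (hΩ : OmegaVanish π N) (i : Fin m) (Y : W m n b)
    (x : WBasis m n b) (v : π.M) :
    (coind π).Th (List.replicate N (.inl i)) Y (psi π (sng x) v) = 0 := by
  induction Y using W_ind_emb with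
  | zero => simp
  | add f f' hf hf' => simp only [map_add, LinearMap.add_apply, hf, hf', add_zero]
  | smul c f hf => rw [map_smul, LinearMap.smul_apply, hf, smul_zero]
  | emb D f =>
  induction f using A_ind with
  | zero => simp
  | add f f' hf hf' => simp only [map_add, LinearMap.add_apply, hf, hf', add_zero]
  | smul c f hf => rw [map_smul, map_smul, LinearMap.smul_apply, hf, smul_zero]
  | mon y =>
  obtain ⟨p0, p1, q0, q1, P, Q, hPQ⟩ := brL_shf D x.2.2 i y (x.1, x.2.1)
  have hx : emb x.2.2 (asng (shf i 0 (x.1, x.2.1))) = sng x := by rw [shf_zero, emb_asng]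
  rw [AVRep.Th_replicate, LinearMap.smul_apply]
  have h := evl_comp (LinearMap.applyₗ (R := ℂ) (psi π (sng x) v) :
      Module.End ℂ (coind π).M →ₗ[ℂ] (coind π).M)
    (fun p : ℤ × ℤ => (coind π).μ (tpow i p.1) * (coind π).X (wmul (tpow i p.2) (emb D (asng y))))
    ((xA - xB) ^ N)
  have h1 (p : ℤ × ℤ) : (LinearMap.applyₗ (R := ℂ) (psi π (sng x) v) :
      Module.End ℂ (coind π).M →ₗ[ℂ] (coind π).M)
      ((coind π).μ (tpow i p.1) * (coind π).X (wmul (tpow i p.2) (emb D (asng y))))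
      = (p0 • psi π (wmul (tpow i (p.1 + p.2)) P) v
        + (q0 + q1 * p.2) • psi π (wmul (tpow i (p.1 + p.2)) Q) v)
        + ((-1 : ℂ) ^ (par (y.1, y.2, D) * par x)) •
          psi π (emb x.2.2 (asng (shf i p.1 (x.1, x.2.1)))) (π.act (emb D (asng (shf i p.2 y))) v) := by
    have h2 := hPQ 0 p.2
    rw [hx] at h2
    have h3 : emb D (asng (shf i p.2 y)) = sng ((shf i p.2 y).1, y.2, D) := emb_asng _ _
    have h4 : par ((shf i p.2 y).1, y.2, D) = par (y.1, y.2, D) := by cases D <;> rfl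
    rw [LinearMap.applyₗ_apply_apply, Module.End.mul_apply, wmul_tpow_emb, h3, X_psi, ← h3, h2, map_add,
      μ_psi, μ_psi, twW_sng, map_smul, h4, wmul_sng, mulA_tpow]
    simp [wmul_tpow_add]
  rw [LinearMap.applyₗ_apply_apply] at h
  simp only [h1] at h
  rw [h, ← evl_add, ← evl_add]
  have e1 := evl_contract_sq ((AddMonoidHom.fst ℤ ℤ) + (AddMonoidHom.snd ℤ ℤ))
    (fun c => psi π (wmul (tpow i c) P) v) (fun _ => p0) 0 (1, 0) (0, 1) (by simp) (by simp)
    ((xA - xB) ^ (N - 2))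
  have e2 := evl_contract_sq ((AddMonoidHom.fst ℤ ℤ) + (AddMonoidHom.snd ℤ ℤ))
    (fun c => psi π (wmul (tpow i c) Q) v) (fun p => q0 + q1 * p.2) (-q1) (1, 0) (0, 1) (by simp)
    (fun a => by push_cast [Prod.snd_add]; ring) ((xA - xB) ^ (N - 2))
  have e3 := evl_comp (((-1 : ℂ) ^ (par (y.1, y.2, D) * par x)) •
      (LinearMap.id : (AAlg m n →ₗ[ℂ] π.M) →ₗ[ℂ] _))
    (fun p : ℤ × ℤ => psi π (emb x.2.2 (asng (shf i p.1 (x.1, x.2.1))))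
      (π.act (emb D (asng (shf i p.2 y))) v)) ((xA - xB) ^ N * 1)
  rw [hΩ.psi_eq_zero, map_zero, mul_one] at e3
  have e4 : (xA - xB) ^ N = (xA - xB) ^ 2 * (xA - xB) ^ (N - 2) := by
    rw [← pow_add, Nat.add_sub_cancel' hN]
  simp only [LinearMap.smul_apply, LinearMap.id_apply] at e3
  rw [← e3, e4]
  change _ • (evl _ ((mon (1, 0) - mon (0, 1)) ^ 2 * _) + evl _ ((mon (1, 0) - mon (0, 1)) ^ 2 * _)
    + _) = _
  simp only [AddMonoidHom.add_apply, AddMonoidHom.coe_fst, AddMonoidHom.coe_snd] at e1 e2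
  rw [e1, e2, add_zero, add_zero, smul_zero]

end Nilpotent

end

end WSuper

namespace WSuper

open scoped AddMonoidAlgebra


noncomputable section

section CoverFinite

variable {m n : ℕ} {b : Bool}

instance : Finite (Dir m n b) := by
  refine Finite.of_injective (β := Option (Fin m ⊕ Fin n)) (fun D => match D with
    | .di i => some (.inl i)
    | .pa α => some (.inr α)
    | .d0 => none) ?_
  intro D D' h
  cases D <;> cases D' <;> simp_all

variable {π : WRep m n b}

lemma act_mem_sub {ν : HIdx m b → ℂ} {r s t : LExp m} (h : r = t + s) {v : π.M}
    (hv : v ∈ wtG π.g (ν - wr b r)) {X : WBasis m n b} (hX : X.1 = s) :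
    π.act (sng X) v ∈ wtG π.g (ν - wr b t) := by
  have h1 := π.act_mem_wtG hv X
  have h2 : ν - wr b r + Sum.elim (fun i => (X.1 i : ℂ)) 0 = ν - wr b t := by
    change ν - wr b r + wr b X.1 = _
    rw [h, wr_add, hX]; abel
  rwa [h2] at h1

lemma hB_inl (i : Fin m) : hB m n b (.inl i) = (0, fun _ => false, .di i) := by cases b <;> rfl

/-- The finite set of degrees generating a weight space of the cuspidal cover. -/
def coverDeg (N : ℕ) (ν : HIdx m b → ℂ) : Set (LExp m) :=
  {s | ∀ i, (s i).natAbs ≤ N} ∪ {s | ∀ i, (s i : ℂ) = ν (.inl i)}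

lemma finite_coverDeg (N : ℕ) (ν : HIdx m b → ℂ) : (coverDeg N ν).Finite := by
  refine Set.Finite.union ?_ (Set.Subsingleton.finite fun s hs t ht => ?_)
  · refine (Set.finite_Icc (fun _ => -(N : ℤ) : LExp m) (fun _ => (N : ℤ))).subset fun s hs => ?_
    have hs' : ∀ i, (s i).natAbs ≤ N := hs
    exact ⟨fun i => by have := hs' i; simp only; omega, fun i => by have := hs' i; simp only; omega⟩
  · funext i
    exact_mod_cast (hs i).trans (ht i).symm

lemma OmegaVanish.psi_mem_of_large {N : ℕ} (hΩ : OmegaVanish π N) {ν : HIdx m b → ℂ}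
    (U : Submodule ℂ (AAlg m n →ₗ[ℂ] π.M)) {x : WBasis m n b} {v : π.M}
    (hv : v ∈ wtG π.g (ν - wr b x.1)) {i j : Fin m} (hi : N < (x.1 i).natAbs)
    (hj : (x.1 j : ℂ) ≠ ν (.inl j))
    (hU : ∀ e : ℤ, (x.1 i + e).natAbs < (x.1 i).natAbs →
      ∀ w ∈ wtG π.g (ν - wr b (e • Pi.single i 1 + x.1)),
        psi π (sng (e • Pi.single i 1 + x.1, x.2)) w ∈ U) :
    psi π (sng x) v ∈ U := by
  set F : ℤ × ℤ → (AAlg m n →ₗ[ℂ] π.M) := fun p =>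
    psi π (emb x.2.2 (asng (shf i p.1 (x.1, x.2.1))))
      (π.act (emb (.di j) (asng (shf i p.2 (0, fun _ => false)))) v) with hF
  have hF0 : F (0, 0) = (ν (.inl j) - x.1 j) • psi π (sng x) v := by
    have h := WRep.mem_wtG.1 hv (.inl j)
    rw [hB_inl] at h
    simp only [hF, shf_zero, emb_asng, h, map_smul]
    rfl
  have hmem (e d : ℤ) (hd : d = -e) (he : (x.1 i + e).natAbs < (x.1 i).natAbs) : F (e, d) ∈ U := by
    simp only [hF, emb_asng]
    refine hU e he _ (act_mem_sub (s := d • Pi.single i 1 + 0) ?_ hv rfl)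
    rw [hd]; module
  suffices h : F (0, 0) ∈ U by
    rw [hF0] at h
    exact (U.smul_mem_iff (sub_ne_zero.2 hj.symm)).1 h
  have hz (k s : ℤ) : evl F ((xA - xB) ^ N * mon (k - N, s)) = 0 := hΩ.psi_eq_zero i x.2.2 (.di j) (x.1, x.2.1) (0, fun _ => false) v
    (mon (k - N, s))
  rcases lt_or_ge (x.1 i) 0 with h0 | h0
  · have h1 := hz N (-N)
    rw [evl_sub_pow_mul_mon, Finset.sum_range_succ, add_eq_zero_iff_eq_neg'] at h1
    simp only [Nat.choose_self, sub_self, neg_add_cancel, Nat.cast_one, mul_one] at h1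
    refine (U.smul_mem_iff (pow_ne_zero N (by norm_num : (-1 : ℂ) ≠ 0))).1 ?_
    refine h1.symm ▸ U.neg_mem (U.sum_mem fun r hr => U.smul_mem _ (hmem _ _ (by ring) ?_))
    have := Finset.mem_range.1 hr
    omega
  · have h1 := hz 0 0
    rw [evl_sub_pow_mul_mon, Finset.sum_range_succ', add_eq_zero_iff_eq_neg'] at h1
    simp only [Nat.choose_zero_right, Nat.cast_zero, sub_self, pow_zero, add_zero, Nat.cast_one,
      mul_one, one_smul] at h1
    refine h1.symm ▸ U.neg_mem (U.sum_mem fun r hr => U.smul_mem _ (hmem _ _ (by ring) ?_))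
    have := Finset.mem_range.1 hr
    omega

lemma OmegaVanish.coverU_le {N : ℕ} (hΩ : OmegaVanish π N) (ν : HIdx m b → ℂ) :
    coverU π ν ≤ ⨆ p : coverDeg N ν × (GExp n × Dir m n b),
      (wtG π.g (ν - wr b p.1.1)).map (psi π (sng (p.1.1, p.2))) := by
  refine coverU_induct π _ fun x v hv => ?_
  induction hk : ∑ i, (x.1 i).natAbs using Nat.strong_induction_on generalizing x v with
  | _ k ih =>
  by_cases hx : x.1 ∈ coverDeg N ν
  · exact Submodule.mem_iSup_of_mem (⟨x.1, hx⟩, x.2) ⟨v, hv, rfl⟩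
  · simp only [coverDeg, Set.mem_union, Set.mem_ofPred_eq, not_or, not_forall, not_le] at hx
    obtain ⟨⟨i, hi⟩, j, hj⟩ := hx
    refine hΩ.psi_mem_of_large _ hv hi hj fun e he w hw => ?_
    refine ih _ ?_ (e • Pi.single i 1 + x.1, x.2) w hw rfl
    rw [← hk]
    refine Finset.sum_lt_sum (fun l _ => ?_) ⟨i, Finset.mem_univ _, ?_⟩
    · by_cases hl : l = i
      · subst hl
        simpa [add_comm] using he.le
      · simp [hl]
    · simpa [add_comm] using he

lemma OmegaVanish.finiteDimensional_coverU {N : ℕ} (hΩ : OmegaVanish π N)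
    (hfd : ∀ lam, FiniteDimensional ℂ (wtG π.g lam)) (ν : HIdx m b → ℂ) :
    FiniteDimensional ℂ (coverU π ν) := by
  have := (finite_coverDeg N ν).to_subtype
  exact Submodule.finiteDimensional_of_le (hΩ.coverU_le ν)

lemma X_hB_coverU {ν : HIdx m b → ℂ} (h : HIdx m b) {u : AAlg m n →ₗ[ℂ] π.M} (hu : u ∈ coverU π ν) :
    (coind π).X (sng (hB m n b h)) u = ν h • u := by
  suffices hle : coverU π ν ≤ LinearMap.ker ((coind π).X (sng (hB m n b h)) - ν h • LinearMap.id) from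
    sub_eq_zero.1 (LinearMap.mem_ker.1 (hle hu))
  refine coverU_induct π _ fun x v hv => ?_
  have h1 := WRep.mem_wtG.1 hv h
  rw [LinearMap.mem_ker, LinearMap.sub_apply, X_psi, brL_sng, WRep.brB_hB, WRep.par_hB, twW_zero, h1]
  change _ - ν h • psi π (sng x) v = 0
  simp only [map_smul, LinearMap.smul_apply, Pi.sub_apply, wr]
  module

/-- A weight space of the cuspidal cover, as the core of the coinduced module. -/
def OmegaVanish.core {N : ℕ} (hN : 2 ≤ N) (hΩ : OmegaVanish π N)
    (hfd : ∀ lam, FiniteDimensional ℂ (wtG π.g lam)) (ν : HIdx m b → ℂ) (hne : coverU π ν ≠ ⊥) :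
    Core (coind π) where
  U := coverU π ν
  fd := hΩ.finiteDimensional_coverU hfd ν
  ne := hne
  nu i := ν (.inl i)
  nu0 := match b, ν with
    | true, ν => ν (.inr (0 : Fin 1))
    | false, _ => 0
  d_apply i u hu := by
    rw [← hB_inl]
    exact X_hB_coverU _ hu
  d0_apply D hD u hu := by
    cases D with
    | di => simp [isder] at hD
    | pa => simp [isder] at hD
    | d0 => exact X_hB_coverU (b := true) (.inr (0 : Fin 1)) hu
  X_mem r s D u hu := by
    refine coverU_induct π ((coverU π ν).comap ((coind π).tm (-r) * (coind π).X (sng (r, s, D))))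
      (fun x v hv => ?_) hu
    rw [Submodule.mem_comap, Module.End.mul_apply, X_psi, brL_sng, twW_sng, map_add, map_smul,
      LinearMap.smul_apply, map_smul]
    refine Submodule.add_mem _ ?_ (Submodule.smul_mem _ _ ?_)
    · have := brB_mem_WDeg (r, s, D) x
      refine WDeg_induct (p := fun w => (coind π).tm (-r) (psi π w v) ∈ coverU π ν) (by simp)
        (fun w w' h h' => ?_) (fun c w h => ?_) (fun y => ?_) this
      · rw [map_add, LinearMap.add_apply, map_add]; exact Submodule.add_mem _ h h'
      · rw [map_smul, LinearMap.smul_apply, map_smul]; exact Submodule.smul_mem _ _ h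
      · rw [AVRep.tm, μ_psi]
        refine psi_mem π (wmul_mem_WDeg _ _) ?_
        simpa using hv
    · rw [AVRep.tm, μ_psi]
      refine psi_mem π (wmul_mem_WDeg _ _) (act_mem_sub (s := r) ?_ hv rfl)
      simp
  xi_mem α u hu := by
    refine coverU_induct π ((coverU π ν).comap ((coind π).μ (asng (0, gone α))))
      (fun x v hv => ?_) hu
    rw [Submodule.mem_comap, μ_psi]
    exact psi_mem π (wmul_mem_WDeg _ _) (by simpa using hv)
  N := N
  two_le := hN
  nilp u hu i Y := by
    exact coverU_induct π (LinearMap.ker ((coind π).Th (List.replicate N (.inl i)) Y))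
      (fun x v _ => hΩ.Th_psi hN i Y x v) hu

end CoverFinite

end

end WSuper

namespace WSuper


noncomputable section

section TensorQuotient

variable {m n : ℕ} {b : Bool} (π : WRep m n b)

lemma act_apply_asng (X : WBasis m n b) (u : AAlg m n →ₗ[ℂ] π.M) (a : ABasis m n) :
    π.act (sng X) (u (asng a)) = u (wOnA X a)
      + ((-1 : ℂ) ^ (par X * apar a)) • ((coind π).X (sng X) u : AAlg m n →ₗ[ℂ] π.M) (asng a) := by
  change _ = _ + _ • coindAct π (sng X) u (asng a)
  rw [coindAct_asng, twW_sng, map_smul, map_smul, LinearMap.smul_apply, LinearMap.smul_apply, map_smul,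
    ← smul_sub, smul_smul, mul_comm (par X), neg_one_pow_mul_self, one_smul, Der_sng]
  abel

lemma μ_apply_asng (h a : ABasis m n) (u : AAlg m n →ₗ[ℂ] π.M) :
    ((coind π).μ (asng h) u : AAlg m n →ₗ[ℂ] π.M) (asng a)
      = ((-1 : ℂ) ^ (gdeg h.2 * gdeg a.2) * mulSgn h.2 a.2) • u (asng (a.1 + h.1, xorE h.2 a.2)) := by
  change coindMul π (asng h) u (asng a) = _
  rw [coindMul_apply, mulA_asng_comm, apar_pow, mulA_asng, amulB, map_smul, map_smul, smul_smul,
    add_comm h.1]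

lemma derC_mul_neg_one_pow (α : Fin n) (s : GExp n) (k : ℕ) :
    derC α s * (-1 : ℂ) ^ (gdeg (derE α s) * k) = derC α s * ((-1) ^ k * (-1) ^ (gdeg s * k)) := by
  by_cases h : s α = true
  · have := gsgn_derE h
    rw [pow_mul, pow_mul, ← gsgn, ← gsgn, this, neg_pow]
  · simp [derC, h]

/-- The evaluation map from a tensor module, given a family of functionals on `A`. -/
def evalT {σ : GlRep m n} (ι : σ.V →ₗ[ℂ] (AAlg m n →ₗ[ℂ] π.M)) : TModule σ →ₗ[ℂ] π.M :=
  Finsupp.lsum ℂ fun a => LinearMap.applyₗ (asng a) ∘ₗ ι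

lemma evalT_single {σ : GlRep m n} (ι : σ.V →ₗ[ℂ] (AAlg m n →ₗ[ℂ] π.M)) (a : ABasis m n) (v : σ.V) :
    evalT π ι (Finsupp.single a v) = ι v (asng a) := by
  simp [evalT]

variable {π}

lemma evalT_tmAct (K : Core (coind π)) {σ : GlRep m n} (ι : σ.V →ₗ[ℂ] (AAlg m n →ₗ[ℂ] π.M))
    (hdi : ∀ r s j v, (coind π).X (sng (r, s, .di j)) (ι v) = K.nu j • (coind π).μ (asng (r, s)) (ι v)
      + ((∑ i, (r i : ℂ) • (coind π).μ (asng (r, s)) (ι (σ.ρ (.inl i) (.inl j) v)))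
      + ∑ α, ((-1) ^ (gdeg s + 1) * derC α s) •
          (coind π).μ (asng (r, derE α s)) (ι (σ.ρ (.inr α) (.inl j) v))))
    (hpa : ∀ r s β v, (coind π).X (sng (r, s, .pa β)) (ι v) =
      (∑ i, (r i : ℂ) • (coind π).μ (asng (r, s)) (ι (σ.ρ (.inl i) (.inr β) v)))
      + ∑ α, ((-1) ^ (gdeg s + 1) * derC α s) •
          (coind π).μ (asng (r, derE α s)) (ι (σ.ρ (.inr α) (.inr β) v)))
    (hd0 : ∀ r s D v, isder D = 0 →
      (coind π).X (sng (r, s, D)) (ι v) = K.nu0 • (coind π).μ (asng (r, s)) (ι v))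
    (x : WBasis m n b) (u : TModule σ) :
    evalT π ι (tmAct σ K.nu K.nu0 x u) = π.act (sng x) (evalT π ι u) := by
  have hu : evalT π ι u = u.sum fun a v => ι v (asng a) := by simp [evalT, Finsupp.sum]
  have sq (k : ℕ) : (-1 : ℂ) ^ k * (-1) ^ k = 1 := neg_one_pow_mul_self k
  have sg (k l : ℕ) : (-1 : ℂ) ^ (k % 2 * (l % 2)) = (-1) ^ (k * l) := by
    rw [pow_mul, ← neg_one_pow_eq_pow_mod_two, ← pow_mul, mul_comm, pow_mul, ← neg_one_pow_eq_pow_mod_two,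
      ← pow_mul, mul_comm]
  obtain ⟨s, f, D⟩ := x
  rw [hu, map_finsuppSum]
  cases D with
  | di j =>
    rw [tmAct, map_finsuppSum]
    refine Finsupp.sum_congr fun a _ => ?_
    have e := sq (gdeg f * gdeg a.2)
    have e' := sq (gdeg a.2)
    have h (α : Fin n) := derC_mul_neg_one_pow α f (gdeg a.2)
    rw [act_apply_asng, hdi]
    simp only [LinearMap.add_apply, LinearMap.smul_apply, LinearMap.sum_apply, map_add, map_sum, map_smul,
      evalT_single, wOnA, smul_add, Finset.smul_sum, smul_smul, par, apar, sg, add_comm s]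
    rw [add_mul, add_smul, add_assoc, add_assoc]
    refine congrArg₂ _ rfl (congrArg₂ _ ?_ (congrArg₂ _ (Finset.sum_congr rfl fun i _ => ?_)
      (Finset.sum_congr rfl fun α _ => ?_))) |> Eq.symm
    · refine (congrArg _ (μ_apply_asng π _ _ _)).trans ?_
      rw [smul_smul]
      congr 1
      dsimp only
      generalize (-1 : ℂ) ^ (gdeg f * gdeg a.2) = p at *
      linear_combination (K.nu j * mulSgn f a.2) * e
    · refine (congrArg _ (μ_apply_asng π _ _ _)).trans ?_
      rw [smul_smul]
      congr 1
      dsimp only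
      generalize (-1 : ℂ) ^ (gdeg f * gdeg a.2) = p at *
      linear_combination ((s i : ℂ) * mulSgn f a.2) * e
    · refine (congrArg _ (μ_apply_asng π _ _ _)).trans ?_
      rw [smul_smul]
      congr 1
      dsimp only
      generalize (-1 : ℂ) ^ (gdeg f * gdeg a.2) = p at *
      linear_combination p * (-1) ^ (gdeg f + 1) * mulSgn (derE α f) a.2 * h α
        + (-1) ^ gdeg a.2 * (-1) ^ (gdeg f + 1) * derC α f * mulSgn (derE α f) a.2 * e
  | pa β =>
    rw [tmAct, map_finsuppSum]
    refine Finsupp.sum_congr fun a _ => ?_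
    have e := sq (gdeg f * gdeg a.2)
    have e' := sq (gdeg a.2)
    have h (α : Fin n) := derC_mul_neg_one_pow α f (gdeg a.2)
    rw [act_apply_asng, hpa]
    simp only [LinearMap.add_apply, LinearMap.smul_apply, LinearMap.sum_apply, map_add, map_sum, map_smul,
      evalT_single, wOnA, smul_add, Finset.smul_sum, smul_smul, par, apar, sg, add_comm s]
    rw [add_assoc]
    refine congrArg₂ _ rfl (congrArg₂ _ (Finset.sum_congr rfl fun i _ => ?_)
      (Finset.sum_congr rfl fun α _ => ?_)) |> Eq.symm
    · refine (congrArg _ (μ_apply_asng π _ _ _)).trans ?_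
      rw [smul_smul]
      congr 1
      simp only [add_mul, one_mul, pow_add, pow_one]
      generalize (-1 : ℂ) ^ (gdeg f * gdeg a.2) = p at *
      linear_combination ((s i : ℂ) * mulSgn f a.2 * (-1) ^ gdeg a.2) * e
    · refine (congrArg _ (μ_apply_asng π _ _ _)).trans ?_
      rw [smul_smul]
      congr 1
      simp only [add_mul, one_mul, pow_add, pow_one]
      generalize (-1 : ℂ) ^ (gdeg f * gdeg a.2) = p at *
      linear_combination p * (-1) ^ gdeg a.2 * (-1) ^ (gdeg f + 1) * mulSgn (derE α f) a.2 * h α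
        + (-1) ^ (gdeg f + 1) * derC α f * mulSgn (derE α f) a.2 * (p * p * e' + e)
  | d0 =>
    rw [tmAct, map_finsuppSum]
    refine Finsupp.sum_congr fun a _ => ?_
    have e := sq (gdeg f * gdeg a.2)
    have e' := sq (gdeg a.2)
    have h (α : Fin n) := derC_mul_neg_one_pow α f (gdeg a.2)
    rw [act_apply_asng, hd0 _ _ _ _ rfl]
    simp only [LinearMap.add_apply, LinearMap.smul_apply, LinearMap.sum_apply, map_add, map_sum, map_smul,
      evalT_single, wOnA, smul_add, Finset.smul_sum, smul_smul, par, apar, sg, add_comm s]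
    rw [map_zero, zero_add]
    refine Eq.symm ?_
    refine (congrArg _ (μ_apply_asng π _ _ _)).trans ?_
    rw [smul_smul]
    congr 1
    dsimp only
    generalize (-1 : ℂ) ^ (gdeg f * gdeg a.2) = p at *
    linear_combination (K.nu0 * mulSgn f a.2) * e

end TensorQuotient

end

end WSuper

namespace WSuper


noncomputable section

section CoverNonzero

variable {m n : ℕ} {b : Bool} {π : WRep m n b}

lemma exists_coverU_ne_bot (hsup : (⨆ lam, wtG π.g lam) = ⊤)
    (hnontriv : ∃ (x : WBasis m n b) (v : π.M), π.g x v ≠ 0) : ∃ ν, coverU π ν ≠ ⊥ := by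
  obtain ⟨x, v, hv⟩ := hnontriv
  obtain ⟨lam, hlam⟩ : ∃ lam, ¬ wtG π.g lam ≤ LinearMap.ker (π.g x) := by
    by_contra! h
    exact hv (LinearMap.mem_ker.1 (iSup_le h (hsup ▸ Submodule.mem_top)))
  obtain ⟨w, hw, hw0⟩ := SetLike.not_le_iff_exists.1 hlam
  refine ⟨lam + wr b x.1, fun h => hw0 ?_⟩
  have h1 := psi_mem π (ν := lam + wr b x.1) (sng_mem_WDeg x) (by simpa using hw)
  rw [h, Submodule.mem_bot] at h1
  have h2 := congrArg (fun u : AAlg m n →ₗ[ℂ] π.M => u (aone m n)) h1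
  simp only [psi_apply] at h2
  rw [sng_eq_emb, wmul_emb, one_mulA, ← sng_eq_emb] at h2
  exact h2

end CoverNonzero

end

end WSuper

namespace WSuper

/-- Every non-trivial simple cuspidal strong Harish-Chandra
(i.e. strongly cuspidal) module for `V = W(m,n)` (`b = false`) or
`V = W(m,n) ⋉ A d_0` (`b = true`) is a quotient of a tensor `AV`-module:
there is a finite-dimensional simple `gl(m,n)`-module `V'`, weights
`λ ∈ ℂ^m`, `λ_0 ∈ ℂ`, and a surjective `V`-module homomorphism from the tensor
module `T(V', λ)` (with `f d_0` acting as multiplication by `λ_0 f` in the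
extended case) onto `M`. -/
theorem simple_stronglyCuspidal_is_tensor_quotient (m n : ℕ) (b : Bool)
    (ρ : WRep m n b)
    (hnontriv : ∃ (x : WBasis m n b) (v : ρ.M), ρ.g x v ≠ 0)
    (hsimple : IsSimpleG ρ.g) (hcusp : IsStronglyCuspidalG ρ.g) :
    ∃ σ : GlRep m n, FiniteDimensional ℂ σ.V ∧ σ.IsSimple ∧
      ∃ (lam : Fin m → ℂ) (lam0 : ℂ) (φ : TModule σ →ₗ[ℂ] ρ.M),
        Function.Surjective φ ∧
        ∀ (x : WBasis m n b) (u : TModule σ),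
          φ (tmAct σ lam lam0 x u) = ρ.act (sng x) (φ u) := by
  obtain ⟨⟨hsup, hfd⟩, C, hC⟩ := hcusp
  obtain ⟨N, hN, hΩ⟩ := exists_omega (m := m) (n := n) (b := b) C
  obtain ⟨ν, hν⟩ := exists_coverU_ne_bot hsup hnontriv
  let K := OmegaVanish.core hN (hΩ ρ hsup hfd hC) hfd ν hν
  obtain ⟨σ, ι, hσ, hσs, hι, -, hdi, hpa, hd0⟩ := K.exists_gl
  have hφ := evalT_tmAct K ι hdi hpa hd0
  refine ⟨σ, hσ, hσs, K.nu, K.nu0, evalT ρ ι, ?_, hφ⟩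
  obtain ⟨v, hv⟩ := hσs.1
  refine LinearMap.range_eq_top.1 ((hsimple.2 (LinearMap.range (evalT ρ ι)) ?_).resolve_left fun h => hv ?_)
  · rintro x _ ⟨u, rfl⟩
    exact ⟨_, hφ x u⟩
  · refine hι (Eq.trans (A_ext fun a => ?_) (map_zero ι).symm)
    rw [← evalT_single, LinearMap.range_eq_bot.1 h]
    rfl

end WSuper
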